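/- Assume the Riemann hypothesis. Let f be a fake μ defined via the sequence (ε_j), and suppose there is an integer k ≥ 1 with ε_j = 0 for 1 ≤ j ≤ k−1 and ε_k ≠ 0, where moreover k ≥ 2 if ε_k = 1 (so f is of Möbius-type or powerfull-type with initial index k). Then there exist a constant C > 0 and real polynomials P_k,…,P_{2k−1} such that for all sufficiently large x: |F_f(x) − Σ_{j=k}^{2k−1} P_j(log x) x^{1/j}| ≤ x^{1/(2k)} exp(C log x / log log x). -/

import Mathlib

open Filter

lemma integrable_one_add_abs_rpow {r : ℝ} (hr : 1 < r) :
    MeasureTheory.Integrable (fun t : ℝ => (1 + |t|) ^ (-r)) := by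
  have := integrable_one_add_norm (E := ℝ) (μ := MeasureTheory.volume) (r := r) (by simpa using hr)
  simpa [Real.norm_eq_abs] using this

/-- Moving the line of integration across a vertical strip. -/
lemma integral_vertical_eq_of_strip {H : ℂ → ℂ} {a b C : ℝ} (hab : a ≤ b)
    (hd : DifferentiableOn ℂ H {z | a ≤ z.re ∧ z.re ≤ b})
    (hb : ∀ z : ℂ, a ≤ z.re → z.re ≤ b → ‖H z‖ ≤ C * (1 + |z.im|) ^ (-(5 / 4) : ℝ)) :
    ∫ t : ℝ, H (a + t * Complex.I) = ∫ t : ℝ, H (b + t * Complex.I) := by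
  have hInt : ∀ c : ℝ, a ≤ c → c ≤ b →
      MeasureTheory.Integrable (fun t : ℝ => H (c + t * Complex.I)) := by
    intro c h1 h2
    refine MeasureTheory.Integrable.mono' (g := fun t : ℝ => C * (1 + |t|) ^ (-(5 / 4) : ℝ))
      ((integrable_one_add_abs_rpow (by norm_num)).const_mul C) ?_ ?_
    · refine Continuous.aestronglyMeasurable ?_
      refine hd.continuousOn.comp_continuous (by fun_prop) ?_
      intro t
      simp [h1, h2]
    · refine Eventually.of_forall fun t => ?_
      simpa using hb (c + t * Complex.I) (by simpa using h1) (by simpa using h2)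
  have ha := MeasureTheory.intervalIntegral_tendsto_integral (hInt a le_rfl hab)
    tendsto_neg_atTop_atBot tendsto_id
  have hb' := MeasureTheory.intervalIntegral_tendsto_integral (hInt b hab le_rfl)
    tendsto_neg_atTop_atBot tendsto_id
  have hsub := ((hb'.const_smul Complex.I).sub (ha.const_smul Complex.I))
  have hhor : ∀ e : ℝ, |e| = 1 → Tendsto (fun T : ℝ =>
      ∫ x : ℝ in a..b, H (x + (e * T : ℝ) * Complex.I)) atTop (nhds 0) := by
    intro e he
    have hlim : Tendsto (fun T : ℝ => C * (1 + T) ^ (-(5 / 4) : ℝ) * |b - a|) atTop (nhds 0) := by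
      have h1 : Tendsto (fun T : ℝ => (1 + T) ^ (-(5 / 4) : ℝ)) atTop (nhds 0) :=
        (tendsto_rpow_neg_atTop (by norm_num : (0 : ℝ) < 5 / 4)).comp
          (tendsto_atTop_add_const_left _ _ tendsto_id)
      simpa using (h1.const_mul C).mul_const |b - a|
    refine squeeze_zero_norm' ?_ hlim
    filter_upwards [eventually_ge_atTop 0] with T hT
    refine intervalIntegral.norm_integral_le_of_norm_le_const ?_
    intro x hx
    rw [Set.uIoc_of_le hab] at hx
    have := hb (x + (e * T : ℝ) * Complex.I) (by simpa using hx.1.le) (by simpa using hx.2)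
    simpa [abs_mul, he, abs_of_nonneg hT] using this
  have h1 := (hhor (-1) (by simp)).sub (hhor 1 (by simp))
  have htot := h1.add hsub
  have hzero : ∀ T : ℝ,
      ((∫ x : ℝ in a..b, H (x + ((-1 : ℝ) * T : ℝ) * Complex.I)) -
        ∫ x : ℝ in a..b, H (x + ((1 : ℝ) * T : ℝ) * Complex.I)) +
      (Complex.I • (∫ t in (-T)..(id T), H (b + t * Complex.I)) -
        Complex.I • ∫ t in (-T)..(id T), H (a + t * Complex.I)) = 0 := by
    intro T
    have := Complex.integral_boundary_rect_eq_zero_of_differentiableOn H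
      ⟨a, -T⟩ ⟨b, T⟩ (hd.mono ?_)
    · rw [← add_sub_assoc]
      simpa using this
    · intro z hz
      have := hz.1
      simp only [Set.mem_preimage, Set.uIcc_of_le hab] at this
      exact this
  have h0 := tendsto_nhds_unique (htot.congr hzero) tendsto_const_nhds
  have : Complex.I • ((∫ t : ℝ, H (b + t * Complex.I)) - ∫ t : ℝ, H (a + t * Complex.I)) = 0 := by
    rw [smul_sub]; simpa using h0
  rw [smul_eq_zero] at this
  rcases this with h | h
  · exact absurd h Complex.I_ne_zero
  · exact (sub_eq_zero.mp h).symm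

/-- A function decaying in a right half-plane has vanishing integral over the boundary line. -/
lemma integral_vertical_eq_zero {H : ℂ → ℂ} {a C : ℝ}
    (hd : DifferentiableOn ℂ H {z | a ≤ z.re})
    (hb : ∀ z : ℂ, a ≤ z.re → ‖H z‖ ≤ C * (1 + ‖z‖) ^ (-(3 / 2) : ℝ)) :
    ∫ t : ℝ, H (a + t * Complex.I) = 0 := by
  have hC : 0 ≤ C := by
    have := (norm_nonneg _).trans (hb a (by simp))
    exact nonneg_of_mul_nonneg_left this (by positivity)
  have hb2 : ∀ z : ℂ, a ≤ z.re →
      ‖H z‖ ≤ C * (1 + |z.re|) ^ (-(1 / 4) : ℝ) * (1 + |z.im|) ^ (-(5 / 4) : ℝ) := by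
    intro z hz
    refine (hb z hz).trans ?_
    rw [mul_assoc]
    gcongr
    rw [show (-(3 / 2) : ℝ) = -(1 / 4) + -(5 / 4) by norm_num,
      Real.rpow_add (by positivity)]
    gcongr ?_ * ?_
    · exact Real.rpow_le_rpow_of_nonpos (by positivity)
        (by linarith [Complex.abs_re_le_norm z]) (by norm_num)
    · exact Real.rpow_le_rpow_of_nonpos (by positivity)
        (by linarith [Complex.abs_im_le_norm z]) (by norm_num)
  have heq : ∀ R : ℝ, a ≤ R →
      ∫ t : ℝ, H (a + t * Complex.I) = ∫ t : ℝ, H (R + t * Complex.I) := by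
    intro R hR
    refine integral_vertical_eq_of_strip (C := C) hR (hd.mono fun z hz => hz.1) ?_
    intro z h1 _
    refine (hb2 z h1).trans ?_
    gcongr
    refine mul_le_of_le_one_right hC ?_
    exact Real.rpow_le_one_of_one_le_of_nonpos (by linarith [abs_nonneg z.re]) (by norm_num)
  set I0 := ∫ t : ℝ, (1 + |t|) ^ (-(5 / 4) : ℝ)
  have hle : ∀ R : ℝ, a ≤ R →
      ‖∫ t : ℝ, H (a + t * Complex.I)‖ ≤ C * (1 + |R|) ^ (-(1 / 4) : ℝ) * I0 := by
    intro R hR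
    rw [heq R hR, ← MeasureTheory.integral_const_mul]
    refine MeasureTheory.norm_integral_le_of_norm_le
      ((integrable_one_add_abs_rpow (by norm_num)).const_mul _) (Eventually.of_forall fun t => ?_)
    simpa using hb2 (R + t * Complex.I) (by simpa using hR)
  have hlim : Tendsto (fun R : ℝ => C * (1 + |R|) ^ (-(1 / 4) : ℝ) * I0) atTop (nhds 0) := by
    have h1 : Tendsto (fun R : ℝ => (1 + |R|) ^ (-(1 / 4) : ℝ)) atTop (nhds 0) :=
      (tendsto_rpow_neg_atTop (by norm_num : (0 : ℝ) < 1 / 4)).comp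
        (tendsto_atTop_add_const_left _ _ tendsto_abs_atTop_atTop)
    simpa using (h1.const_mul C).mul_const I0
  have := ge_of_tendsto hlim (by filter_upwards [eventually_ge_atTop a] with R hR using hle R hR)
  exact norm_le_zero_iff.mp this

lemma exists_bound_of_bound_outside {H : ℂ → ℂ} {S : Set ℂ} (hS : IsClosed S)
    (hH : ContinuousOn H S) {C R r : ℝ}
    (hb : ∀ z ∈ S, R ≤ ‖z‖ → ‖H z‖ ≤ C * (1 + ‖z‖) ^ r) :
    ∃ C', ∀ z ∈ S, ‖H z‖ ≤ C' * (1 + ‖z‖) ^ r := by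
  have hK : IsCompact (S ∩ Metric.closedBall 0 R) := (isCompact_closedBall 0 R).inter_left hS
  have hc : ContinuousOn (fun z => ‖H z‖ / (1 + ‖z‖) ^ r) (S ∩ Metric.closedBall 0 R) := by
    refine ContinuousOn.div (hH.mono Set.inter_subset_left).norm ?_ ?_
    · refine Continuous.continuousOn ?_
      refine Continuous.rpow_const (by fun_prop) fun z => Or.inl ?_
      positivity
    · intro z _; positivity
  obtain ⟨B, hB⟩ := (hK.image_of_continuousOn hc).bddAbove
  refine ⟨max B C, fun z hz => ?_⟩
  by_cases h : R ≤ ‖z‖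
  · exact (hb z hz h).trans (by gcongr; exact le_max_right _ _)
  · have : ‖H z‖ / (1 + ‖z‖) ^ r ≤ B := hB ⟨z, ⟨hz, by simpa using (not_le.mp h).le⟩, rfl⟩
    rw [div_le_iff₀ (by positivity)] at this
    exact this.trans (by gcongr; exact le_max_left _ _)

/-- Integrability along a vertical line of a function decaying at infinity. -/
lemma integrable_vertical {H : ℂ → ℂ} {S : Set ℂ} {a C : ℝ} (hH : ContinuousOn H S)
    (hS : ∀ t : ℝ, (a + t * Complex.I : ℂ) ∈ S)
    (hb : ∀ z ∈ S, ‖H z‖ ≤ C * (1 + ‖z‖) ^ (-(3 / 2) : ℝ)) :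
    MeasureTheory.Integrable (fun t : ℝ => H (a + t * Complex.I)) := by
  refine MeasureTheory.Integrable.mono' (g := fun t : ℝ => C * (1 + |t|) ^ (-(3 / 2) : ℝ))
    ((integrable_one_add_abs_rpow (by norm_num)).const_mul C) ?_ ?_
  · exact (hH.comp_continuous (by fun_prop) hS).aestronglyMeasurable
  · refine Eventually.of_forall fun t => ?_
    have h1 := hb _ (hS t)
    have hC'0 : 0 ≤ C := by
      have := (norm_nonneg _).trans h1
      exact nonneg_of_mul_nonneg_left this (by positivity)
    refine h1.trans ?_
    gcongr ?_ * ?_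
    refine Real.rpow_le_rpow_of_nonpos (by positivity) ?_ (by norm_num)
    have := Complex.abs_im_le_norm (a + t * Complex.I)
    simp at this ⊢
    linarith

/-- Dividing a function of slow growth by the kernel `z * (z + 2 * η)`, after removing the
singularity at `0`. -/
lemma exists_bound_dslope_div {E : ℂ → ℂ} {S : Set ℂ} {η C : ℝ} (hη : 0 < η)
    (hSc : IsClosed S) (hS0 : S ∈ nhds (0 : ℂ)) (hSη : ∀ z ∈ S, -η ≤ z.re)
    (hEd : DifferentiableOn ℂ E S) (hEb : ∀ z ∈ S, ‖E z‖ ≤ C * (1 + ‖z‖) ^ (1 / 2 : ℝ)) :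
    DifferentiableOn ℂ (fun z => dslope E 0 z / (z + 2 * η)) S ∧
      ∃ C', ∀ z ∈ S, ‖dslope E 0 z / (z + 2 * η)‖ ≤ C' * (1 + ‖z‖) ^ (-(3 / 2) : ℝ) := by
  have hne : ∀ z ∈ S, z + 2 * η ≠ 0 := by
    intro z hz h
    have h1 := congrArg Complex.re h
    simp at h1
    have := hSη z hz
    linarith
  have hHd : DifferentiableOn ℂ (fun z => dslope E 0 z / (z + 2 * η)) S :=
    DifferentiableOn.div ((Complex.differentiableOn_dslope hS0).mpr hEd) (by fun_prop) hne
  refine ⟨hHd, ?_⟩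
  have hE0 : ‖E 0‖ ≤ C := by simpa using hEb 0 (mem_of_mem_nhds hS0)
  have hC : 0 ≤ C := (norm_nonneg _).trans hE0
  refine exists_bound_of_bound_outside (R := 4 * η + 1) (C := 16 * C) hSc hHd.continuousOn ?_
  intro z hz hzR
  have hz0 : z ≠ 0 := by
    rintro rfl; simp at hzR; linarith
  have hzpos : 0 < ‖z‖ := norm_pos_iff.mpr hz0
  rw [norm_div, dslope_of_ne _ hz0, slope_def_field, norm_div, sub_zero]
  have h1 : ‖E z - E 0‖ ≤ 2 * C * (1 + ‖z‖) ^ (1 / 2 : ℝ) := by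
    refine (norm_sub_le _ _).trans ?_
    have : (1 : ℝ) ≤ (1 + ‖z‖) ^ (1 / 2 : ℝ) :=
      Real.one_le_rpow (by linarith) (by norm_num)
    nlinarith [hEb z hz]
  have h2 : (1 + ‖z‖) / 4 ≤ ‖z + 2 * η‖ := by
    have : ‖z‖ - ‖(2 * η : ℂ)‖ ≤ ‖z + 2 * η‖ := by
      simpa using norm_sub_norm_le z (-(2 * η : ℂ))
    have h3 : ‖(2 * η : ℂ)‖ = 2 * η := by simp [abs_of_pos hη]
    rw [h3] at this
    linarith
  have h3 : (1 + ‖z‖) / 2 ≤ ‖z‖ := by linarith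
  rw [div_div]
  have h4 : (1 + ‖z‖) ^ 2 / 8 ≤ ‖z‖ * ‖z + 2 * η‖ := by
    calc (1 + ‖z‖) ^ 2 / 8 = (1 + ‖z‖) / 2 * ((1 + ‖z‖) / 4) := by ring
      _ ≤ _ := by gcongr
  refine (div_le_div₀ (by positivity) h1 (by positivity) h4).trans (le_of_eq ?_)
  rw [show (-(3 / 2) : ℝ) = 1 / 2 - (2 : ℕ) by norm_num, Real.rpow_sub (by positivity),
    Real.rpow_natCast]
  field_simp
  ring

lemma integral_dslope_div {E : ℂ → ℂ} {η : ℝ} (hη : 0 < η)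
    (hHi : MeasureTheory.Integrable (fun t : ℝ => dslope E 0 ((-η : ℝ) + t * Complex.I) /
      ((-η : ℝ) + t * Complex.I + 2 * η))) :
    MeasureTheory.Integrable (fun t : ℝ => E (-η + t * Complex.I) * (η / (η ^ 2 + t ^ 2))) ∧
    η * ∫ t : ℝ, dslope E 0 ((-η : ℝ) + t * Complex.I) / ((-η : ℝ) + t * Complex.I + 2 * η) =
      Real.pi * E 0 - ∫ t : ℝ, E (-η + t * Complex.I) * (η / (η ^ 2 + t ^ 2)) := by
  have hηc : (η : ℂ) ≠ 0 := by exact_mod_cast hη.ne'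
  have hpt : ∀ t : ℝ, dslope E 0 ((-η : ℝ) + t * Complex.I) /
      ((-η : ℝ) + t * Complex.I + 2 * η) =
      (-1 / η : ℂ) * (E (-η + t * Complex.I) * (η / (η ^ 2 + t ^ 2))) +
      (1 / η ^ 2 : ℂ) * (E 0) * ((1 + (t * η⁻¹) ^ 2)⁻¹ : ℝ) := by
    intro t
    have hz0 : ((-η : ℝ) + t * Complex.I : ℂ) ≠ 0 := by
      intro h
      have h1 := congrArg Complex.re h
      simp at h1
      linarith
    have hq : (η ^ 2 + t ^ 2 : ℂ) ≠ 0 := by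
      have : (η ^ 2 + t ^ 2 : ℝ) ≠ 0 := by positivity
      exact_mod_cast this
    have hprod : ((-η : ℝ) + t * Complex.I : ℂ) * ((-η : ℝ) + t * Complex.I + 2 * η) =
        -(η ^ 2 + t ^ 2) := by
      push_cast; ring_nf; rw [Complex.I_sq]; ring
    rw [dslope_of_ne _ hz0, slope_def_field, sub_zero, div_div, hprod]
    have hq2 : ((1 + (t * η⁻¹) ^ 2 : ℝ) : ℂ) = (η ^ 2 + t ^ 2) / η ^ 2 := by
      push_cast; field_simp
    rw [Complex.ofReal_inv, hq2, Complex.ofReal_neg]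
    field_simp
    ring
  have hInt1 : MeasureTheory.Integrable (fun t : ℝ => ((1 + (t * η⁻¹) ^ 2)⁻¹ : ℝ)) :=
    integrable_inv_one_add_sq.comp_mul_right' (inv_ne_zero hη.ne')
  have hInt1c : MeasureTheory.Integrable (fun t : ℝ => (1 / η ^ 2 : ℂ) * (E 0) *
      ((1 + (t * η⁻¹) ^ 2)⁻¹ : ℝ)) := (hInt1.ofReal).const_mul _
  have hInt2 : MeasureTheory.Integrable (fun t : ℝ => (-1 / η : ℂ) * (E (-η + t * Complex.I) *
      (η / (η ^ 2 + t ^ 2)))) := by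
    refine (hHi.sub hInt1c).congr (Eventually.of_forall fun t => ?_)
    simp only [Pi.sub_apply]
    rw [hpt t]
    ring
  refine ⟨?_, ?_⟩
  · refine (hInt2.const_mul (-η : ℂ)).congr (Eventually.of_forall fun t => ?_)
    simp only
    field_simp
  simp_rw [hpt]
  rw [MeasureTheory.integral_add hInt2 hInt1c, MeasureTheory.integral_const_mul,
    MeasureTheory.integral_const_mul]
  have hval : ∫ t : ℝ, (((1 + (t * η⁻¹) ^ 2)⁻¹ : ℝ) : ℂ) = η * Real.pi := by
    rw [integral_complex_ofReal, MeasureTheory.Measure.integral_comp_mul_right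
      (fun t : ℝ => (1 + t ^ 2)⁻¹), integral_univ_inv_one_add_sq]
    simp [abs_of_pos hη]
  rw [hval]
  generalize (∫ t : ℝ, E (-η + t * Complex.I) * (η / (η ^ 2 + t ^ 2) : ℂ)) = J
  field_simp
  ring

/-- Poisson's formula on a half-plane, twisted by an exponential. -/
lemma integral_poisson_exp {G : ℂ → ℂ} {η l C : ℝ} (hη : 0 < η) (hl : 0 ≤ l)
    (hd : DifferentiableOn ℂ G {z | -η ≤ z.re})
    (hb : ∀ z : ℂ, -η ≤ z.re → ‖G z‖ ≤ C * (1 + ‖z‖) ^ (1 / 2 : ℝ)) :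
    MeasureTheory.Integrable (fun t : ℝ => G (-η + t * Complex.I) *
        Complex.exp (-(l * t * Complex.I)) * (η / (η ^ 2 + t ^ 2))) ∧
    ∫ t : ℝ, G (-η + t * Complex.I) * Complex.exp (-(l * t * Complex.I)) * (η / (η ^ 2 + t ^ 2)) =
      Real.pi * Real.exp (-(l * η)) * G 0 := by
  set S : Set ℂ := {z | -η ≤ z.re} with hSdef
  have hS0 : S ∈ nhds (0 : ℂ) := by
    have : {z : ℂ | -η < z.re} ∈ nhds (0 : ℂ) :=
      (isOpen_lt continuous_const Complex.continuous_re).mem_nhds (by simpa using hη)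
    refine mem_of_superset this fun z hz => ?_
    have hz' : -η < z.re := hz
    exact hz'.le
  have hSc : IsClosed S := isClosed_le continuous_const Complex.continuous_re
  set E : ℂ → ℂ := fun z => G z * Complex.exp (-(l * (z + η))) with hE
  have hEd : DifferentiableOn ℂ E S := by
    refine hd.mul (Differentiable.differentiableOn ?_)
    fun_prop
  have hEb : ∀ z ∈ S, ‖E z‖ ≤ C * (1 + ‖z‖) ^ (1 / 2 : ℝ) := by
    intro z hz
    rw [hE, norm_mul]
    refine (mul_le_of_le_one_right (norm_nonneg _) ?_).trans (hb z hz)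
    rw [Complex.norm_exp]
    simp only [Real.exp_le_one_iff]
    simp only [hSdef, Set.mem_ofPred_eq] at hz
    have : 0 ≤ l * (z.re + η) := mul_nonneg hl (by linarith)
    simpa using this
  obtain ⟨hHd, C', hC'⟩ := exists_bound_dslope_div hη hSc hS0 (fun z hz => hz) hEd hEb
  have h0 := integral_vertical_eq_zero (a := -η) (C := C') hHd hC'
  obtain ⟨hi, hv⟩ := integral_dslope_div hη (integrable_vertical (a := -η) hHd.continuousOn
    (fun t => by simp [hSdef]) hC')
  have hEz : ∀ t : ℝ, E (-η + t * Complex.I) =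
      G (-η + t * Complex.I) * Complex.exp (-(l * t * Complex.I)) := by
    intro t
    simp only [hE]
    congr 2
    ring
  rw [h0, mul_zero] at hv
  simp only [hEz] at hi hv
  refine ⟨hi, ?_⟩
  have hE0v : E 0 = G 0 * Real.exp (-(l * η)) := by simp [hE]
  rw [hE0v] at hv
  linear_combination hv

/-- Shifting a contour past the simple pole at `0` of the kernel `1 / (z * (z + 2 * η))`. -/
lemma integral_poisson_strip {F : ℂ → ℂ} {η b C : ℝ} (hη : 0 < η) (hb0 : 0 < b)
    (hd : DifferentiableOn ℂ F {z | -η ≤ z.re ∧ z.re ≤ b})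
    (hb : ∀ z : ℂ, -η ≤ z.re → z.re ≤ b → ‖F z‖ ≤ C * (1 + ‖z‖) ^ (1 / 2 : ℝ)) :
    Real.pi * F 0 = (∫ t : ℝ, F (-η + t * Complex.I) * (η / (η ^ 2 + t ^ 2))) +
      η * ∫ t : ℝ, F (b + t * Complex.I) /
        ((b + t * Complex.I) * (b + t * Complex.I + 2 * η)) := by
  set S : Set ℂ := {z | -η ≤ z.re ∧ z.re ≤ b} with hSdef
  have hS0 : S ∈ nhds (0 : ℂ) := by
    have h1 : {z : ℂ | -η < z.re} ∈ nhds (0 : ℂ) :=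
      (isOpen_lt continuous_const Complex.continuous_re).mem_nhds (by simpa using hη)
    have h2 : {z : ℂ | z.re < b} ∈ nhds (0 : ℂ) :=
      (isOpen_lt Complex.continuous_re continuous_const).mem_nhds (by simpa using hb0)
    filter_upwards [h1, h2] with z hz1 hz2
    exact ⟨le_of_lt hz1, le_of_lt hz2⟩
  have hSc : IsClosed S := (isClosed_le continuous_const Complex.continuous_re).inter
    (isClosed_le Complex.continuous_re continuous_const)
  obtain ⟨hHd, C', hC'⟩ := exists_bound_dslope_div hη hSc hS0 (fun z hz => hz.1) hd
    (fun z hz => hb z hz.1 hz.2)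
  have hC'0 : 0 ≤ C' := by
    have := (norm_nonneg _).trans (hC' 0 (mem_of_mem_nhds hS0))
    exact nonneg_of_mul_nonneg_left this (by positivity)
  have hshift := integral_vertical_eq_of_strip (a := -η) (b := b) (C := C') (by linarith) hHd
    (fun z h1 h2 => by
      refine (hC' z ⟨h1, h2⟩).trans ?_
      gcongr ?_ * ?_
      calc (1 + ‖z‖) ^ (-(3 / 2) : ℝ) ≤ (1 + ‖z‖) ^ (-(5 / 4) : ℝ) :=
            Real.rpow_le_rpow_of_exponent_le (by linarith [norm_nonneg z]) (by norm_num)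
        _ ≤ _ := Real.rpow_le_rpow_of_nonpos (by positivity)
            (by linarith [Complex.abs_im_le_norm z]) (by norm_num))
  have hib := integrable_vertical (a := b) hHd.continuousOn
    (fun t => by simp [hSdef]; linarith) hC'
  obtain ⟨hi, hv⟩ := integral_dslope_div hη (integrable_vertical (a := -η) hHd.continuousOn
    (fun t => by simp [hSdef]; linarith) hC')
  have hKd : DifferentiableOn ℂ (fun z : ℂ => 1 / (z * (z + 2 * η))) {z | b ≤ z.re} := by
    refine DifferentiableOn.div (by fun_prop) (by fun_prop) fun z hz => ?_
    have hz' : b ≤ z.re := hz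
    refine mul_ne_zero ?_ ?_ <;> intro h <;> have h1 := congrArg Complex.re h <;> simp at h1 <;>
      linarith
  have hKb : ∀ z ∈ {z : ℂ | b ≤ z.re}, ‖1 / (z * (z + 2 * η))‖ ≤
      (1 + 1 / b) ^ 2 * (1 + ‖z‖) ^ (-(3 / 2) : ℝ) := by
    intro z hz
    have hz' : b ≤ z.re := hz
    have hzn : b ≤ ‖z‖ := hz'.trans (Complex.re_le_norm z)
    have h1 : ‖z‖ ≤ ‖z + 2 * η‖ := by
      refine le_of_sq_le_sq ?_ (norm_nonneg _)
      rw [Complex.sq_norm, Complex.sq_norm, Complex.normSq_apply, Complex.normSq_apply]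
      simp
      nlinarith
    have h2 : 1 + ‖z‖ ≤ (1 + 1 / b) * ‖z‖ := by
      have : 1 ≤ 1 / b * ‖z‖ := by rw [one_div_mul_eq_div, one_le_div hb0]; exact hzn
      linarith
    have h3 : (1 + ‖z‖) ^ (-2 : ℝ) ≤ (1 + ‖z‖) ^ (-(3 / 2) : ℝ) :=
      Real.rpow_le_rpow_of_exponent_le (by linarith [norm_nonneg z]) (by norm_num)
    refine le_trans ?_ (mul_le_mul_of_nonneg_left h3 (by positivity))
    rw [Real.rpow_neg (by positivity), norm_div, norm_one, norm_mul, one_div,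
      ← div_eq_mul_inv, inv_eq_one_div, div_le_div_iff₀ (by nlinarith) (by positivity)]
    have h4 : (1 + ‖z‖) ^ (2 : ℝ) = (1 + ‖z‖) ^ 2 := by norm_cast
    rw [h4]
    calc 1 * (1 + ‖z‖) ^ 2 ≤ ((1 + 1 / b) * ‖z‖) ^ 2 := by rw [one_mul]; gcongr
      _ = (1 + 1 / b) ^ 2 * (‖z‖ * ‖z‖) := by ring
      _ ≤ _ := by gcongr
  have hK0 := integral_vertical_eq_zero hKd hKb
  have hKi := integrable_vertical (a := b) hKd.continuousOn (fun t => by simp) hKb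
  have hsplit : ∀ t : ℝ, dslope F 0 (b + t * Complex.I) / (b + t * Complex.I + 2 * η) +
      F 0 * (1 / ((b + t * Complex.I) * (b + t * Complex.I + 2 * η))) =
      F (b + t * Complex.I) / ((b + t * Complex.I) * (b + t * Complex.I + 2 * η)) := by
    intro t
    have hz0 : (b + t * Complex.I : ℂ) ≠ 0 := by
      intro h
      have h1 := congrArg Complex.re h
      simp at h1
      linarith
    rw [dslope_of_ne _ hz0, slope_def_field, sub_zero, div_div]
    ring
  simp_rw [← hsplit]
  rw [MeasureTheory.integral_add hib (hKi.const_mul (F 0)), MeasureTheory.integral_const_mul, hK0,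
    mul_zero, add_zero, ← hshift, hv]
  ring

/-- A bound for the integral of a function with nonnegative real part against the Poisson kernel
twisted by an exponential in the direction opposite to `integral_poisson_exp`. -/
lemma norm_integral_poisson_exp_le {G : ℂ → ℂ} {η l C : ℝ} (hη : 0 < η) (hl : 0 ≤ l)
    (hd : DifferentiableOn ℂ G {z | -η ≤ z.re})
    (hb : ∀ z : ℂ, -η ≤ z.re → ‖G z‖ ≤ C * (1 + ‖z‖) ^ (1 / 2 : ℝ))
    (hre : ∀ z : ℂ, -η ≤ z.re → 0 ≤ (G z).re) :
    MeasureTheory.Integrable (fun t : ℝ => G (-η + t * Complex.I) *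
        Complex.exp (l * t * Complex.I) * (η / (η ^ 2 + t ^ 2))) ∧
    ‖∫ t : ℝ, G (-η + t * Complex.I) * Complex.exp (l * t * Complex.I) *
      (η / (η ^ 2 + t ^ 2))‖ ≤ 3 * Real.pi * ‖G 0‖ := by
  obtain ⟨hi, hv⟩ := integral_poisson_exp hη hl hd hb
  obtain ⟨hi0, hv0⟩ := integral_poisson_exp hη le_rfl hd hb
  simp only [Complex.ofReal_zero, zero_mul, neg_zero, Complex.exp_zero, mul_one,
    Real.exp_zero, Complex.ofReal_one] at hi0 hv0
  have hw : ∀ t : ℝ, (η / (η ^ 2 + t ^ 2) : ℂ) = ((η / (η ^ 2 + t ^ 2) : ℝ) : ℂ) := by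
    intro t; push_cast; rfl
  have hiR : MeasureTheory.Integrable (fun t : ℝ => (G (-η + t * Complex.I)).re *
      (η / (η ^ 2 + t ^ 2))) := by
    refine hi0.re.congr (Eventually.of_forall fun t => ?_)
    simp only [hw, RCLike.re_to_complex, Complex.re_mul_ofReal]
  have hvR : ∫ t : ℝ, (G (-η + t * Complex.I)).re * (η / (η ^ 2 + t ^ 2)) =
      Real.pi * (G 0).re := by
    have h := congrArg Complex.re hv0
    rw [← RCLike.re_to_complex, ← integral_re hi0] at h
    simp only [hw, RCLike.re_to_complex, Complex.re_mul_ofReal, Complex.re_ofReal_mul] at h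
    exact h
  have hcont : ∀ c : ℝ, Continuous (fun t : ℝ => Complex.exp (c * t * Complex.I)) := by
    intro c; fun_prop
  have hnorm : ∀ t : ℝ, ‖Complex.exp (l * t * Complex.I)‖ = 1 := by
    intro t
    have := Complex.norm_exp_ofReal_mul_I (l * t)
    push_cast at this
    exact this
  have hi' : MeasureTheory.Integrable (fun t : ℝ => G (-η + t * Complex.I) *
        Complex.exp (l * t * Complex.I) * (η / (η ^ 2 + t ^ 2))) := by
    refine (hi0.bdd_mul (c := 1) (hcont l).aestronglyMeasurable
      (Eventually.of_forall fun t => (hnorm t).le)).congr (Eventually.of_forall fun t => ?_)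
    simp only
    ring
  refine ⟨hi', ?_⟩
  have hiRe : MeasureTheory.Integrable (fun t : ℝ => 2 * Complex.exp (l * t * Complex.I) *
      ((((G (-η + t * Complex.I)).re * (η / (η ^ 2 + t ^ 2)) : ℝ)) : ℂ)) := by
    refine (hiR.ofReal.bdd_mul (c := 2) (f := fun t : ℝ => 2 * Complex.exp (l * t * Complex.I))
      (Continuous.aestronglyMeasurable (by fun_prop))
      (Eventually.of_forall fun t => ?_))
    rw [norm_mul, hnorm]; simp
  have hiC : MeasureTheory.Integrable (fun t : ℝ => (starRingEnd ℂ) (G (-η + t * Complex.I) *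
        Complex.exp (-(l * t * Complex.I)) * (η / (η ^ 2 + t ^ 2)))) :=
    Complex.conjCLE.toContinuousLinearMap.integrable_comp hi
  have hsplit : ∀ t : ℝ, G (-η + t * Complex.I) *
        Complex.exp (l * t * Complex.I) * (η / (η ^ 2 + t ^ 2)) =
      2 * Complex.exp (l * t * Complex.I) *
      ((((G (-η + t * Complex.I)).re * (η / (η ^ 2 + t ^ 2)) : ℝ)) : ℂ) -
      (starRingEnd ℂ) (G (-η + t * Complex.I) *
        Complex.exp (-(l * t * Complex.I)) * (η / (η ^ 2 + t ^ 2))) := by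
    intro t
    rw [hw, map_mul, map_mul, Complex.conj_ofReal, ← Complex.exp_conj]
    have h1 : (starRingEnd ℂ) (-(l * t * Complex.I)) = l * t * Complex.I := by
      simp
    rw [h1]
    have h2 : G (-η + t * Complex.I) + (starRingEnd ℂ) (G (-η + t * Complex.I)) =
        2 * ((G (-η + t * Complex.I)).re : ℂ) := by
      rw [Complex.add_conj]; push_cast; ring
    rw [Complex.ofReal_mul]
    linear_combination (Complex.exp (l * t * Complex.I) * ((η / (η ^ 2 + t ^ 2) : ℝ) : ℂ)) * h2
  simp_rw [hsplit]
  rw [MeasureTheory.integral_sub hiRe hiC, integral_conj, hv]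
  have hA : ‖∫ t : ℝ, 2 * Complex.exp (l * t * Complex.I) *
      ((((G (-η + t * Complex.I)).re * (η / (η ^ 2 + t ^ 2)) : ℝ)) : ℂ)‖ ≤
      2 * (Real.pi * ‖G 0‖) := by
    calc _ ≤ ∫ t : ℝ, 2 * ((G (-η + t * Complex.I)).re * (η / (η ^ 2 + t ^ 2))) := by
          refine MeasureTheory.norm_integral_le_of_norm_le (hiR.const_mul 2)
            (Eventually.of_forall fun t => ?_)
          rw [norm_mul, norm_mul, hnorm, Complex.norm_real, Real.norm_of_nonneg]
          · simp
          · exact mul_nonneg (hre _ (by simp)) (by positivity)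
      _ = 2 * (Real.pi * (G 0).re) := by rw [MeasureTheory.integral_const_mul, hvR]
      _ ≤ _ := by
        have := Complex.re_le_norm (G 0)
        gcongr
  have hB : ‖(starRingEnd ℂ) (Real.pi * Real.exp (-(l * η)) * G 0)‖ ≤ Real.pi * ‖G 0‖ := by
    rw [RCLike.norm_conj, norm_mul, norm_mul, Complex.norm_real, Complex.norm_real,
      Real.norm_of_nonneg Real.pi_pos.le, Real.norm_of_nonneg (Real.exp_pos _).le]
    have : Real.exp (-(l * η)) ≤ 1 := Real.exp_le_one_iff.mpr (by nlinarith)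
    have := Real.pi_pos
    gcongr
    nlinarith
  refine (norm_sub_le _ _).trans ?_
  linarith

/-- A zero-free holomorphic function on a disc has a holomorphic logarithm. -/
lemma exists_log_of_ne_zero {f : ℂ → ℂ} {c : ℂ} {R : ℝ} (hR : 0 < R)
    (hd : DifferentiableOn ℂ f (Metric.ball c R)) (h0 : ∀ z ∈ Metric.ball c R, f z ≠ 0) :
    ∃ h : ℂ → ℂ, (∀ z ∈ Metric.ball c R, HasDerivAt h (deriv f z / f z) z) ∧ h c = 0 ∧
      ∀ z ∈ Metric.ball c R, f z = f c * Complex.exp (h z) := by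
  have hdd : DifferentiableOn ℂ (fun z => deriv f z / f z) (Metric.ball c R) :=
    (hd.deriv Metric.isOpen_ball).div hd h0
  obtain ⟨h, hc, hh⟩ := hdd.isExactOn_ball.with_val_at c 0
  refine ⟨h, hh, hc, fun z hz => ?_⟩
  have hfd : ∀ w ∈ Metric.ball c R, HasDerivAt f (deriv f w) w := fun w hw =>
    (hd.differentiableAt (Metric.isOpen_ball.mem_nhds hw)).hasDerivAt
  have hg : ∀ w ∈ Metric.ball c R, HasDerivAt (fun w => f w * Complex.exp (-h w)) 0 w := by
    intro w hw
    have := (hfd w hw).mul ((hh w hw).neg.cexp)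
    refine this.congr_deriv ?_
    simp only [Pi.neg_apply]
    have hw0 := h0 w hw
    rw [show f w * (Complex.exp (-h w) * -(deriv f w / f w)) =
      -(f w / f w * (deriv f w * Complex.exp (-h w))) by ring, div_self hw0]
    ring
  have hconst := (convex_ball c R).is_const_of_fderivWithin_eq_zero (𝕜 := ℂ)
    (f := fun w => f w * Complex.exp (-h w))
    (fun w hw => (hg w hw).differentiableAt.differentiableWithinAt)
    (fun w hw => by
      rw [fderivWithin_of_isOpen Metric.isOpen_ball hw]
      ext
      simp [(hg w hw).deriv]) hz (Metric.mem_ball_self hR)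
  simp only [hc, neg_zero, Complex.exp_zero, mul_one] at hconst
  rw [← hconst, mul_assoc, ← Complex.exp_add, neg_add_cancel, Complex.exp_zero, mul_one]

/-- Bound for the logarithmic derivative of a zero-free function on a disc. -/
lemma norm_logDeriv_le_of_ne_zero {f : ℂ → ℂ} {c s : ℂ} {r R M : ℝ} (hr : 0 ≤ r) (hrR : r < R)
    (hd : DifferentiableOn ℂ f (Metric.ball c R)) (h0 : ∀ z ∈ Metric.ball c R, f z ≠ 0)
    (hM : ∀ z ∈ Metric.ball c R, ‖f z‖ ≤ M) (hs : s ∈ Metric.closedBall c r) :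
    ‖deriv f s / f s‖ ≤ 16 * R / (R - r) ^ 2 * (Real.log (M / ‖f c‖) + 1) := by
  have hR : 0 < R := hr.trans_lt hrR
  obtain ⟨h, hh, hhc, hfh⟩ := exists_log_of_ne_zero hR hd h0
  have hcR := Metric.mem_ball_self (x := c) hR
  have hfc : 0 < ‖f c‖ := norm_pos_iff.mpr (h0 c hcR)
  set L := Real.log (M / ‖f c‖) with hL
  have hMf : 1 ≤ M / ‖f c‖ := by rw [one_le_div hfc]; exact hM c hcR
  have hL0 : 0 ≤ L := Real.log_nonneg hMf
  have hre : ∀ z ∈ Metric.ball c R, (h z).re ≤ L + 1 := by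
    intro z hz
    have h1 := hM z hz
    rw [hfh z hz, norm_mul, Complex.norm_exp] at h1
    have h2 : Real.exp (h z).re ≤ M / ‖f c‖ := by
      rw [le_div_iff₀ hfc]; linarith
    have := (Real.le_log_iff_exp_le (by linarith)).mpr h2
    linarith
  have hbd : ∀ z ∈ Metric.ball c ((r + R) / 2), ‖h z‖ ≤ 4 * (L + 1) * R / (R - r) := by
    intro z hz
    have hz' : z - c ∈ Metric.ball (0 : ℂ) R := by
      simp only [Metric.mem_ball, dist_eq_norm, sub_zero] at hz ⊢
      linarith
    have h1 := Complex.borelCaratheodory_zero (f := fun w => h (w + c)) (M := L + 1) (R := R)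
      (z := z - c) (by linarith) ?_ ?_ hR hz' (by simp [hhc])
    · simp only [sub_add_cancel] at h1
      refine h1.trans ?_
      simp only [Metric.mem_ball, dist_eq_norm, sub_zero] at hz hz'
      have h2 : (R - r) / 2 ≤ R - ‖z - c‖ := by linarith
      calc _ ≤ 2 * (L + 1) * R / ((R - r) / 2) := by
            have : 0 < R - r := by linarith
            gcongr
        _ = _ := by field_simp; ring
    · intro w hw
      have : w + c ∈ Metric.ball c R := by simpa [dist_eq_norm] using hw
      exact ((hh _ this).comp_add_const w c).differentiableAt.differentiableWithinAt
    · intro w hw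
      exact hre _ (by simpa [dist_eq_norm] using hw)
  have hsb : Metric.closedBall s ((R - r) / 4) ⊆ Metric.ball c ((r + R) / 2) := by
    intro w hw
    simp only [Metric.mem_closedBall, Metric.mem_ball] at hw hs ⊢
    have := dist_triangle w s c
    linarith
  have hsub : Metric.ball c ((r + R) / 2) ⊆ Metric.ball c R :=
    Metric.ball_subset_ball (by linarith)
  have hsR : s ∈ Metric.ball c R := Metric.closedBall_subset_ball hrR hs
  rw [← (hh s hsR).deriv]
  have hfin := Complex.norm_deriv_le_of_forall_mem_sphere_norm_le (f := h) (c := s)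
    (R := (R - r) / 4) (C := 4 * (L + 1) * R / (R - r)) (by linarith) ?_ ?_
  · refine hfin.trans (le_of_eq ?_)
    have : R - r ≠ 0 := by linarith
    field_simp
    ring
  · refine DifferentiableOn.diffContOnCl ?_
    intro w hw
    refine (hh w (hsub (hsb ?_))).differentiableAt.differentiableWithinAt
    exact Metric.closure_ball_subset_closedBall hw
  · intro w hw
    exact hbd w (hsb (Metric.sphere_subset_closedBall hw))

/-- One-sided bound for the logarithmic derivative of a holomorphic function to the right of its
zeros. -/
lemma exists_neg_re_logDeriv_le {r R' R : ℝ} (hr : 0 < r) (hr' : r < R') (hR : R' < R) :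
    ∃ K : ℝ, 0 < K ∧ ∀ (f : ℂ → ℂ) (M β : ℝ) (s : ℂ),
      DifferentiableOn ℂ f (Metric.closedBall 0 R) →
      (∀ z ∈ Metric.closedBall 0 R, ‖f z‖ ≤ M) → f 0 ≠ 0 →
      (∀ z ∈ Metric.closedBall 0 R', f z = 0 → z.re ≤ β) →
      s ∈ Metric.closedBall 0 r → β < s.re →
      -(deriv f s / f s).re ≤ K * (Real.log (M / ‖f 0‖) + 1) := by
  have hR'0 : 0 < R' := hr.trans hr'
  have hR0 : 0 < R := hR'0.trans hR
  have hlog : 0 < Real.log (R / R') := Real.log_pos (by rwa [one_lt_div hR'0])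
  set K0 := 16 * R' / (R' - r) ^ 2 with hK0
  set K1 := R' / (R ^ 2 - R' * r) / Real.log (R / R') with hK1
  have hden : 0 < R ^ 2 - R' * r := by nlinarith
  have hK0p : 0 < K0 := by
    have : 0 < R' - r := by linarith
    positivity
  have hK1p : 0 < K1 := by positivity
  refine ⟨K0 + K1, by positivity, ?_⟩
  suffices H : ∀ (n : ℕ) (f : ℂ → ℂ) (M β : ℝ) (s : ℂ),
      DifferentiableOn ℂ f (Metric.closedBall 0 R) →
      (∀ z ∈ Metric.closedBall 0 R, ‖f z‖ ≤ M) → f 0 ≠ 0 →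
      (∀ z ∈ Metric.closedBall 0 R', f z = 0 → z.re ≤ β) →
      s ∈ Metric.closedBall 0 r → β < s.re →
      Real.log (M / ‖f 0‖) < n * Real.log (R / R') →
      -(deriv f s / f s).re ≤ (K0 + K1) * (Real.log (M / ‖f 0‖) + 1) by
    intro f M β s h1 h2 h3 h4 h5 h6
    obtain ⟨n, hn⟩ := exists_nat_gt (Real.log (M / ‖f 0‖) / Real.log (R / R'))
    rw [div_lt_iff₀ hlog] at hn
    exact H n f M β s h1 h2 h3 h4 h5 h6 hn
  intro n
  induction n with
  | zero =>
    intro f M β s h1 h2 h3 h4 h5 h6 h7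
    have : 0 ≤ Real.log (M / ‖f 0‖) := by
      refine Real.log_nonneg ?_
      rw [one_le_div (norm_pos_iff.mpr h3)]
      exact h2 0 (by simpa using hR0.le)
    simp at h7
    linarith
  | succ n ih =>
    intro f M β s h1 h2 h3 h4 h5 h6 h7
    have hf0 : 0 < ‖f 0‖ := norm_pos_iff.mpr h3
    have hMf : 1 ≤ M / ‖f 0‖ := by
      rw [one_le_div hf0]
      exact h2 0 (by simpa using hR0.le)
    have hL0 : 0 ≤ Real.log (M / ‖f 0‖) := Real.log_nonneg hMf
    by_cases hz : ∃ ρ ∈ Metric.closedBall (0 : ℂ) R', f ρ = 0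
    swap
    · push Not at hz
      have hsub : Metric.ball (0 : ℂ) R' ⊆ Metric.closedBall 0 R :=
        (Metric.ball_subset_closedBall).trans (Metric.closedBall_subset_closedBall hR.le)
      have := norm_logDeriv_le_of_ne_zero hr.le hr' (h1.mono hsub)
        (fun z hz' => hz z (Metric.ball_subset_closedBall hz')) (fun z hz' => h2 z (hsub hz')) h5
      have h8 := (neg_le_abs _).trans ((Complex.abs_re_le_norm _).trans this)
      refine h8.trans ?_
      gcongr
      linarith
    · obtain ⟨ρ, hρ, hρ0⟩ := hz
      have hρn : ‖ρ‖ ≤ R' := by simpa using hρ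
      have hρne : ρ ≠ 0 := by rintro rfl; exact h3 hρ0
      have hρpos : 0 < ‖ρ‖ := norm_pos_iff.mpr hρne
      have hnhds : Metric.closedBall (0 : ℂ) R ∈ nhds ρ :=
        Metric.closedBall_mem_nhds_of_mem (by simp; linarith)
      set B : ℂ → ℂ := fun z => ((R : ℂ) ^ 2 - (starRingEnd ℂ) ρ * z) / R with hB
      have hRc : (R : ℂ) ≠ 0 := by exact_mod_cast hR0.ne'
      have hBne : ∀ z ∈ Metric.closedBall (0 : ℂ) R, B z ≠ 0 := by
        intro z hz h
        have hz' : ‖z‖ ≤ R := by simpa using hz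
        rw [hB, div_eq_zero_iff, or_iff_left hRc, sub_eq_zero] at h
        have := congrArg norm h
        rw [norm_mul, RCLike.norm_conj, norm_pow, Complex.norm_real, Real.norm_of_nonneg hR0.le]
          at this
        nlinarith
      set g : ℂ → ℂ := fun z => dslope f ρ z * B z with hg
      have hgd : DifferentiableOn ℂ g (Metric.closedBall 0 R) := by
        refine ((Complex.differentiableOn_dslope hnhds).mpr h1).mul ?_
        refine Differentiable.differentiableOn ?_
        simp only [hB]; fun_prop
      have hfg : ∀ z, f z * B z = (z - ρ) * g z := by
        intro z
        have := sub_smul_dslope f ρ z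
        rw [hρ0, sub_zero, smul_eq_mul] at this
        rw [← this]; simp only [hg]; ring
      have hgs : ∀ z ∈ Metric.sphere (0 : ℂ) R, ‖g z‖ ≤ M := by
        intro z hz
        have hz' : ‖z‖ = R := by simpa using hz
        have hBz : ‖B z‖ = ‖z - ρ‖ := by
          have h10 : B z = z * (starRingEnd ℂ) (z - ρ) / R := by
            have : (R : ℂ) ^ 2 = z * (starRingEnd ℂ) z := by
              rw [Complex.mul_conj, Complex.normSq_eq_norm_sq, hz']; push_cast; rfl
            simp only [hB]
            rw [this, map_sub]; ring
          rw [h10, norm_div, norm_mul, RCLike.norm_conj, hz', Complex.norm_real,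
            Real.norm_of_nonneg hR0.le]
          field_simp
        have hne : 0 < ‖z - ρ‖ := by
          rw [norm_pos_iff, sub_ne_zero]; rintro rfl; linarith
        have h11 := congrArg norm (hfg z)
        rw [norm_mul, norm_mul, hBz, mul_comm] at h11
        rw [← mul_left_cancel₀ hne.ne' h11]
        exact h2 z (Metric.sphere_subset_closedBall hz)
      have hgM : ∀ z ∈ Metric.closedBall (0 : ℂ) R, ‖g z‖ ≤ M := by
        intro z hz
        refine Complex.norm_le_of_forall_mem_frontier_norm_le (U := Metric.ball (0 : ℂ) R)
          Metric.isBounded_ball ?_ ?_ ?_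
        · refine DifferentiableOn.diffContOnCl ?_
          rwa [closure_ball _ hR0.ne']
        · rwa [frontier_ball _ hR0.ne']
        · rwa [closure_ball _ hR0.ne']
      have hg0 : ‖g 0‖ = ‖f 0‖ * (R / ‖ρ‖) := by
        have h12 := congrArg norm (hfg 0)
        have : ‖B 0‖ = R := by
          simp only [hB, mul_zero, sub_zero]
          rw [pow_two, mul_div_assoc, div_self hRc, mul_one, Complex.norm_real,
            Real.norm_of_nonneg hR0.le]
        rw [norm_mul, norm_mul, this, zero_sub, norm_neg] at h12
        field_simp
        linarith
      have hRρ : 0 < R / ‖ρ‖ := by positivity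
      have hg0ne : g 0 ≠ 0 := by
        rw [← norm_pos_iff, hg0]; positivity
      have hlogg : Real.log (M / ‖g 0‖) ≤ Real.log (M / ‖f 0‖) - Real.log (R / R') := by
        have h13 : M / ‖g 0‖ = (M / ‖f 0‖) / (R / ‖ρ‖) := by rw [hg0]; field_simp
        rw [h13, Real.log_div (by linarith) hRρ.ne']
        have : Real.log (R / R') ≤ Real.log (R / ‖ρ‖) := by
          apply Real.log_le_log (by positivity); gcongr
        linarith
      have hsR : s ∈ Metric.closedBall (0 : ℂ) R := Metric.closedBall_subset_closedBall
        (by linarith) h5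
      have hsn : ‖s‖ ≤ r := by simpa using h5
      have hsρ : ρ.re < s.re := (h4 ρ hρ hρ0).trans_lt h6
      have hsub : s - ρ ≠ 0 := by
        intro h
        have := congrArg Complex.re h
        simp at this; linarith
      have hfs : f s ≠ 0 := by
        intro h
        have := h4 s (Metric.closedBall_subset_closedBall hr'.le h5) h
        linarith
      have hgsne : g s ≠ 0 := by
        intro h
        have := hfg s
        rw [h, mul_zero, mul_eq_zero] at this
        exact this.elim hfs (hBne s hsR)
      have hIH := ih g M β s hgd hgM hg0ne ?_ h5 h6 ?_
      · have hsN : Metric.closedBall (0 : ℂ) R ∈ nhds s :=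
          Metric.closedBall_mem_nhds_of_mem (by simp; linarith)
        have hdf : HasDerivAt f (deriv f s) s := (h1.differentiableAt hsN).hasDerivAt
        have hdg : HasDerivAt g (deriv g s) s := (hgd.differentiableAt hsN).hasDerivAt
        have hdB : HasDerivAt B (-(starRingEnd ℂ) ρ / R) s := by
          have := (((hasDerivAt_id s).const_mul ((starRingEnd ℂ) ρ)).const_sub
            ((R : ℂ) ^ 2)).div_const (R : ℂ)
          simpa using this
        have e1 := hdf.mul hdB
        have e2 := ((hasDerivAt_id s).sub_const ρ).mul hdg
        have e3 : (fun z => f z * B z) = (fun z => (z - ρ) * g z) := funext hfg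
        have e4 := e1.unique (by
          have : (f * B) = ((fun x => id x - ρ) * g) := by
            funext z; exact hfg z
          rw [this]; exact e2)
        have hBs := hBne s hsR
        have key : deriv f s / f s = deriv g s / g s + 1 / (s - ρ) +
            (starRingEnd ℂ) ρ / R / B s := by
          have h14 := hfg s
          have h15 : f s * B s ≠ 0 := mul_ne_zero hfs hBs
          have h16 : deriv f s / f s = (deriv f s * B s) / (f s * B s) := by field_simp
          have h17 : deriv f s * B s = 1 * g s + (s - ρ) * deriv g s +
            f s * ((starRingEnd ℂ) ρ / R) := by
            simp only [id] at e4
            linear_combination e4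
          rw [h16, h17, add_div, add_div]
          rw [show f s * ((starRingEnd ℂ) ρ / R) / (f s * B s) = (starRingEnd ℂ) ρ / R / B s by
            field_simp]
          rw [h14]
          field_simp
          ring
        have hb1 : 0 ≤ (1 / (s - ρ)).re := by
          rw [one_div, Complex.inv_re]
          apply div_nonneg _ (Complex.normSq_nonneg _)
          simp; linarith
        have hb2 : ‖(starRingEnd ℂ) ρ / R / B s‖ ≤ R' / (R ^ 2 - R' * r) := by
          have h18 : (starRingEnd ℂ) ρ / R / B s =
              (starRingEnd ℂ) ρ / ((R : ℂ) ^ 2 - (starRingEnd ℂ) ρ * s) := by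
            simp only [hB]; field_simp
          rw [h18, norm_div, RCLike.norm_conj]
          have h19 : R ^ 2 - R' * r ≤ ‖(R : ℂ) ^ 2 - (starRingEnd ℂ) ρ * s‖ := by
            have := norm_sub_norm_le ((R : ℂ) ^ 2) ((starRingEnd ℂ) ρ * s)
            rw [norm_mul, RCLike.norm_conj, norm_pow, Complex.norm_real,
              Real.norm_of_nonneg hR0.le] at this
            have : ‖ρ‖ * ‖s‖ ≤ R' * r := by gcongr
            linarith
          gcongr
        have hb3 := (neg_le_abs _).trans ((Complex.abs_re_le_norm _).trans hb2)
        have hb4 : K1 * Real.log (R / R') = R' / (R ^ 2 - R' * r) := by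
          rw [hK1]; field_simp
        rw [key]
        simp only [Complex.add_re]
        have hb5 : (K0 + K1) * (Real.log (M / ‖g 0‖) + 1) ≤
            (K0 + K1) * (Real.log (M / ‖f 0‖) - Real.log (R / R') + 1) := by gcongr
        nlinarith
      · intro z hz hgz
        have hzR := Metric.closedBall_subset_closedBall hR.le hz
        have := hfg z
        rw [hgz, mul_zero, mul_eq_zero] at this
        exact h4 z hz (this.resolve_right (hBne z hzR))
      · push_cast at h7
        linarith

/-- The zeta function with its pole removed, normalised to have bounded growth on the right. -/
noncomputable def zetaReg : ℂ → ℂ :=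
  Function.update (fun s => (s - 1) / (s + 1) * riemannZeta s) 1 (1 / 2)

lemma zetaReg_one : zetaReg 1 = 1 / 2 := by simp [zetaReg]

lemma zetaReg_of_ne {s : ℂ} (hs : s ≠ 1) : zetaReg s = (s - 1) / (s + 1) * riemannZeta s := by
  simp [zetaReg, hs]

lemma add_one_ne_zero_of_re {s : ℂ} (hs : -1 < s.re) : s + 1 ≠ 0 := by
  intro h
  have := congrArg Complex.re h
  simp at this
  linarith

lemma riemannZeta_eq_zetaReg {s : ℂ} (hs : s ≠ 1) (hs' : -1 < s.re) :
    riemannZeta s = (s + 1) / (s - 1) * zetaReg s := by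
  rw [zetaReg_of_ne hs]
  have h1 : s - 1 ≠ 0 := sub_ne_zero.mpr hs
  have h2 := add_one_ne_zero_of_re hs'
  field_simp

lemma differentiableAt_zetaReg {s : ℂ} (hs : -1 < s.re) : DifferentiableAt ℂ zetaReg s := by
  have hgen : ∀ z : ℂ, z ≠ 1 → -1 < z.re → DifferentiableAt ℂ zetaReg z := by
    intro z hz hz'
    have h1 : DifferentiableAt ℂ (fun s => (s - 1) / (s + 1) * riemannZeta s) z :=
      DifferentiableAt.mul (DifferentiableAt.div (by fun_prop) (by fun_prop)
        (add_one_ne_zero_of_re hz')) (differentiableAt_riemannZeta hz)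
    refine h1.congr_of_eventuallyEq ?_
    filter_upwards [isOpen_ne.mem_nhds hz] with w hw
    exact zetaReg_of_ne hw
  by_cases h : s = 1
  · subst h
    refine (Complex.analyticAt_of_differentiable_on_punctured_nhds_of_continuousAt
      ?_ ?_).differentiableAt
    · have h1 : ∀ᶠ z : ℂ in nhds 1, -1 < z.re :=
        (isOpen_lt continuous_const Complex.continuous_re).mem_nhds (by simp)
      filter_upwards [h1.filter_mono nhdsWithin_le_nhds, self_mem_nhdsWithin] with z hz hz'
      exact hgen z hz' hz
    · rw [zetaReg, continuousAt_update_same]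
      have h2 : Tendsto (fun s : ℂ => 1 / (s + 1)) (nhdsWithin 1 {1}ᶜ) (nhds (1 / (1 + 1))) := by
        refine Tendsto.mono_left ?_ nhdsWithin_le_nhds
        refine Tendsto.div tendsto_const_nhds ?_ (by norm_num)
        exact (continuous_id.add continuous_const).tendsto 1
      have h3 := h2.mul riemannZeta_residue_one
      norm_num at h3 ⊢
      refine h3.congr fun z => ?_
      ring
  · exact hgen s h hs

lemma zetaReg_ne_zero
    (hRH : ∀ ρ : ℂ, riemannZeta ρ = 0 → 0 < ρ.re → ρ.re < 1 → ρ.re = 1 / 2) {s : ℂ}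
    (hs : 1 / 2 < s.re) : zetaReg s ≠ 0 := by
  by_cases h : s = 1
  · rw [h, zetaReg_one]; norm_num
  · rw [zetaReg_of_ne h]
    refine mul_ne_zero (div_ne_zero (sub_ne_zero.mpr h)
      (add_one_ne_zero_of_re (by linarith))) ?_
    intro h0
    rcases lt_or_ge s.re 1 with h1 | h1
    · have := hRH s h0 (by linarith) h1
      linarith
    · exact riemannZeta_ne_zero_of_one_le_re h1 h0

lemma hasDerivAt_add_cpow {a u : ℝ} (h : 0 < a + u) (r : ℂ) :
    HasDerivAt (fun v : ℝ => ((a : ℂ) + v) ^ r) (r * ((a : ℂ) + u) ^ (r - 1)) u := by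
  have h1 : HasDerivAt (fun z : ℂ => (a + z) ^ r) (r * ((a : ℂ) + u) ^ (r - 1) * 1) (u : ℂ) := by
    refine HasDerivAt.cpow_const ((hasDerivAt_id _).const_add _) ?_
    left
    simpa using h
  simpa using h1.comp_ofReal

lemma norm_cpow_sub_cpow_le {a : ℝ} (ha : 0 < a) {s : ℂ} (hs : 0 ≤ s.re) {u : ℝ} (hu : 0 ≤ u)
    (hu1 : u ≤ 1) :
    ‖((a : ℂ) + u) ^ (-s) - (a : ℂ) ^ (-s)‖ ≤ ‖s‖ * a ^ (-s.re - 1) := by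
  have h := (convex_Icc (0 : ℝ) 1).norm_image_sub_le_of_norm_hasDerivWithin_le
    (f := fun v : ℝ => ((a : ℂ) + v) ^ (-s))
    (f' := fun v : ℝ => (-s) * ((a : ℂ) + v) ^ (-s - 1)) (C := ‖s‖ * a ^ (-s.re - 1))
    (x := 0) (y := u) ?_ ?_ (by simp) ⟨hu, hu1⟩
  · simp only [Complex.ofReal_zero, add_zero, sub_zero, Real.norm_of_nonneg hu] at h
    refine h.trans (mul_le_of_le_one_right (by positivity) hu1)
  · intro v hv
    exact (hasDerivAt_add_cpow (by linarith [hv.1]) _).hasDerivWithinAt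
  · intro v hv
    have hv0 : 0 < a + v := by linarith [hv.1]
    rw [norm_mul, norm_neg, ← Complex.ofReal_add, Complex.norm_cpow_eq_rpow_re_of_pos hv0]
    gcongr
    simp only [Complex.sub_re, Complex.neg_re, Complex.one_re]
    exact Real.rpow_le_rpow_of_nonpos ha (by linarith [hv.1]) (by linarith)

/-- The terms of a series converging to `(s - 1) ζ(s) - 1` for `0 < re s`. -/
noncomputable def zetaTerm (n : ℕ) (s : ℂ) : ℂ :=
  (s - 1) * ((n : ℂ) + 1) ^ (-s) + ((n : ℂ) + 1 + 1) ^ (1 - s) - ((n : ℂ) + 1) ^ (1 - s)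

lemma norm_zetaTerm_le (n : ℕ) {s : ℂ} (hs : 0 ≤ s.re) :
    ‖zetaTerm n s‖ ≤ ‖s - 1‖ * ‖s‖ * ((n : ℝ) + 1) ^ (-s.re - 1) := by
  have ha : (0 : ℝ) < (n : ℝ) + 1 := by positivity
  have hac : (((n : ℝ) + 1 : ℝ) : ℂ) = (n : ℂ) + 1 := by push_cast; rfl
  have h := (convex_Icc (0 : ℝ) 1).norm_image_sub_le_of_norm_hasDerivWithin_le
    (f := fun v : ℝ => (v : ℂ) * ((s - 1) * ((n : ℂ) + 1) ^ (-s)) +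
      ((((n : ℝ) + 1 : ℝ) : ℂ) + v) ^ (1 - s))
    (f' := fun v : ℝ => 1 * ((s - 1) * ((n : ℂ) + 1) ^ (-s)) +
      (1 - s) * ((((n : ℝ) + 1 : ℝ) : ℂ) + v) ^ (1 - s - 1))
    (C := ‖s - 1‖ * ‖s‖ * ((n : ℝ) + 1) ^ (-s.re - 1))
    (x := 0) (y := 1) ?_ ?_ (by simp) (by simp)
  · rw [hac] at h
    simp only [Complex.ofReal_zero, Complex.ofReal_one, zero_mul, zero_add, one_mul, add_zero,
      sub_zero, norm_one, mul_one] at h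
    exact h
  · intro v hv
    refine HasDerivAt.hasDerivWithinAt ?_
    refine HasDerivAt.add ?_ (hasDerivAt_add_cpow (by linarith [hv.1]) _)
    exact (Complex.ofRealCLM.hasDerivAt (x := v)).mul_const _
  · intro v hv
    have h1 := norm_cpow_sub_cpow_le ha hs hv.1 hv.2
    rw [show (1 : ℂ) - s - 1 = -s by ring, ← hac]
    calc _ = ‖s - 1‖ * ‖((((n : ℝ) + 1 : ℝ) : ℂ) + v) ^ (-s) -
          (((n : ℝ) + 1 : ℝ) : ℂ) ^ (-s)‖ := by
          rw [← norm_mul, ← norm_neg]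
          congr 1; ring
      _ ≤ _ := by rw [mul_assoc]; gcongr

lemma summable_succ_rpow {σ : ℝ} (hσ : 0 < σ) :
    Summable fun n : ℕ => ((n : ℝ) + 1) ^ (-σ - 1) := by
  have := (summable_nat_add_iff 1).mpr (Real.summable_nat_rpow.mpr (by linarith : -σ - 1 < -1))
  simpa using this

lemma tsum_zetaTerm_of_one_lt {s : ℂ} (hs : 1 < s.re) :
    ∑' n, zetaTerm n s = (s - 1) * riemannZeta s - 1 := by
  have hsum : Summable fun n => zetaTerm n s := by
    refine Summable.of_norm_bounded (((summable_succ_rpow (σ := s.re) (by linarith)).mul_left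
      (‖s - 1‖ * ‖s‖))) fun n => norm_zetaTerm_le n (by linarith)
  have hz : Summable fun n : ℕ => ((n : ℂ) + 1) ^ (-s) := by
    have := (summable_nat_add_iff 1).mpr (Complex.summable_one_div_nat_cpow.mpr hs)
    refine this.congr fun n => ?_
    rw [Complex.cpow_neg]; simp
  have hzv : ∑' n : ℕ, ((n : ℂ) + 1) ^ (-s) = riemannZeta s := by
    rw [zeta_eq_tsum_one_div_nat_add_one_cpow hs]
    refine tsum_congr fun n => ?_
    rw [Complex.cpow_neg, one_div]
  have hpart : ∀ N : ℕ, ∑ n ∈ Finset.range N, zetaTerm n s =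
      (s - 1) * ∑ n ∈ Finset.range N, ((n : ℂ) + 1) ^ (-s) + (((N : ℂ) + 1) ^ (1 - s) - 1) := by
    intro N
    induction N with
    | zero => simp
    | succ N ih =>
      rw [Finset.sum_range_succ, ih, Finset.sum_range_succ, zetaTerm]
      push_cast
      ring
  have h1 := hsum.hasSum.tendsto_sum_nat
  have h2 := hz.hasSum.tendsto_sum_nat
  rw [hzv] at h2
  have h3 : Tendsto (fun N : ℕ => ((N : ℂ) + 1) ^ (1 - s)) atTop (nhds 0) := by
    rw [tendsto_zero_iff_norm_tendsto_zero]
    have h4 : Tendsto (fun N : ℕ => ((N : ℝ) + 1) ^ (-(s.re - 1))) atTop (nhds 0) :=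
      (tendsto_rpow_neg_atTop (by linarith)).comp
        (tendsto_atTop_add_const_right _ 1 tendsto_natCast_atTop_atTop)
    refine h4.congr fun N => ?_
    have : ((N : ℂ) + 1) = (((N : ℝ) + 1 : ℝ) : ℂ) := by push_cast; rfl
    rw [this, Complex.norm_cpow_eq_rpow_re_of_pos (by positivity)]
    simp
  have h5 := (h2.const_mul (s - 1)).add (h3.sub_const 1)
  refine tendsto_nhds_unique h1 ?_
  simp_rw [hpart]
  convert h5 using 2
  ring

lemma differentiableOn_tsum_zetaTerm :
    DifferentiableOn ℂ (fun s => ∑' n, zetaTerm n s) {s | 0 < s.re} := by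
  intro s hs
  have hs' : 0 < s.re := hs
  set U : Set ℂ := {z | s.re / 2 < z.re} ∩ Metric.ball 0 (‖s‖ + 1) with hU
  have hUo : IsOpen U :=
    (isOpen_lt continuous_const Complex.continuous_re).inter Metric.isOpen_ball
  have hsU : s ∈ U := ⟨by simp only [Set.mem_ofPred_eq]; linarith, by simp⟩
  refine DifferentiableAt.differentiableWithinAt ?_
  refine (Complex.differentiableOn_tsum_of_summable_norm (U := U)
    (u := fun n : ℕ => (‖s‖ + 1 + 1) * (‖s‖ + 1) * ((n : ℝ) + 1) ^ (-(s.re / 2) - 1))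
    ((summable_succ_rpow (by linarith)).mul_left _) ?_ hUo ?_).differentiableAt
    (hUo.mem_nhds hsU)
  · intro n
    refine Differentiable.differentiableOn ?_
    have h1 : ((n : ℂ) + 1) ≠ 0 := Nat.cast_add_one_ne_zero n
    have h2 : ((n : ℂ) + 1 + 1) ≠ 0 := by
      have := Nat.cast_add_one_ne_zero (R := ℂ) (n + 1)
      push_cast at this
      exact this
    unfold zetaTerm
    have hc1 : Differentiable ℂ fun s : ℂ => ((n : ℂ) + 1) ^ (-s) :=
      fun z => (differentiableAt_fun_id.neg).const_cpow (Or.inl h1)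
    have hc2 : Differentiable ℂ fun s : ℂ => ((n : ℂ) + 1) ^ (1 - s) :=
      fun z => (differentiableAt_fun_id.const_sub 1).const_cpow (Or.inl h1)
    have hc3 : Differentiable ℂ fun s : ℂ => ((n : ℂ) + 1 + 1) ^ (1 - s) :=
      fun z => (differentiableAt_fun_id.const_sub 1).const_cpow (Or.inl h2)
    fun_prop
  · rintro n w ⟨hw1, hw2⟩
    have hw1' : s.re / 2 < w.re := hw1
    have hw2' : ‖w‖ < ‖s‖ + 1 := by simpa using hw2
    refine (norm_zetaTerm_le n (by linarith)).trans ?_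
    have : ‖w - 1‖ ≤ ‖s‖ + 1 + 1 := by
      have := norm_sub_le w 1
      rw [norm_one] at this
      linarith
    have h1 : (1 : ℝ) ≤ (n : ℝ) + 1 := by linarith [Nat.cast_nonneg (α := ℝ) n]
    gcongr

lemma zetaReg_eq_tsum {s : ℂ} (hs : 0 < s.re) :
    (s + 1) * zetaReg s = ∑' n, zetaTerm n s + 1 := by
  have hUo : IsOpen {s : ℂ | 0 < s.re} := isOpen_lt continuous_const Complex.continuous_re
  have h1 : AnalyticOnNhd ℂ (fun s => (s + 1) * zetaReg s) {s | 0 < s.re} := by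
    refine DifferentiableOn.analyticOnNhd ?_ hUo
    intro z hz
    have hz' : 0 < z.re := hz
    refine DifferentiableAt.differentiableWithinAt ?_
    have := differentiableAt_zetaReg (s := z) (by linarith)
    fun_prop
  have h2 : AnalyticOnNhd ℂ (fun s => ∑' n, zetaTerm n s + 1) {s | 0 < s.re} :=
    (differentiableOn_tsum_zetaTerm.add_const 1).analyticOnNhd hUo
  refine h1.eqOn_of_preconnected_of_eventuallyEq h2
    (convex_halfSpace_re_gt 0).isPreconnected (z₀ := 2) (by simp) ?_ hs
  have h3 : ∀ᶠ z : ℂ in nhds 2, 1 < z.re :=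
    (isOpen_lt continuous_const Complex.continuous_re).mem_nhds (by simp)
  filter_upwards [h3] with z hz
  have hz1 : z ≠ 1 := by rintro rfl; simp at hz
  rw [tsum_zetaTerm_of_one_lt hz, zetaReg_of_ne hz1]
  have := add_one_ne_zero_of_re (s := z) (by linarith)
  field_simp
  ring

lemma norm_le_norm_add_one {s : ℂ} (hs : 0 ≤ s.re) : ‖s‖ ≤ ‖s + 1‖ ∧ ‖s - 1‖ ≤ ‖s + 1‖ ∧
    1 ≤ ‖s + 1‖ := by
  refine ⟨?_, ?_, ?_⟩
  · refine le_of_sq_le_sq ?_ (norm_nonneg _)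
    rw [Complex.sq_norm, Complex.sq_norm, Complex.normSq_apply, Complex.normSq_apply]
    simp
    nlinarith
  · refine le_of_sq_le_sq ?_ (norm_nonneg _)
    rw [Complex.sq_norm, Complex.sq_norm, Complex.normSq_apply, Complex.normSq_apply]
    simp
    nlinarith
  · have := Complex.re_le_norm (s + 1)
    simp at this; linarith

lemma exists_norm_zetaReg_le {σ : ℝ} (hσ : 0 < σ) :
    ∃ C : ℝ, 0 < C ∧ ∀ s : ℂ, σ ≤ s.re → ‖zetaReg s‖ ≤ C * (‖s‖ + 1) := by
  have hS := summable_succ_rpow hσ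
  set S := ∑' n : ℕ, ((n : ℝ) + 1) ^ (-σ - 1) with hSdef
  have hS0 : 0 ≤ S := tsum_nonneg fun n => by positivity
  refine ⟨S + 1, by positivity, fun s hs => ?_⟩
  have h1 : ‖∑' n, zetaTerm n s‖ ≤ ‖s - 1‖ * ‖s‖ * S := by
    rw [hSdef, ← tsum_mul_left]
    refine tsum_of_norm_bounded (hS.mul_left _).hasSum fun n => ?_
    refine (norm_zetaTerm_le n (by linarith)).trans ?_
    have h1 : (1 : ℝ) ≤ (n : ℝ) + 1 := by linarith [Nat.cast_nonneg (α := ℝ) n]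
    gcongr
  obtain ⟨h2, h3, h4⟩ := norm_le_norm_add_one (s := s) (by linarith)
  have h5 : ‖s + 1‖ * ‖zetaReg s‖ ≤ ‖s - 1‖ * ‖s‖ * S + 1 := by
    rw [← norm_mul, zetaReg_eq_tsum (by linarith)]
    refine (norm_add_le _ _).trans ?_
    rw [norm_one]; gcongr
  have h6 : ‖s - 1‖ * ‖s‖ * S ≤ ‖s + 1‖ * ‖s‖ * S := by gcongr
  have h7 : ‖s + 1‖ * ‖zetaReg s‖ ≤ ‖s + 1‖ * ((S + 1) * (‖s‖ + 1)) := by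
    nlinarith [norm_nonneg s, mul_nonneg hS0 (norm_nonneg s)]
  exact le_of_mul_le_mul_left h7 (by linarith)

lemma norm_sub_one_div_add_one_le {s : ℂ} (hs : 2 ≤ s.re) :
    1 / 3 ≤ ‖(s - 1) / (s + 1)‖ ∧ ‖(s - 1) / (s + 1)‖ ≤ 1 := by
  obtain ⟨-, h3, h4⟩ := norm_le_norm_add_one (s := s) (by linarith)
  rw [norm_div]
  refine ⟨?_, div_le_one_of_le₀ h3 (norm_nonneg _)⟩
  rw [le_div_iff₀ (by linarith)]
  have h1 : 1 ≤ ‖s - 1‖ := by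
    have := Complex.re_le_norm (s - 1)
    simp at this; linarith
  have h2 : ‖s + 1‖ ≤ ‖s - 1‖ + 2 := by
    have := norm_add_le (s - 1) 2
    rw [show s - 1 + 2 = s + 1 by ring] at this
    simpa using this
  linarith

lemma norm_LSeries_le {f : ℕ → ℂ} (hf : LSeriesSummable f 2) {s : ℂ} (hs : 2 ≤ s.re) :
    ‖LSeries f s‖ ≤ ∑' n, ‖LSeries.term f 2 n‖ := by
  refine tsum_of_norm_bounded hf.norm.hasSum fun n => ?_
  exact LSeries.norm_term_le_of_re_le_re f (by simpa using hs) n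

/-- Two-sided bounds for the regularised zeta function and its logarithmic derivative far to the
right. -/
lemma exists_zetaReg_bounds_of_two_le :
    ∃ C : ℝ, 1 ≤ C ∧ ∀ s : ℂ, 2 ≤ s.re → ‖zetaReg s‖ ≤ C ∧ C⁻¹ ≤ ‖zetaReg s‖ ∧
      ‖deriv zetaReg s / zetaReg s‖ ≤ C := by
  have hζ : LSeriesSummable (fun n => (ArithmeticFunction.zeta n : ℂ)) 2 := by
    have := ArithmeticFunction.LSeriesSummable_zeta_iff (s := 2)
    exact this.mpr (by simp)
  have hμ : LSeriesSummable (fun n => ((ArithmeticFunction.moebius n : ℤ) : ℂ)) 2 :=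
    ArithmeticFunction.LSeriesSummable_moebius_iff.mpr (by simp)
  have hΛ : LSeriesSummable (fun n => (ArithmeticFunction.vonMangoldt n : ℂ)) 2 :=
    ArithmeticFunction.LSeriesSummable_vonMangoldt (by simp)
  set A := ∑' n, ‖LSeries.term (fun n => (ArithmeticFunction.zeta n : ℂ)) 2 n‖ with hA
  set B := ∑' n, ‖LSeries.term (fun n => ((ArithmeticFunction.moebius n : ℤ) : ℂ)) 2 n‖ with hB
  set E := ∑' n, ‖LSeries.term (fun n => (ArithmeticFunction.vonMangoldt n : ℂ)) 2 n‖ with hE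
  have hA0 : 0 ≤ A := tsum_nonneg fun n => norm_nonneg _
  have hB0 : 0 ≤ B := tsum_nonneg fun n => norm_nonneg _
  have hE0 : 0 ≤ E := tsum_nonneg fun n => norm_nonneg _
  refine ⟨1 + A + 3 * B + E + 2, by linarith, fun s hs => ?_⟩
  have hs1 : 1 < s.re := by linarith
  have hne : s ≠ 1 := by rintro rfl; simp at hs1
  have hζs : ‖riemannZeta s‖ ≤ A := by
    rw [← ArithmeticFunction.LSeries_zeta_eq_riemannZeta hs1]
    exact norm_LSeries_le hζ hs
  have hmul := ArithmeticFunction.LSeries_zeta_mul_Lseries_moebius hs1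
  rw [ArithmeticFunction.LSeries_zeta_eq_riemannZeta hs1] at hmul
  have hμs := norm_LSeries_le hμ hs
  have hΛs := norm_LSeries_le hΛ hs
  rw [ArithmeticFunction.LSeries_vonMangoldt_eq_deriv_riemannZeta_div hs1] at hΛs
  obtain ⟨hq1, hq2⟩ := norm_sub_one_div_add_one_le hs
  have hζ0 : riemannZeta s ≠ 0 := riemannZeta_ne_zero_of_one_le_re hs1.le
  have hs10 : s - 1 ≠ 0 := sub_ne_zero.mpr hne
  have hs20 : s + 1 ≠ 0 := add_one_ne_zero_of_re (by linarith)
  refine ⟨?_, ?_, ?_⟩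
  · rw [zetaReg_of_ne hne, norm_mul]
    have : ‖(s - 1) / (s + 1)‖ * ‖riemannZeta s‖ ≤ 1 * A := by gcongr
    linarith
  · have h1 : 1 ≤ ‖riemannZeta s‖ * B := by
      rw [← norm_one (α := ℂ), ← hmul, norm_mul]
      gcongr
    rw [zetaReg_of_ne hne, norm_mul]
    rw [inv_le_iff_one_le_mul₀ (by linarith)]
    have h2 : 1 / 3 * ‖riemannZeta s‖ ≤ ‖(s - 1) / (s + 1)‖ * ‖riemannZeta s‖ := by gcongr
    have h3 : 1 / 3 * ‖riemannZeta s‖ * (3 * B) ≤ ‖(s - 1) / (s + 1)‖ * ‖riemannZeta s‖ *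
      (1 + A + 3 * B + E + 2) := by
      gcongr
      linarith
    linarith
  · have hev : zetaReg =ᶠ[nhds s] fun z => (z - 1) / (z + 1) * riemannZeta z := by
      filter_upwards [isOpen_ne.mem_nhds hne] with w hw
      exact zetaReg_of_ne hw
    have hd1 : HasDerivAt (fun z : ℂ => (z - 1) / (z + 1))
        ((1 * (s + 1) - (s - 1) * 1) / (s + 1) ^ 2) s :=
      ((hasDerivAt_id s).sub_const 1).div ((hasDerivAt_id s).add_const 1) hs20
    have hd2 := hd1.mul (differentiableAt_riemannZeta hne).hasDerivAt
    have hd3 : deriv zetaReg s = (1 * (s + 1) - (s - 1) * 1) / (s + 1) ^ 2 * riemannZeta s +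
        (s - 1) / (s + 1) * deriv riemannZeta s := by
      rw [hev.deriv_eq]
      exact hd2.deriv
    have hkey : deriv zetaReg s / zetaReg s =
        1 / (s - 1) - 1 / (s + 1) + deriv riemannZeta s / riemannZeta s := by
      rw [hd3, zetaReg_of_ne hne]
      field_simp
    rw [hkey]
    obtain ⟨-, -, h4⟩ := norm_le_norm_add_one (s := s) (by linarith)
    have h1 : 1 ≤ ‖s - 1‖ := by
      have := Complex.re_le_norm (s - 1)
      simp at this; linarith
    have e1 : ‖1 / (s - 1)‖ ≤ 1 := by
      rw [norm_div, norm_one]; exact div_le_one_of_le₀ h1 (norm_nonneg _)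
    have e2 : ‖1 / (s + 1)‖ ≤ 1 := by
      rw [norm_div, norm_one]; exact div_le_one_of_le₀ h4 (norm_nonneg _)
    rw [neg_div, norm_neg] at hΛs
    have e3 := norm_add_le (1 / (s - 1) - 1 / (s + 1)) (deriv riemannZeta s / riemannZeta s)
    have e4 := norm_sub_le (1 / (s - 1)) (1 / (s + 1))
    linarith

lemma one_le_log_abs_add_three (t : ℝ) : 1 ≤ Real.log (|t| + 3) := by
  rw [Real.le_log_iff_exp_le (by positivity)]
  have := Real.exp_one_lt_d9
  have := abs_nonneg t
  linarith

/-- The regularised zeta function grows at most linearly in vertical direction near the critical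
strip; logarithmic form, relative to the value at the centre. -/
lemma exists_log_bound_zetaReg : ∃ A : ℝ, 0 < A ∧ ∀ t : ℝ, ∃ M : ℝ,
    (∀ z ∈ Metric.closedBall ((2 : ℂ) + t * Complex.I) (19 / 10), ‖zetaReg z‖ ≤ M) ∧
    zetaReg (2 + t * Complex.I) ≠ 0 ∧
    Real.log (M / ‖zetaReg (2 + t * Complex.I)‖) + 1 ≤ A * Real.log (|t| + 3) := by
  obtain ⟨C, hC, hCb⟩ := exists_norm_zetaReg_le (σ := 1 / 10) (by norm_num)
  obtain ⟨C0, hC0, hC0b⟩ := exists_zetaReg_bounds_of_two_le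
  refine ⟨|Real.log (2 * C * C0)| + 2, by positivity, fun t => ?_⟩
  obtain ⟨h1, h2, -⟩ := hC0b (2 + t * Complex.I) (by simp)
  have hpos : 0 < ‖zetaReg (2 + t * Complex.I)‖ := lt_of_lt_of_le (by positivity) h2
  refine ⟨C * (|t| + 5), fun z hz => ?_, norm_pos_iff.mp hpos, ?_⟩
  · rw [Metric.mem_closedBall, dist_eq_norm] at hz
    have h3 : 1 / 10 ≤ z.re := by
      have := (Complex.abs_re_le_norm _).trans hz
      rw [abs_le] at this
      simp at this
      linarith [this.1]
    refine (hCb z h3).trans ?_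
    have h4 : ‖z‖ ≤ 2 + |t| + 19 / 10 := by
      have e1 := norm_add_le (z - (2 + t * Complex.I)) (2 + t * Complex.I)
      have e2 := norm_add_le (2 : ℂ) (t * Complex.I)
      simp at e1 e2
      linarith
    refine mul_le_mul_of_nonneg_left ?_ hC.le
    linarith
  · have hl := one_le_log_abs_add_three t
    have h5 : C * (|t| + 5) / ‖zetaReg (2 + t * Complex.I)‖ ≤ 2 * C * C0 * (|t| + 3) := by
      rw [div_le_iff₀ hpos]
      rw [inv_le_iff_one_le_mul₀ (by linarith)] at h2
      have : 0 ≤ |t| := abs_nonneg t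
      calc C * (|t| + 5) ≤ C * (2 * (|t| + 3)) * 1 := by rw [mul_one]; gcongr; linarith
        _ ≤ C * (2 * (|t| + 3)) * (‖zetaReg (2 + t * Complex.I)‖ * C0) := by gcongr
        _ = _ := by ring
    have h6 := Real.log_le_log (by positivity) h5
    rw [Real.log_mul (by positivity) (by positivity)] at h6
    have h7 := le_abs_self (Real.log (2 * C * C0))
    nlinarith [abs_nonneg (Real.log (2 * C * C0))]

/-- One-sided bound for the logarithmic derivative of zeta on the right of the critical line. -/
lemma exists_neg_re_logDeriv_zetaReg_le
    (hRH : ∀ ρ : ℂ, riemannZeta ρ = 0 → 0 < ρ.re → ρ.re < 1 → ρ.re = 1 / 2) :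
    ∃ A : ℝ, 0 < A ∧ ∀ s : ℂ, 1 / 2 < s.re →
      -(deriv zetaReg s / zetaReg s).re ≤ A * Real.log (|s.im| + 3) := by
  obtain ⟨C0, hC0, hC0b⟩ := exists_zetaReg_bounds_of_two_le
  obtain ⟨A, hA, hAb⟩ := exists_log_bound_zetaReg
  obtain ⟨K, hK, hKb⟩ := exists_neg_re_logDeriv_le (r := 3 / 2) (R' := 18 / 10) (R := 19 / 10)
    (by norm_num) (by norm_num) (by norm_num)
  refine ⟨C0 + K * A, by positivity, fun s hs => ?_⟩
  have hl := one_le_log_abs_add_three s.im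
  rcases le_or_gt 2 s.re with h2 | h2
  · obtain ⟨-, -, h⟩ := hC0b s h2
    have := (neg_le_abs _).trans ((Complex.abs_re_le_norm _).trans h)
    refine this.trans ?_
    nlinarith [mul_pos hK hA]
  · obtain ⟨M, hM, hne, hlog⟩ := hAb s.im
    set c : ℂ := 2 + s.im * Complex.I with hc
    have hmem : ∀ {R : ℝ} {z : ℂ}, z ∈ Metric.closedBall (0 : ℂ) R →
        z + c ∈ Metric.closedBall c R := by
      intro R z hz
      simpa [dist_eq_norm] using hz
    have hre : ∀ {R : ℝ} {z : ℂ}, z ∈ Metric.closedBall (0 : ℂ) R → 2 - R ≤ (z + c).re := by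
      intro R z hz
      have h3 : ‖z‖ ≤ R := by simpa using hz
      have := (abs_le.mp ((Complex.abs_re_le_norm z).trans h3)).1
      simp [hc]
      linarith
    have hsc : s - c = ((s.re - 2 : ℝ) : ℂ) := by
      apply Complex.ext <;> simp [hc]
    have h := hKb (fun z => zetaReg (z + c)) M (-3 / 2) (s - c) ?_ ?_ ?_ ?_ ?_ ?_
    · rw [deriv_comp_add_const, sub_add_cancel] at h
      simp only [zero_add] at h
      refine h.trans ?_
      calc K * (Real.log (M / ‖zetaReg c‖) + 1) ≤ K * (A * Real.log (|s.im| + 3)) := by gcongr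
        _ ≤ _ := by nlinarith
    · intro z hz
      have := hre hz
      have h4 := differentiableAt_zetaReg (s := z + c) (by linarith)
      exact (h4.comp z (by fun_prop)).differentiableWithinAt
    · intro z hz
      exact hM _ (hmem hz)
    · simpa using hne
    · intro z hz hz0
      by_contra! hcon
      refine zetaReg_ne_zero hRH ?_ hz0
      simp [hc]; linarith
    · rw [hsc, mem_closedBall_zero_iff, Complex.norm_real, Real.norm_eq_abs, abs_le]
      constructor <;> linarith
    · rw [hsc, Complex.ofReal_re]; linarith

/-- Logarithmic growth of the logarithmic derivative of zeta, at a fixed distance from the critical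
line. -/
lemma exists_norm_logDeriv_zetaReg_le
    (hRH : ∀ ρ : ℂ, riemannZeta ρ = 0 → 0 < ρ.re → ρ.re < 1 → ρ.re = 1 / 2)
    {η : ℝ} (hη : 0 < η) :
    ∃ A : ℝ, 0 < A ∧ ∀ s : ℂ, 1 / 2 + η ≤ s.re →
      ‖deriv zetaReg s / zetaReg s‖ ≤ A * Real.log (|s.im| + 3) := by
  obtain ⟨C0, hC0, hC0b⟩ := exists_zetaReg_bounds_of_two_le
  obtain ⟨A, hA, hAb⟩ := exists_log_bound_zetaReg
  set K : ℝ := 16 * (3 / 2) / (3 / 2 - (3 / 2 - η)) ^ 2 with hK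
  have hK0 : 0 < K := by
    have : 0 < 3 / 2 - (3 / 2 - η) := by linarith
    positivity
  refine ⟨C0 + K * A, by positivity, fun s hs => ?_⟩
  have hl := one_le_log_abs_add_three s.im
  rcases le_or_gt 2 s.re with h2 | h2
  · obtain ⟨-, -, h⟩ := hC0b s h2
    refine h.trans ?_
    nlinarith [mul_pos hK0 hA]
  · obtain ⟨M, hM, hne, hlog⟩ := hAb s.im
    set c : ℂ := 2 + s.im * Complex.I with hc
    have hre : ∀ z ∈ Metric.ball c (3 / 2), 1 / 2 < z.re := by
      intro z hz
      rw [Metric.mem_ball, dist_eq_norm] at hz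
      have := (abs_lt.mp ((Complex.abs_re_le_norm _).trans_lt hz)).1
      simp [hc] at this
      linarith
    have hsc : s - c = ((s.re - 2 : ℝ) : ℂ) := by
      apply Complex.ext <;> simp [hc]
    have h := norm_logDeriv_le_of_ne_zero (f := zetaReg) (c := c) (s := s) (r := 3 / 2 - η)
      (R := 3 / 2) (M := M) (by linarith) (by linarith)
      (fun z hz => (differentiableAt_zetaReg (by linarith [hre z hz])).differentiableWithinAt)
      (fun z hz => zetaReg_ne_zero hRH (hre z hz))
      (fun z hz => hM z (Metric.ball_subset_closedBall.trans
        (Metric.closedBall_subset_closedBall (by norm_num)) hz)) ?_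
    · refine h.trans ?_
      calc K * (Real.log (M / ‖zetaReg c‖) + 1) ≤ K * (A * Real.log (|s.im| + 3)) := by gcongr
        _ ≤ _ := by nlinarith
    · rw [Metric.mem_closedBall, dist_eq_norm, hsc, Complex.norm_real, Real.norm_eq_abs, abs_le]
      constructor <;> linarith

lemma log_abs_add_im_le (t : ℝ) (z : ℂ) :
    Real.log (|t + z.im| + 3) ≤ 2 * (|t| + 3) ^ (1 / 2 : ℝ) * (1 + ‖z‖) ^ (1 / 2 : ℝ) := by
  have h1 : |t + z.im| + 3 ≤ (|t| + 3) * (1 + ‖z‖) := by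
    have := abs_add_le t z.im
    have := Complex.abs_im_le_norm z
    nlinarith [abs_nonneg t, norm_nonneg z, mul_nonneg (abs_nonneg t) (norm_nonneg z)]
  have h2 := Real.log_le_rpow_div (x := |t + z.im| + 3) (ε := 1 / 2) (by positivity) (by norm_num)
  have h3 : (|t + z.im| + 3) ^ (1 / 2 : ℝ) ≤ ((|t| + 3) * (1 + ‖z‖)) ^ (1 / 2 : ℝ) :=
    Real.rpow_le_rpow (by positivity) h1 (by norm_num)
  rw [Real.mul_rpow (by positivity) (by positivity)] at h3
  linarith

lemma norm_log_le_of_one_le {w : ℂ} (hw : 1 ≤ ‖w‖) :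
    ‖Complex.log w‖ ≤ Real.log ‖w‖ + Real.pi := by
  refine (Complex.norm_le_abs_re_add_abs_im _).trans ?_
  rw [Complex.log_re, Complex.log_im, abs_of_nonneg (Real.log_nonneg hw)]
  gcongr
  exact Complex.abs_arg_le_pi w

lemma abs_im_add_three_le {w : ℂ} (hw : 0 ≤ w.re) : |w.im| + 3 ≤ ‖2 * (w + 3)‖ := by
  have h1 := Complex.re_le_norm (w + 3)
  have h2 := Complex.abs_im_le_norm (w + 3)
  simp at h1 h2
  rw [norm_mul]
  simp
  linarith

/-- Pointwise bound for the logarithmic derivative of zeta to the right of the critical line,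
depending on a parameter. -/
lemma exists_norm_logDeriv_zetaReg_le_exp
    (hRH : ∀ ρ : ℂ, riemannZeta ρ = 0 → 0 < ρ.re → ρ.re < 1 → ρ.re = 1 / 2) :
    ∃ C : ℝ, 0 < C ∧ ∀ l : ℝ, 1 ≤ l → ∀ s : ℂ, 1 / 2 + 4 / l ≤ s.re → s.re ≤ 2 →
      ‖deriv zetaReg s / zetaReg s‖ ≤ C * Real.exp (2 * l) +
        C * Real.exp (-(l * (s.re - 1 / 2) / 2)) * Real.log (|s.im| + 3) := by
  obtain ⟨C0, hC0, hC0b⟩ := exists_zetaReg_bounds_of_two_le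
  obtain ⟨A, hA, hAb⟩ := exists_neg_re_logDeriv_zetaReg_le hRH
  refine ⟨2 * C0 + 84 * A, by positivity, fun l hl s hs hs2 => ?_⟩
  have hl0 : 0 < l := by linarith
  set D : ℂ → ℂ := fun z => deriv zetaReg z / zetaReg z with hD
  obtain ⟨η, hη⟩ : ∃ η, η = (s.re - 1 / 2) / 2 := ⟨_, rfl⟩
  have hηl : 2 / l ≤ η := by rw [hη]; linarith [show 4 / l = 2 * (2 / l) by ring]
  have hη0 : 0 < η := lt_of_lt_of_le (by positivity) hηl
  have hη1 : η ≤ 1 := by linarith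
  have hlη : 2 ≤ l * η := by rw [div_le_iff₀ hl0] at hηl; linarith
  obtain ⟨B, hB, hBb⟩ := exists_norm_logDeriv_zetaReg_le hRH hη0
  set L : ℂ → ℂ := fun z => Complex.log (2 * (s + z + 3)) with hL
  set Φ : ℂ → ℂ := fun z => A * L z + D (s + z) with hΦ
  have hre : ∀ z : ℂ, -η ≤ z.re → 1 / 2 + η ≤ (s + z).re := by
    intro z hz; simp; linarith
  have hDd : ∀ z : ℂ, -η ≤ z.re → DifferentiableAt ℂ (fun z => D (s + z)) z := by
    intro z hz
    have h1 := hre z hz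
    have hopen : IsOpen {w : ℂ | -1 < w.re} := isOpen_lt continuous_const Complex.continuous_re
    have h2 : DifferentiableOn ℂ zetaReg {w : ℂ | -1 < w.re} := fun w hw =>
      (differentiableAt_zetaReg hw).differentiableWithinAt
    have h3 : s + z ∈ {w : ℂ | -1 < w.re} := by
      show -1 < (s + z).re
      linarith
    have h4 : DifferentiableAt ℂ D (s + z) :=
      ((h2.deriv hopen).differentiableAt (hopen.mem_nhds h3)).div
        (h2.differentiableAt (hopen.mem_nhds h3)) (zetaReg_ne_zero hRH (by linarith))
    exact h4.comp z (by fun_prop)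
  have hLre : ∀ z : ℂ, -η ≤ z.re → Real.log (|(s + z).im| + 3) ≤ (L z).re := by
    intro z hz
    have h1 := abs_im_add_three_le (w := s + z) (by linarith [hre z hz])
    simp only [hL, Complex.log_re]
    exact Real.log_le_log (by positivity) h1
  have hLre0 : ∀ z : ℂ, -η ≤ z.re → 0 ≤ (L z).re := fun z hz =>
    (zero_le_one.trans (one_le_log_abs_add_three _)).trans (hLre z hz)
  have hnorm1 : ∀ z : ℂ, -η ≤ z.re → 1 ≤ ‖2 * (s + z + 3)‖ := by
    intro z hz
    have h1 := abs_im_add_three_le (w := s + z) (by linarith [hre z hz])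
    linarith [abs_nonneg (s + z).im]
  have hLd : DifferentiableOn ℂ L {z | -η ≤ z.re} := by
    intro z hz
    have hz' : -η ≤ z.re := hz
    refine (DifferentiableAt.clog (by fun_prop) ?_).differentiableWithinAt
    left
    have := hre z hz'
    simp at this ⊢
    linarith
  set CL : ℝ := 2 * (2 * (‖s‖ + 3)) ^ (1 / 2 : ℝ) + Real.pi with hCL
  have hLb : ∀ z : ℂ, -η ≤ z.re → ‖L z‖ ≤ CL * (1 + ‖z‖) ^ (1 / 2 : ℝ) := by
    intro z hz
    have h1 := norm_log_le_of_one_le (hnorm1 z hz)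
    have h2 := Real.log_le_rpow_div (x := ‖2 * (s + z + 3)‖) (ε := 1 / 2) (by positivity)
      (by norm_num)
    have h3 : ‖2 * (s + z + 3)‖ ≤ (2 * (‖s‖ + 3)) * (1 + ‖z‖) := by
      rw [norm_mul]
      have e1 := norm_add_le (s + z) 3
      have e2 := norm_add_le s z
      simp at e1 ⊢
      nlinarith [norm_nonneg s, norm_nonneg z, mul_nonneg (norm_nonneg s) (norm_nonneg z)]
    have h4 : ‖2 * (s + z + 3)‖ ^ (1 / 2 : ℝ) ≤ ((2 * (‖s‖ + 3)) * (1 + ‖z‖)) ^ (1 / 2 : ℝ) :=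
      Real.rpow_le_rpow (by positivity) h3 (by norm_num)
    rw [Real.mul_rpow (by positivity) (by positivity)] at h4
    have h5 : (1 : ℝ) ≤ (1 + ‖z‖) ^ (1 / 2 : ℝ) :=
      Real.one_le_rpow (by linarith [norm_nonneg z]) (by norm_num)
    have h6 := Real.pi_pos
    rw [hCL]
    nlinarith
  set CD : ℝ := B * (2 * (|s.im| + 3) ^ (1 / 2 : ℝ)) with hCD
  have hDb : ∀ z : ℂ, -η ≤ z.re → ‖D (s + z)‖ ≤ CD * (1 + ‖z‖) ^ (1 / 2 : ℝ) := by
    intro z hz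
    refine (hBb _ (hre z hz)).trans ?_
    rw [hCD, mul_assoc]
    refine mul_le_mul_of_nonneg_left ?_ hB.le
    have := log_abs_add_im_le s.im z
    simpa using this
  have hCD0 : 0 ≤ CD := by positivity
  obtain ⟨hiL, hvL⟩ := norm_integral_poisson_exp_le hη0 hl0.le hLd hLb hLre0
  obtain ⟨hiΦ, hvΦ⟩ := norm_integral_poisson_exp_le (G := Φ) (C := A * CL + CD) hη0 hl0.le
    (fun z hz => ((hLd z hz).const_mul _).add (hDd z hz).differentiableWithinAt)
    (fun z hz => by
      refine (norm_add_le _ _).trans ?_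
      rw [norm_mul, Complex.norm_real, Real.norm_of_nonneg hA.le, add_mul, mul_assoc]
      exact add_le_add (mul_le_mul_of_nonneg_left (hLb z hz) hA.le) (hDb z hz))
    (fun z hz => by
      have h1 := hLre z hz
      have h2 := hAb (s + z) (by linarith [hre z hz])
      simp only [hΦ, Complex.add_re, Complex.re_ofReal_mul]
      have h3 : A * Real.log (|(s + z).im| + 3) ≤ A * (L z).re := by gcongr
      change -(D (s + z)).re ≤ _ at h2
      linarith)
  set F : ℂ → ℂ := fun z => D (s + z) * Complex.exp (l * z) with hF
  have hmain := integral_poisson_strip (F := F) (η := η) (b := 2) (C := CD * Real.exp (2 * l))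
    hη0 (by norm_num)
    (fun z hz => ((hDd z hz.1).mul (by fun_prop)).differentiableWithinAt)
    (fun z h1 h2 => by
      rw [hF, norm_mul, Complex.norm_exp]
      have h3 : Real.exp ((l : ℂ) * z).re ≤ Real.exp (2 * l) := by
        rw [Complex.re_ofReal_mul]
        exact Real.exp_le_exp.mpr (by nlinarith)
      calc _ ≤ (CD * (1 + ‖z‖) ^ (1 / 2 : ℝ)) * Real.exp (2 * l) := by
            gcongr
            exact hDb z h1
        _ = _ := by ring)
  have hFline : ∀ t : ℝ, F (-η + t * Complex.I) * (η / (η ^ 2 + t ^ 2)) =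
      (Real.exp (-(l * η)) : ℂ) * (Φ (-η + t * Complex.I) * Complex.exp (l * t * Complex.I) *
        (η / (η ^ 2 + t ^ 2)) - A * (L (-η + t * Complex.I) * Complex.exp (l * t * Complex.I) *
        (η / (η ^ 2 + t ^ 2)))) := by
    intro t
    have h1 : Complex.exp (l * (-η + t * Complex.I)) =
        (Real.exp (-(l * η)) : ℂ) * Complex.exp (l * t * Complex.I) := by
      rw [Complex.ofReal_exp, ← Complex.exp_add]
      congr 1
      push_cast; ring
    simp only [hF, hΦ]
    rw [h1]
    ring
  have hInt1 : ∫ t : ℝ, F (-η + t * Complex.I) * (η / (η ^ 2 + t ^ 2)) =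
      (Real.exp (-(l * η)) : ℂ) * ((∫ t : ℝ, Φ (-η + t * Complex.I) *
        Complex.exp (l * t * Complex.I) * (η / (η ^ 2 + t ^ 2))) -
        A * ∫ t : ℝ, L (-η + t * Complex.I) * Complex.exp (l * t * Complex.I) *
        (η / (η ^ 2 + t ^ 2))) := by
    simp_rw [hFline]
    rw [MeasureTheory.integral_const_mul, MeasureTheory.integral_sub hiΦ (hiL.const_mul _),
      MeasureTheory.integral_const_mul]
  have hInt2 : ‖∫ t : ℝ, F ((2 : ℝ) + t * Complex.I) /
        (((2 : ℝ) + t * Complex.I) * ((2 : ℝ) + t * Complex.I + 2 * η))‖ ≤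
      C0 * Real.exp (2 * l) * Real.pi := by
    rw [← integral_univ_inv_one_add_sq, ← MeasureTheory.integral_const_mul]
    refine MeasureTheory.norm_integral_le_of_norm_le (integrable_inv_one_add_sq.const_mul _)
      (Eventually.of_forall fun t => ?_)
    have h1 : ‖F ((2 : ℝ) + t * Complex.I)‖ ≤ C0 * Real.exp (2 * l) := by
      rw [hF, norm_mul, Complex.norm_exp]
      have h2 : ((l : ℂ) * ((2 : ℝ) + t * Complex.I)).re = 2 * l := by
        rw [Complex.re_ofReal_mul]; simp; ring
      rw [h2]
      gcongr
      refine (hC0b _ ?_).2.2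
      simp; linarith
    have h3 : 1 + t ^ 2 ≤ ‖((2 : ℝ) + t * Complex.I : ℂ) * ((2 : ℝ) + t * Complex.I + 2 * η)‖ := by
      rw [norm_mul]
      have e1 : ‖((2 : ℝ) + t * Complex.I : ℂ)‖ ≤ ‖((2 : ℝ) + t * Complex.I + 2 * η : ℂ)‖ := by
        refine le_of_sq_le_sq ?_ (norm_nonneg _)
        rw [Complex.sq_norm, Complex.sq_norm, Complex.normSq_apply, Complex.normSq_apply]
        simp
        nlinarith
      have e2 : ‖((2 : ℝ) + t * Complex.I : ℂ)‖ * ‖((2 : ℝ) + t * Complex.I : ℂ)‖ = 4 + t ^ 2 := by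
        rw [← pow_two, Complex.sq_norm, Complex.normSq_apply]
        simp; ring
      have e3 := mul_le_mul_of_nonneg_left e1 (norm_nonneg ((2 : ℝ) + t * Complex.I : ℂ))
      linarith
    rw [norm_div, ← div_eq_mul_inv]
    gcongr
  have hF0 : F 0 = D s := by simp [hF]
  have hΦ0 : ‖Φ 0‖ ≤ A * ‖L 0‖ + ‖D s‖ := by
    simp only [hΦ, add_zero]
    refine (norm_add_le _ _).trans ?_
    rw [norm_mul, Complex.norm_real, Real.norm_of_nonneg hA.le]
  have hℓ := one_le_log_abs_add_three s.im
  have hL0 : ‖L 0‖ ≤ 7 * Real.log (|s.im| + 3) := by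
    have h1 := norm_log_le_of_one_le (hnorm1 0 (by simp; linarith))
    have h2 : ‖2 * (s + 0 + 3)‖ ≤ 4 * (|s.im| + 3) := by
      rw [norm_mul, add_zero]
      have e1 := Complex.norm_le_abs_re_add_abs_im (s + 3)
      have e2 : |(s + 3).re| = s.re + 3 := by
        rw [abs_of_nonneg] <;> simp
        have := hre 0 (by simp; linarith)
        simp at this
        linarith
      rw [e2] at e1
      simp at e1 ⊢
      linarith [abs_nonneg s.im]
    have h3 := Real.log_le_log (by linarith [hnorm1 0 (by simp; linarith)]) h2
    rw [Real.log_mul (by norm_num) (by positivity)] at h3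
    have h4 : Real.log 4 ≤ 2 := by
      have := Real.log_two_lt_d9
      rw [show (4 : ℝ) = 2 ^ 2 by norm_num, Real.log_pow]
      push_cast; linarith
    have h5 := Real.pi_lt_four
    simp only [hL]
    linarith
  rw [hF0, hInt1] at hmain
  have hfin : Real.pi * ‖D s‖ ≤ Real.exp (-(l * η)) * (3 * Real.pi * ‖Φ 0‖ +
      A * (3 * Real.pi * ‖L 0‖)) + η * (C0 * Real.exp (2 * l) * Real.pi) := by
    have h1 : Real.pi * ‖D s‖ = ‖(Real.pi : ℂ) * D s‖ := by
      rw [norm_mul, Complex.norm_real, Real.norm_of_nonneg Real.pi_pos.le]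
    rw [h1, hmain]
    refine (norm_add_le _ _).trans ?_
    rw [norm_mul, norm_mul, Complex.norm_real, Complex.norm_real, Real.norm_of_nonneg hη0.le,
      Real.norm_of_nonneg (Real.exp_pos _).le]
    gcongr
    refine (norm_sub_le _ _).trans ?_
    rw [norm_mul, Complex.norm_real, Real.norm_of_nonneg hA.le]
    gcongr
  have hpi := Real.pi_pos
  have hfin2 : ‖D s‖ ≤ Real.exp (-(l * η)) * (3 * ‖Φ 0‖ + A * (3 * ‖L 0‖)) +
      η * (C0 * Real.exp (2 * l)) := by
    refine le_of_mul_le_mul_left (hfin.trans (le_of_eq ?_)) hpi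
    ring
  have hexp : Real.exp (-(l * η)) ≤ 1 / 6 := by
    have h1 : Real.exp (-(l * η)) ≤ Real.exp (-2) := by gcongr
    have h2 : Real.exp (-2) ≤ 1 / 6 := by
      have := Real.exp_one_gt_d9
      rw [Real.exp_neg, inv_eq_one_div, div_le_div_iff₀ (Real.exp_pos _) (by norm_num),
        show (2 : ℝ) = 1 + 1 by norm_num, Real.exp_add]
      nlinarith
    linarith
  have hexp0 := Real.exp_pos (-(l * η))
  have hexp2 := Real.exp_pos (2 * l)
  have e1 : Real.exp (-(l * η)) * (3 * ‖Φ 0‖ + A * (3 * ‖L 0‖)) ≤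
      Real.exp (-(l * η)) * (3 * ‖D s‖ + 42 * A * Real.log (|s.im| + 3)) := by
    refine mul_le_mul_of_nonneg_left ?_ hexp0.le
    have : A * ‖L 0‖ ≤ A * (7 * Real.log (|s.im| + 3)) := by gcongr
    linarith
  have e2 : Real.exp (-(l * η)) * ‖D s‖ ≤ 1 / 6 * ‖D s‖ := by gcongr
  have e3 : η * (C0 * Real.exp (2 * l)) ≤ C0 * Real.exp (2 * l) :=
    mul_le_of_le_one_left (by positivity) hη1
  have e4 : l * (s.re - 1 / 2) / 2 = l * η := by rw [hη]; ring
  rw [e4]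
  change ‖D s‖ ≤ _
  have e5 : 0 ≤ A * Real.exp (2 * l) := by positivity
  have e6 : 0 ≤ C0 * (Real.exp (-(l * η)) * Real.log (|s.im| + 3)) := by positivity
  linarith

/-- Under RH, `log |ζ|` is small to the right of the critical line, up to a parameter. -/
lemma exists_abs_log_norm_zetaReg_le
    (hRH : ∀ ρ : ℂ, riemannZeta ρ = 0 → 0 < ρ.re → ρ.re < 1 → ρ.re = 1 / 2) :
    ∃ C : ℝ, 0 < C ∧ ∀ l : ℝ, 1 ≤ l → ∀ s : ℂ, 1 / 2 + 4 / l ≤ s.re →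
      |Real.log ‖zetaReg s‖| ≤ C * (Real.log (|s.im| + 3) / l + Real.exp (2 * l)) := by
  obtain ⟨C0, hC0, hC0b⟩ := exists_zetaReg_bounds_of_two_le
  obtain ⟨A, hA, hAb⟩ := exists_norm_logDeriv_zetaReg_le_exp hRH
  have hlarge : ∀ s : ℂ, 2 ≤ s.re → |Real.log ‖zetaReg s‖| ≤ C0 := by
    intro s hs
    obtain ⟨h1, h2, -⟩ := hC0b s hs
    have hpos : 0 < ‖zetaReg s‖ := lt_of_lt_of_le (by positivity) h2
    have h3 := Real.log_le_log hpos h1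
    have h4 := Real.log_le_log (by positivity) h2
    have h5 := Real.log_le_sub_one_of_pos (show 0 < C0 by linarith)
    rw [Real.log_inv] at h4
    rw [abs_le]
    constructor <;> linarith
  refine ⟨C0 + 2 * A, by positivity, fun l hl s hs => ?_⟩
  have hl0 : 0 < l := by linarith
  have hE : 1 ≤ Real.exp (2 * l) := Real.one_le_exp (by positivity)
  have hℓ := one_le_log_abs_add_three s.im
  have hℓl : 0 ≤ Real.log (|s.im| + 3) / l := by positivity
  rcases le_total 2 s.re with h2 | h2
  · refine (hlarge s h2).trans ?_
    nlinarith [mul_nonneg hA.le hℓl, mul_nonneg (by linarith : 0 ≤ C0) hℓl]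
  have hhalf : 1 / 2 < s.re := by
    have : 0 < 4 / l := by positivity
    linarith
  set c : ℂ := 2 + s.im * Complex.I with hc
  have hcre : c.re = 2 := by simp [hc]
  have hball : ∀ z ∈ Metric.ball c (3 / 2), 1 / 2 < z.re := by
    intro z hz
    rw [Metric.mem_ball, dist_eq_norm] at hz
    have h3 := (abs_le.mp (Complex.abs_re_le_norm (z - c))).1
    rw [Complex.sub_re, hcre] at h3
    linarith
  obtain ⟨h, hder, hhc, hexp⟩ := exists_log_of_ne_zero (f := zetaReg) (c := c) (R := 3 / 2)
    (by norm_num)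
    (fun z hz => (differentiableAt_zetaReg (by linarith [hball z hz])).differentiableWithinAt)
    (fun z hz => zetaReg_ne_zero hRH (hball z hz))
  set p : ℝ → ℂ := fun τ => c - τ with hp
  have hpmem : ∀ τ ∈ Set.Icc 0 (2 - s.re), p τ ∈ Metric.ball c (3 / 2) := by
    intro τ hτ
    rw [Metric.mem_ball, dist_eq_norm]
    simp only [hp, sub_sub_cancel_left, norm_neg, Complex.norm_real, Real.norm_eq_abs]
    rw [abs_of_nonneg hτ.1]
    linarith [hτ.2]
  have hpd : ∀ τ ∈ Set.Icc 0 (2 - s.re), HasDerivAt (fun τ => h (p τ))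
      (deriv zetaReg (p τ) / zetaReg (p τ) * -1) τ := by
    intro τ hτ
    have h3 : HasDerivAt p (-1) τ := by
      simpa using (hasDerivAt_id τ).ofReal_comp.const_sub c
    exact (hder _ (hpmem τ hτ)).comp τ h3
  have hpre : ∀ τ, (p τ).re = 2 - τ := fun τ => by simp [hp, hcre]
  have hpim : ∀ τ, (p τ).im = s.im := fun τ => by simp [hp, hc]
  have hps : p (2 - s.re) = s := by
    apply Complex.ext
    · rw [hpre]; ring
    · rw [hpim]
  have hbd := image_norm_le_of_norm_deriv_right_le_deriv_boundary' (f := fun τ => h (p τ))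
    (f' := fun τ => deriv zetaReg (p τ) / zetaReg (p τ) * -1) (a := 0) (b := 2 - s.re)
    (B := fun τ => A * Real.exp (2 * l) * τ + 2 * A / l * Real.exp (-(l * (3 / 2 - τ) / 2)) *
      Real.log (|s.im| + 3))
    (B' := fun τ => A * Real.exp (2 * l) + A * Real.exp (-(l * (3 / 2 - τ) / 2)) *
      Real.log (|s.im| + 3))
    (fun τ hτ => (hpd τ hτ).continuousAt.continuousWithinAt)
    (fun τ hτ => (hpd τ (Set.Ico_subset_Icc_self hτ)).hasDerivWithinAt)
    (by
      simp only [hp, Complex.ofReal_zero, sub_zero, hhc, norm_zero]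
      positivity)
    (by fun_prop)
    (fun τ hτ => by
      have h3 : HasDerivAt (fun τ : ℝ => -(l * (3 / 2 - τ) / 2)) (l / 2) τ := by
        have := ((((hasDerivAt_id τ).const_sub (3 / 2)).const_mul l).div_const 2).neg
        refine this.congr_deriv ?_
        ring
      have h4 := ((hasDerivAt_id τ).const_mul (A * Real.exp (2 * l))).add
        ((h3.exp.const_mul (2 * A / l)).mul_const (Real.log (|s.im| + 3)))
      refine (h4.congr_deriv ?_).hasDerivWithinAt
      field_simp)
    (fun τ hτ => by
      rw [mul_neg_one, norm_neg]
      have h3 := hAb l hl (p τ) (by rw [hpre]; linarith [hτ.2]) (by rw [hpre]; linarith [hτ.1])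
      rw [hpre, hpim] at h3
      convert h3 using 5
      ring)
  have hlast := hbd (x := 2 - s.re) ⟨by linarith, le_refl _⟩
  simp only [hps] at hlast
  have hsmem : s ∈ Metric.ball c (3 / 2) := by
    have := hpmem (2 - s.re) ⟨by linarith, le_refl _⟩
    rwa [hps] at this
  have hlog : Real.log ‖zetaReg s‖ = Real.log ‖zetaReg c‖ + (h s).re := by
    rw [hexp s hsmem, norm_mul, Complex.norm_exp, Real.log_mul, Real.log_exp]
    · exact norm_ne_zero_iff.mpr (zetaReg_ne_zero hRH (by rw [hcre]; norm_num))
    · exact (Real.exp_pos _).ne'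
  have h3 := hlarge c hcre.ge
  have h4 := Complex.abs_re_le_norm (h s)
  have h5 : Real.exp (-(l * (3 / 2 - (2 - s.re)) / 2)) ≤ 1 := by
    rw [Real.exp_le_one_iff]
    nlinarith
  have h6 : 2 * A / l * Real.exp (-(l * (3 / 2 - (2 - s.re)) / 2)) * Real.log (|s.im| + 3) ≤
      2 * A * (Real.log (|s.im| + 3) / l) := by
    calc _ ≤ 2 * A / l * 1 * Real.log (|s.im| + 3) := by gcongr
      _ = _ := by ring
  have h7 : A * Real.exp (2 * l) * (2 - s.re) ≤ A * Real.exp (2 * l) * 2 := by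
    gcongr; linarith
  rw [hlog]
  refine (abs_add_le _ _).trans ?_
  nlinarith [mul_nonneg (by linarith : 0 ≤ C0) hℓl]

lemma one_add_sq_le_norm_mul_add_one {s : ℂ} (hs : 1 ≤ s.re) : 1 + s.im ^ 2 ≤ ‖s * (s + 1)‖ := by
  rw [norm_mul]
  have h1 : ‖s‖ ≤ ‖s + 1‖ := (norm_le_norm_add_one (by linarith)).1
  have h2 : ‖s‖ * ‖s‖ = s.re ^ 2 + s.im ^ 2 := by
    rw [← pow_two, Complex.sq_norm, Complex.normSq_apply]
    ring
  nlinarith [norm_nonneg s]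

lemma integrable_inv_mul_add_one :
    MeasureTheory.Integrable (fun t : ℝ => 1 / (((2 : ℝ) + t * Complex.I : ℂ) *
      ((2 : ℝ) + t * Complex.I + 1))) := by
  refine integrable_inv_one_add_sq.mono' (Continuous.aestronglyMeasurable ?_)
    (Eventually.of_forall fun t => ?_)
  · refine continuous_const.div (by fun_prop) fun t => ?_
    have := one_add_sq_le_norm_mul_add_one (s := (2 : ℝ) + t * Complex.I) (by simp)
    rw [← norm_pos_iff]
    nlinarith [sq_nonneg ((2 : ℝ) + t * Complex.I : ℂ).im]
  · have := one_add_sq_le_norm_mul_add_one (s := (2 : ℝ) + t * Complex.I) (by simp)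
    simp only [Complex.add_im, Complex.ofReal_im, Complex.mul_im, Complex.I_im, Complex.I_re,
      Complex.ofReal_re] at this
    rw [norm_div, norm_one, one_div]
    refine inv_anti₀ (by positivity) ?_
    simpa using this

lemma integral_perron_hat {x : ℝ} (hx : 0 < x) :
    (1 / (2 * Real.pi) : ℂ) * ∫ t : ℝ, (x : ℂ) ^ (-((2 : ℝ) + t * Complex.I : ℂ)) *
      (1 / (((2 : ℝ) + t * Complex.I : ℂ) * ((2 : ℝ) + t * Complex.I + 1))) =
    ((max (1 - x) 0 : ℝ) : ℂ) := by
  set g : ℝ → ℂ := fun t => (Set.Ioc 0 1).indicator (fun _ => 1 : ℝ → ℂ) t -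
    (Set.Ioc 0 1).indicator (fun t => (t : ℂ) ^ (1 : ℂ) : ℝ → ℂ) t with hg
  have hM : ∀ s : ℂ, 0 < s.re → HasMellin g s (1 / (s * (s + 1))) := by
    intro s hs
    have h1 := hasMellin_one_Ioc hs
    have h2 := hasMellin_cpow_Ioc 1 (s := s) (by simp; linarith)
    have h3 := hasMellin_sub h1.1 h2.1
    refine ⟨h3.1, h3.2.trans ?_⟩
    rw [h1.2, h2.2]
    have e1 : s ≠ 0 := fun h => by simp [h] at hs
    have e2 : s + 1 ≠ 0 := add_one_ne_zero_of_re (by linarith)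
    field_simp
    ring
  have hgx : ∀ u : ℝ, 0 < u → g u = ((max (1 - u) 0 : ℝ) : ℂ) := by
    intro u hu
    simp only [hg]
    rcases le_or_gt u 1 with h | h
    · rw [Set.indicator_of_mem (show u ∈ Set.Ioc 0 1 from ⟨hu, h⟩),
        Set.indicator_of_mem (show u ∈ Set.Ioc 0 1 from ⟨hu, h⟩), max_eq_left (by linarith)]
      simp
    · rw [Set.indicator_of_notMem (fun h' => by linarith [h'.2]),
        Set.indicator_of_notMem (fun h' => by linarith [h'.2]), max_eq_right (by linarith)]
      simp
  have hcont : ContinuousAt g x := by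
    have : g =ᶠ[nhds x] fun u => ((max (1 - u) 0 : ℝ) : ℂ) := by
      filter_upwards [lt_mem_nhds hx] with u hu using hgx u hu
    exact ContinuousAt.congr (by fun_prop) this.symm
  have hmel : ∀ t : ℝ, mellin g ((2 : ℝ) + t * Complex.I) =
      1 / (((2 : ℝ) + t * Complex.I : ℂ) * ((2 : ℝ) + t * Complex.I + 1)) := fun t =>
    (hM _ (by simp)).2
  have hv : Complex.VerticalIntegrable (mellin g) 2 := by
    unfold Complex.VerticalIntegrable
    simp_rw [hmel]
    exact integrable_inv_mul_add_one
  have h := mellinInv_mellin_eq 2 g hx (hM _ (by simp)).1 hv hcont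
  rw [← hgx x hx, ← h, mellinInv]
  simp_rw [hmel, smul_eq_mul]
  rw [Complex.real_smul]
  push_cast
  rfl

/-- The kernel of Perron's formula for sums up to `N`, averaged over `[N, N + 1]`. -/
noncomputable def perronKernel (N : ℕ) (s : ℂ) : ℂ :=
  (((N : ℂ) + 1) ^ (s + 1) - (N : ℂ) ^ (s + 1)) / (s * (s + 1))

lemma integrable_and_integral_perron {a M : ℝ} (ha : 0 < a) (hM : 0 < M) :
    MeasureTheory.Integrable (fun t : ℝ => (a : ℂ) ^ (-((2 : ℝ) + t * Complex.I : ℂ)) *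
      ((M : ℂ) ^ ((2 : ℝ) + t * Complex.I + 1 : ℂ) / (((2 : ℝ) + t * Complex.I : ℂ) *
      ((2 : ℝ) + t * Complex.I + 1)))) ∧
    ∫ t : ℝ, (a : ℂ) ^ (-((2 : ℝ) + t * Complex.I : ℂ)) *
      ((M : ℂ) ^ ((2 : ℝ) + t * Complex.I + 1 : ℂ) / (((2 : ℝ) + t * Complex.I : ℂ) *
      ((2 : ℝ) + t * Complex.I + 1))) = 2 * Real.pi * ((max (M - a) 0 : ℝ) : ℂ) := by
  have hM' : (M : ℂ) ≠ 0 := by exact_mod_cast hM.ne'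
  have ha' : (a : ℂ) ≠ 0 := by exact_mod_cast ha.ne'
  have key : ∀ t : ℝ, (a : ℂ) ^ (-((2 : ℝ) + t * Complex.I : ℂ)) *
      ((M : ℂ) ^ ((2 : ℝ) + t * Complex.I + 1 : ℂ) / (((2 : ℝ) + t * Complex.I : ℂ) *
      ((2 : ℝ) + t * Complex.I + 1))) = M * (((a / M : ℝ) : ℂ) ^ (-((2 : ℝ) + t * Complex.I : ℂ)) *
      (1 / (((2 : ℝ) + t * Complex.I : ℂ) * ((2 : ℝ) + t * Complex.I + 1)))) := by
    intro t
    rw [Complex.ofReal_div, Complex.div_cpow_ofReal_nonneg ha.le hM.le, Complex.cpow_add _ _ hM',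
      Complex.cpow_one, Complex.cpow_neg (M : ℂ), div_inv_eq_mul]
    ring
  have hInt : MeasureTheory.Integrable (fun t : ℝ => ((a / M : ℝ) : ℂ) ^
      (-((2 : ℝ) + t * Complex.I : ℂ)) *
      (1 / (((2 : ℝ) + t * Complex.I : ℂ) * ((2 : ℝ) + t * Complex.I + 1)))) := by
    have hq : 0 < a / M := by positivity
    refine integrable_inv_mul_add_one.bdd_mul (c := (a / M) ^ (-2 : ℝ)) ?_
      (Eventually.of_forall fun t => ?_)
    · refine Continuous.aestronglyMeasurable ?_
      refine Continuous.const_cpow (by fun_prop) (Or.inl (by exact_mod_cast hq.ne'))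
    · rw [Complex.norm_cpow_eq_rpow_re_of_pos hq]
      simp
  constructor
  · simp_rw [key]
    exact hInt.const_mul _
  · simp_rw [key]
    rw [MeasureTheory.integral_const_mul]
    have h := integral_perron_hat (x := a / M) (by positivity)
    have h1 : max (M - a) 0 = M * max (1 - a / M) 0 := by
      rw [← max_comm 0, ← max_comm 0, mul_max_of_nonneg _ _ hM.le, mul_zero]
      congr 1
      field_simp
    have h2 : (Real.pi : ℂ) ≠ 0 := by exact_mod_cast Real.pi_ne_zero
    rw [h1, Complex.ofReal_mul, ← h, mul_left_comm, ← mul_assoc _ (1 / _ : ℂ),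
      mul_one_div_cancel (mul_ne_zero two_ne_zero h2), one_mul]

lemma integrable_and_integral_perronKernel {a N : ℕ} (ha : 0 < a) (hN : 0 < N) :
    MeasureTheory.Integrable (fun t : ℝ => (a : ℂ) ^ (-((2 : ℝ) + t * Complex.I : ℂ)) *
      perronKernel N ((2 : ℝ) + t * Complex.I)) ∧
    ∫ t : ℝ, (a : ℂ) ^ (-((2 : ℝ) + t * Complex.I : ℂ)) *
      perronKernel N ((2 : ℝ) + t * Complex.I) = 2 * Real.pi * (if a ≤ N then 1 else 0) := by
  obtain ⟨i1, v1⟩ := integrable_and_integral_perron (a := a) (M := N + 1) (by positivity)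
    (by positivity)
  obtain ⟨i2, v2⟩ := integrable_and_integral_perron (a := a) (M := N) (by positivity)
    (by positivity)
  have key : ∀ t : ℝ, (a : ℂ) ^ (-((2 : ℝ) + t * Complex.I : ℂ)) *
      perronKernel N ((2 : ℝ) + t * Complex.I) =
      ((a : ℝ) : ℂ) ^ (-((2 : ℝ) + t * Complex.I : ℂ)) *
      ((((N : ℝ) + 1 : ℝ) : ℂ) ^ ((2 : ℝ) + t * Complex.I + 1 : ℂ) /
      (((2 : ℝ) + t * Complex.I : ℂ) * ((2 : ℝ) + t * Complex.I + 1))) -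
      ((a : ℝ) : ℂ) ^ (-((2 : ℝ) + t * Complex.I : ℂ)) *
      (((N : ℝ) : ℂ) ^ ((2 : ℝ) + t * Complex.I + 1 : ℂ) /
      (((2 : ℝ) + t * Complex.I : ℂ) * ((2 : ℝ) + t * Complex.I + 1))) := by
    intro t
    rw [perronKernel]
    push_cast
    ring
  constructor
  · simp_rw [key]
    exact i1.sub i2
  · simp_rw [key]
    rw [MeasureTheory.integral_sub i1 i2, v1, v2, ← mul_sub, ← Complex.ofReal_sub]
    congr 1
    split_ifs with h
    · have h' : (a : ℝ) ≤ N := by exact_mod_cast h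
      rw [max_eq_left (by linarith), max_eq_left (by linarith)]
      push_cast; ring
    · have h' : (N : ℝ) + 1 ≤ a := by exact_mod_cast (not_le.mp h)
      rw [max_eq_right (by linarith), max_eq_right (by linarith)]
      simp

lemma norm_perronKernel_numerator_le (N : ℕ) {s : ℂ} (hs : 0 ≤ s.re) :
    ‖((N : ℂ) + 1) ^ (s + 1) - (N : ℂ) ^ (s + 1)‖ ≤ 2 * ((N : ℝ) + 1) ^ (s.re + 1) := by
  refine (norm_sub_le _ _).trans ?_
  have e1 : ‖((N : ℂ) + 1) ^ (s + 1)‖ = ((N : ℝ) + 1) ^ (s.re + 1) := by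
    have := Complex.norm_natCast_cpow_of_pos (Nat.succ_pos N) (s + 1)
    push_cast at this
    simpa using this
  have e2 : ‖(N : ℂ) ^ (s + 1)‖ ≤ ((N : ℝ) + 1) ^ (s.re + 1) := by
    rcases Nat.eq_zero_or_pos N with h | h
    · rw [h, Nat.cast_zero, Complex.zero_cpow (add_one_ne_zero_of_re (by linarith)), norm_zero]
      positivity
    · rw [Complex.norm_natCast_cpow_of_pos h]
      simp only [Complex.add_re, Complex.one_re]
      gcongr
      linarith
  linarith

lemma norm_perronKernel_numerator_le' (N : ℕ) {s : ℂ} (hs : 0 ≤ s.re) (hN : 0 < N) :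
    ‖((N : ℂ) + 1) ^ (s + 1) - (N : ℂ) ^ (s + 1)‖ ≤ ‖s + 1‖ * ((N : ℝ) + 1) ^ s.re := by
  have hN' : (0 : ℝ) < N := by exact_mod_cast hN
  have h := (convex_Icc (0 : ℝ) 1).norm_image_sub_le_of_norm_hasDerivWithin_le
    (f := fun v : ℝ => (((N : ℝ) : ℂ) + v) ^ (s + 1))
    (f' := fun v : ℝ => (s + 1) * (((N : ℝ) : ℂ) + v) ^ (s + 1 - 1))
    (C := ‖s + 1‖ * ((N : ℝ) + 1) ^ s.re) (x := 0) (y := 1) ?_ ?_ (by simp) (by simp)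
  · simpa using h
  · intro v hv
    exact (hasDerivAt_add_cpow (by linarith [hv.1]) _).hasDerivWithinAt
  · intro v hv
    have hv0 : 0 < (N : ℝ) + v := by linarith [hv.1]
    rw [norm_mul, ← Complex.ofReal_add, Complex.norm_cpow_eq_rpow_re_of_pos hv0]
    simp only [add_sub_cancel_right]
    gcongr
    exact hv.2

lemma norm_perronKernel_le {N : ℕ} (hN : 0 < N) {s : ℂ} (hs : 0 < s.re) {θ : ℝ} (h0 : 0 ≤ θ)
    (h1 : θ ≤ 1) :
    ‖perronKernel N s‖ ≤ 2 * ((N : ℝ) + 1) ^ (s.re + θ) / ‖s‖ ^ (1 + θ) := by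
  have hs0 : 0 < ‖s‖ := lt_of_lt_of_le hs (Complex.re_le_norm s)
  have hs1 := (norm_le_norm_add_one hs.le).1
  have hs2 : 0 < ‖s + 1‖ := hs0.trans_le hs1
  set X := ‖((N : ℂ) + 1) ^ (s + 1) - (N : ℂ) ^ (s + 1)‖ with hX
  have hN1 : (0 : ℝ) < (N : ℝ) + 1 := by positivity
  have e1 : X ^ θ ≤ 2 * (((N : ℝ) + 1) ^ (s.re + 1)) ^ θ := by
    calc X ^ θ ≤ (2 * ((N : ℝ) + 1) ^ (s.re + 1)) ^ θ :=
          Real.rpow_le_rpow (norm_nonneg _) (norm_perronKernel_numerator_le N hs.le) h0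
      _ = 2 ^ θ * (((N : ℝ) + 1) ^ (s.re + 1)) ^ θ := Real.mul_rpow (by norm_num) (by positivity)
      _ ≤ 2 * (((N : ℝ) + 1) ^ (s.re + 1)) ^ θ := by
          gcongr
          calc (2 : ℝ) ^ θ ≤ 2 ^ (1 : ℝ) := by gcongr; norm_num
            _ = 2 := by norm_num
  have e2 : X ^ (1 - θ) ≤ ‖s + 1‖ ^ (1 - θ) * (((N : ℝ) + 1) ^ s.re) ^ (1 - θ) := by
    rw [← Real.mul_rpow (by positivity) (by positivity)]
    exact Real.rpow_le_rpow (norm_nonneg _) (norm_perronKernel_numerator_le' N hs.le hN)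
      (by linarith)
  have e3 : X ≤ 2 * ((N : ℝ) + 1) ^ (s.re + θ) * ‖s + 1‖ ^ (1 - θ) := by
    have hXX : X = X ^ θ * X ^ (1 - θ) := by
      have hX0 : 0 ≤ X := norm_nonneg _
      rcases hX0.eq_or_lt with h | h
      · rw [← h]
        rcases h0.eq_or_lt with h' | h'
        · rw [← h']; simp
        · rw [Real.zero_rpow h'.ne', zero_mul]
      · rw [← Real.rpow_add h]; simp
    rw [hXX]
    calc X ^ θ * X ^ (1 - θ) ≤ (2 * (((N : ℝ) + 1) ^ (s.re + 1)) ^ θ) *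
          (‖s + 1‖ ^ (1 - θ) * (((N : ℝ) + 1) ^ s.re) ^ (1 - θ)) := by gcongr
      _ = 2 * ((((N : ℝ) + 1) ^ (s.re + 1)) ^ θ * (((N : ℝ) + 1) ^ s.re) ^ (1 - θ)) *
          ‖s + 1‖ ^ (1 - θ) := by ring
      _ = _ := by
          rw [← Real.rpow_mul hN1.le, ← Real.rpow_mul hN1.le, ← Real.rpow_add hN1]
          congr 3
          ring
  rw [perronKernel, norm_div, norm_mul]
  change X / _ ≤ _
  rw [div_le_div_iff₀ (by positivity) (by positivity)]
  calc X * ‖s‖ ^ (1 + θ) ≤ 2 * ((N : ℝ) + 1) ^ (s.re + θ) * ‖s + 1‖ ^ (1 - θ) *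
        (‖s‖ * ‖s + 1‖ ^ θ) := by
        rw [Real.rpow_add hs0, Real.rpow_one]
        gcongr
    _ = 2 * ((N : ℝ) + 1) ^ (s.re + θ) * (‖s‖ * (‖s + 1‖ ^ (1 - θ) * ‖s + 1‖ ^ θ)) := by ring
    _ = _ := by rw [← Real.rpow_add hs2]; simp

lemma differentiableAt_perronKernel {N : ℕ} (hN : 0 < N) {s : ℂ} (hs : 0 < s.re) :
    DifferentiableAt ℂ (perronKernel N) s := by
  have e1 : s ≠ 0 := fun h => by simp [h] at hs
  have e2 : s + 1 ≠ 0 := add_one_ne_zero_of_re (by linarith)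
  have hN' : (N : ℂ) ≠ 0 := by exact_mod_cast hN.ne'
  have hN'' : (N : ℂ) + 1 ≠ 0 := by exact_mod_cast N.succ_ne_zero
  unfold perronKernel
  refine DifferentiableAt.div (.sub (.const_cpow (by fun_prop) (Or.inl hN''))
    (.const_cpow (by fun_prop) (Or.inl hN'))) (by fun_prop) (mul_ne_zero e1 e2)

/-- Perron's formula for a bounded sequence. -/
lemma sum_eq_integral_LSeries_mul_perronKernel {g : ℕ → ℂ} {K : ℝ} (hg : ∀ n, ‖g n‖ ≤ K) {N : ℕ}
    (hN : 0 < N) :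
    ∫ t : ℝ, LSeries g ((2 : ℝ) + t * Complex.I) * perronKernel N ((2 : ℝ) + t * Complex.I) =
      2 * Real.pi * ∑ n ∈ Finset.Icc 1 N, g n := by
  have hK : 0 ≤ K := (norm_nonneg _).trans (hg 0)
  set F : ℕ → ℝ → ℂ := fun n t => LSeries.term g ((2 : ℝ) + t * Complex.I) n *
    perronKernel N ((2 : ℝ) + t * Complex.I) with hF
  have hF0 : F 0 = 0 := by
    ext t
    simp [hF]
  have hFn : ∀ n, 0 < n → F n = fun t : ℝ => g n * ((n : ℂ) ^ (-((2 : ℝ) + t * Complex.I : ℂ)) *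
      perronKernel N ((2 : ℝ) + t * Complex.I)) := by
    intro n hn
    ext t
    simp only [hF]
    rw [LSeries.term_of_ne_zero hn.ne', Complex.cpow_neg]
    ring
  have hInt : ∀ n, MeasureTheory.Integrable (F n) := by
    intro n
    rcases Nat.eq_zero_or_pos n with h | h
    · rw [h, hF0]; exact MeasureTheory.integrable_zero _ _ _
    · rw [hFn n h]
      exact (integrable_and_integral_perronKernel h hN).1.const_mul _
  have hker : ∀ t : ℝ, ‖perronKernel N ((2 : ℝ) + t * Complex.I)‖ ≤
      2 * ((N : ℝ) + 1) ^ (3 : ℝ) * (1 + t ^ 2)⁻¹ := by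
    intro t
    have h1 := norm_perronKernel_numerator_le N (s := (2 : ℝ) + t * Complex.I) (by simp)
    have h2 := one_add_sq_le_norm_mul_add_one (s := (2 : ℝ) + t * Complex.I) (by simp)
    have h3 : ((2 : ℝ) + t * Complex.I : ℂ).im = t := by simp
    have h4 : ((2 : ℝ) + t * Complex.I : ℂ).re + 1 = 3 := by simp; norm_num
    rw [h3] at h2
    rw [h4] at h1
    rw [perronKernel, norm_div, ← div_eq_mul_inv]
    gcongr
  have hsum : Summable fun n => ∫ t, ‖F n t‖ := by
    have h1 : Summable fun n : ℕ => (K * (2 * ((N : ℝ) + 1) ^ (3 : ℝ) * Real.pi)) *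
        (1 / (n : ℝ) ^ 2) := (Real.summable_one_div_nat_pow.mpr (by norm_num)).mul_left _
    refine Summable.of_nonneg_of_le (fun n => MeasureTheory.integral_nonneg fun t => norm_nonneg _)
      (fun n => ?_) h1
    rcases Nat.eq_zero_or_pos n with h | h
    · rw [h, hF0]; simp
    · rw [hFn n h]
      have h2 : ∫ t : ℝ, K * (1 / (n : ℝ) ^ 2) * (2 * ((N : ℝ) + 1) ^ (3 : ℝ) * (1 + t ^ 2)⁻¹) =
          (K * (2 * ((N : ℝ) + 1) ^ (3 : ℝ) * Real.pi)) * (1 / (n : ℝ) ^ 2) := by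
        rw [MeasureTheory.integral_const_mul, MeasureTheory.integral_const_mul,
          integral_univ_inv_one_add_sq]
        ring
      rw [← h2]
      refine MeasureTheory.integral_mono ?_
        ((integrable_inv_one_add_sq.const_mul _).const_mul _) fun t => ?_
      · exact ((integrable_and_integral_perronKernel h hN).1.const_mul _).norm
      · simp only [norm_mul]
        rw [Complex.norm_natCast_cpow_of_pos h, mul_assoc]
        have : (n : ℝ) ^ (-((2 : ℝ) + t * Complex.I : ℂ)).re = 1 / (n : ℝ) ^ 2 := by
          simp
        rw [this]
        have := hg n
        have := hker t
        gcongr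
  have h := MeasureTheory.hasSum_integral_of_summable_integral_norm hInt hsum
  have hval : ∀ n, ∫ t, F n t = if n ∈ Finset.Icc 1 N then 2 * Real.pi * g n else 0 := by
    intro n
    rcases Nat.eq_zero_or_pos n with h | h
    · rw [h, hF0]; simp
    · rw [hFn n h, MeasureTheory.integral_const_mul, (integrable_and_integral_perronKernel h hN).2]
      have : n ∈ Finset.Icc 1 N ↔ n ≤ N := by
        rw [Finset.mem_Icc]; exact ⟨fun h => h.2, fun h' => ⟨h, h'⟩⟩
      simp only [this]
      split_ifs <;> ring
  simp_rw [hval] at h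
  have h2 := (hasSum_sum_of_ne_finset_zero (f := fun n => if n ∈ Finset.Icc 1 N then
    2 * Real.pi * g n else 0) (s := Finset.Icc 1 N) (fun n hn => by simp [hn])).unique h
  have h3 : 2 * Real.pi * ∑ n ∈ Finset.Icc 1 N, g n = ∑ b ∈ Finset.Icc 1 N,
      if b ∈ Finset.Icc 1 N then 2 * Real.pi * g b else 0 := by
    rw [Finset.mul_sum]
    exact Finset.sum_congr rfl (fun n hn => by rw [if_pos hn])
  rw [h3, h2]
  congr 1
  ext t
  simp only [hF, LSeries]
  rw [tsum_mul_right]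

section

open Asymptotics

/-- The Euler factor `∑ e_j z ^ j` of a fake Möbius function, with the factors
`(1 - z ^ j) ^ (-e_j)`, `k ≤ j < 2 k`, removed. -/
noncomputable def localFactor (e : ℕ → ℤ) (k : ℕ) (z : ℂ) : ℂ :=
  (∑' j, (e j : ℂ) * z ^ j) * ∏ j ∈ Finset.Icc k (2 * k - 1), (1 - z ^ j) ^ (e j)

lemma norm_intCast_le_one {a : ℤ} (ha : a = -1 ∨ a = 0 ∨ a = 1) : ‖(a : ℂ)‖ ≤ 1 := by
  rcases ha with h | h | h <;> simp [h]

lemma isBigO_pow_of_le {S : Set ℂ} {r : ℝ} (hS : ∀ z ∈ S, ‖z‖ ≤ r) (hr1 : r < 1) {a b : ℕ}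
    (hab : a ≤ b) : (fun z : ℂ => z ^ b) =O[𝓟 S] fun z => z ^ a := by
  refine IsBigO.of_bound 1 (eventually_principal.mpr fun z hz => ?_)
  rw [one_mul, norm_pow, norm_pow]
  exact pow_le_pow_of_le_one (norm_nonneg _) ((hS z hz).trans hr1.le) hab

lemma one_sub_norm_le_norm_one_sub_pow {z : ℂ} {r : ℝ} (hr1 : r < 1) (hz : ‖z‖ ≤ r) {j : ℕ}
    (hj : 1 ≤ j) : 1 - r ≤ ‖1 - z ^ j‖ := by
  have h1 : ‖z ^ j‖ ≤ r := by
    rw [norm_pow]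
    exact (pow_le_of_le_one (norm_nonneg _) (hz.trans hr1.le) (by omega)).trans hz
  have h2 := norm_sub_norm_le (1 : ℂ) (z ^ j)
  rw [norm_one] at h2
  linarith

lemma isBigO_one_sub_pow_zpow {e : ℤ} (he : e = -1 ∨ e = 0 ∨ e = 1) {r : ℝ}
    (hr1 : r < 1) {k j : ℕ} (hk : 1 ≤ k) (hkj : k ≤ j) :
    (fun z : ℂ => (1 - z ^ j) ^ e - (1 - e * z ^ j)) =O[𝓟 {z | ‖z‖ ≤ r}]
      fun z => z ^ (2 * k) := by
  rcases he with h | h | h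
  · have h1 : (fun z : ℂ => z ^ (2 * j) * (1 - z ^ j)⁻¹) =O[𝓟 {z | ‖z‖ ≤ r}]
        fun z => z ^ (2 * k) := by
      have h2 : (fun z : ℂ => (1 - z ^ j)⁻¹) =O[𝓟 {z | ‖z‖ ≤ r}] fun _ => (1 : ℂ) := by
        refine IsBigO.of_bound (1 - r)⁻¹ (eventually_principal.mpr fun z hz => ?_)
        rw [norm_one, mul_one, norm_inv]
        exact inv_anti₀ (by linarith) (one_sub_norm_le_norm_one_sub_pow hr1 hz (hk.trans hkj))
      simpa using (isBigO_pow_of_le (S := {z | ‖z‖ ≤ r}) (fun z hz => hz) hr1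
        (show 2 * k ≤ 2 * j by omega)).mul h2
    refine h1.congr' (eventually_principal.mpr fun z hz => ?_) EventuallyEq.rfl
    have h3 := one_sub_norm_le_norm_one_sub_pow hr1 hz (hk.trans hkj)
    have h4 : 1 - z ^ j ≠ 0 := fun h => by rw [h, norm_zero] at h3; linarith
    simp only [h, zpow_neg_one]
    push_cast
    field_simp
    ring
  · simpa [h] using isBigO_zero _ _
  · simpa [h] using isBigO_zero _ _

lemma isBigO_prod_one_sub_pow {e : ℕ → ℤ} (he : ∀ j, e j = -1 ∨ e j = 0 ∨ e j = 1) {r : ℝ}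
    (hr1 : r < 1) {k : ℕ} (hk : 1 ≤ k) (s : Finset ℕ) (hs : ∀ j ∈ s, k ≤ j) :
    (fun z : ℂ => ∏ j ∈ s, (1 - z ^ j) ^ (e j) - (1 - ∑ j ∈ s, (e j : ℂ) * z ^ j))
      =O[𝓟 {z | ‖z‖ ≤ r}] fun z => z ^ (2 * k) := by
  have hpow : ∀ a b : ℕ, a ≤ b → (fun z : ℂ => z ^ b) =O[𝓟 {z | ‖z‖ ≤ r}] fun z => z ^ a :=
    fun a b hab => isBigO_pow_of_le (fun z hz => hz) hr1 hab
  have hone : ∀ b : ℕ, (fun z : ℂ => z ^ b) =O[𝓟 {z | ‖z‖ ≤ r}] fun _ => (1 : ℂ) := fun b => by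
    simpa using hpow 0 b (Nat.zero_le _)
  have hmono : ∀ j, k ≤ j → (fun z : ℂ => (e j : ℂ) * z ^ j) =O[𝓟 {z | ‖z‖ ≤ r}]
      fun z => z ^ k := fun j hj => (hpow k j hj).const_mul_left _
  induction s using Finset.induction_on with
  | empty => simpa using isBigO_zero _ _
  | insert i s hi ih =>
    have hs' : ∀ j ∈ s, k ≤ j := fun j hj => hs j (Finset.mem_insert_of_mem hj)
    have hik : k ≤ i := hs i (Finset.mem_insert_self _ _)
    have hb := ih hs'
    have hS : (fun z : ℂ => ∑ j ∈ s, (e j : ℂ) * z ^ j) =O[𝓟 {z | ‖z‖ ≤ r}] fun z => z ^ k :=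
      IsBigO.fun_sum fun j hj => hmono j (hs' j hj)
    have hQ : (fun z : ℂ => ∏ j ∈ s, (1 - z ^ j) ^ (e j)) =O[𝓟 {z | ‖z‖ ≤ r}]
        fun _ => (1 : ℂ) := by
      have h1 := (hb.trans (hone (2 * k))).add
        ((isBigO_refl (fun _ : ℂ => (1 : ℂ)) _).sub (hS.trans (hone k)))
      refine h1.congr_left fun z => ?_
      ring
    have ha := isBigO_one_sub_pow_zpow (he i) hr1 hk hik
    have hw : (fun z : ℂ => 1 - (e i : ℂ) * z ^ i) =O[𝓟 {z | ‖z‖ ≤ r}] fun _ => (1 : ℂ) :=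
      (isBigO_refl (fun _ : ℂ => (1 : ℂ)) _).sub ((hmono i hik).trans (hone k))
    have h1 := (((ha.mul hQ).congr_right (g₂ := fun z => z ^ (2 * k)) fun z => by ring).add
      ((hw.mul hb).congr_right (g₂ := fun z => z ^ (2 * k)) fun z => by ring)).add
      (((hmono i hik).mul hS).congr_right (g₂ := fun z => z ^ (2 * k)) fun z => by ring)
    refine h1.congr_left fun z => ?_
    rw [Finset.prod_insert hi, Finset.sum_insert hi]
    ring

lemma isBigO_tsum_pow {e : ℕ → ℤ} (he : ∀ j, e j = -1 ∨ e j = 0 ∨ e j = 1) {r : ℝ}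
    (hr1 : r < 1) (m : ℕ) :
    (fun z : ℂ => ∑' j, (e j : ℂ) * z ^ j - ∑ j ∈ Finset.range m, (e j : ℂ) * z ^ j)
      =O[𝓟 {z | ‖z‖ ≤ r}] fun z => z ^ m := by
  refine IsBigO.of_bound (1 - r)⁻¹ (eventually_principal.mpr fun z hz => ?_)
  have hz1 : ‖z‖ < 1 := lt_of_le_of_lt hz hr1
  have hsum : Summable fun j => (e j : ℂ) * z ^ j := by
    refine Summable.of_norm_bounded (summable_geometric_of_lt_one (norm_nonneg z) hz1) fun j => ?_
    rw [norm_mul, norm_pow]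
    exact mul_le_of_le_one_left (by positivity) (norm_intCast_le_one (he j))
  rw [← hsum.sum_add_tsum_nat_add m, add_sub_cancel_left]
  have h1 : HasSum (fun j => ‖z‖ ^ m * ‖z‖ ^ j) (‖z‖ ^ m * (1 - ‖z‖)⁻¹) :=
    (hasSum_geometric_of_lt_one (norm_nonneg z) hz1).mul_left _
  refine (tsum_of_norm_bounded h1 fun j => ?_).trans ?_
  · rw [norm_mul, norm_pow, pow_add, mul_comm (‖z‖ ^ j)]
    exact mul_le_of_le_one_left (by positivity) (norm_intCast_le_one (he _))
  · rw [norm_pow, mul_comm]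
    gcongr
    exact hz

lemma exists_norm_localFactor_sub_one_le {e : ℕ → ℤ}
    (he : ∀ j, e j = -1 ∨ e j = 0 ∨ e j = 1) (he0 : e 0 = 1) {r : ℝ}
    (hr1 : r < 1) {k : ℕ} (hk : 1 ≤ k) (hzero : ∀ j, 1 ≤ j → j ≤ k - 1 → e j = 0) :
    ∃ B : ℝ, 0 < B ∧ ∀ z : ℂ, ‖z‖ ≤ r → ‖localFactor e k z - 1‖ ≤ B * ‖z‖ ^ (2 * k) := by
  have hone : ∀ b : ℕ, (fun z : ℂ => z ^ b) =O[𝓟 {z | ‖z‖ ≤ r}] fun _ => (1 : ℂ) := fun b => by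
    simpa using isBigO_pow_of_le (S := {z : ℂ | ‖z‖ ≤ r}) (fun z hz => hz) hr1 (Nat.zero_le b)
  set S : ℂ → ℂ := fun z => ∑ j ∈ Finset.Icc k (2 * k - 1), (e j : ℂ) * z ^ j with hS
  have hSk : S =O[𝓟 {z | ‖z‖ ≤ r}] fun z => z ^ k :=
    IsBigO.fun_sum fun j hj => (isBigO_pow_of_le (S := {z : ℂ | ‖z‖ ≤ r}) (fun z hz => hz) hr1
      (Finset.mem_Icc.mp hj).1).const_mul_left _
  have hrange : ∀ z : ℂ, ∑ j ∈ Finset.range (2 * k), (e j : ℂ) * z ^ j = 1 + S z := by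
    intro z
    have h1 : Finset.range (2 * k) = Finset.range k ∪ Finset.Icc k (2 * k - 1) := by
      ext j; simp; omega
    rw [h1, Finset.sum_union (Finset.disjoint_left.mpr fun j hj hj' => by
      rw [Finset.mem_range] at hj
      rw [Finset.mem_Icc] at hj'
      omega)]
    congr 1
    rw [Finset.sum_eq_single_of_mem 0 (Finset.mem_range.mpr hk)]
    · simp [he0]
    · intro j hj hj0
      rw [hzero j (by omega) (by rw [Finset.mem_range] at hj; omega)]
      simp
  have hb := isBigO_tsum_pow he hr1 (2 * k)
  have hb' := isBigO_prod_one_sub_pow he hr1 hk (Finset.Icc k (2 * k - 1))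
    fun j hj => (Finset.mem_Icc.mp hj).1
  simp only [hrange] at hb
  have hU : (fun z : ℂ => 1 + S z) =O[𝓟 {z | ‖z‖ ≤ r}] fun _ => (1 : ℂ) :=
    (isBigO_refl (fun _ : ℂ => (1 : ℂ)) _).add (hSk.trans (hone k))
  have hQ : (fun z : ℂ => ∏ j ∈ Finset.Icc k (2 * k - 1), (1 - z ^ j) ^ (e j))
      =O[𝓟 {z | ‖z‖ ≤ r}] fun _ => (1 : ℂ) := by
    have h1 := (hb'.trans (hone (2 * k))).add
      ((isBigO_refl (fun _ : ℂ => (1 : ℂ)) _).sub (hSk.trans (hone k)))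
    refine h1.congr_left fun z => ?_
    ring
  have h1 := (((hb.mul hQ).congr_right (g₂ := fun z => z ^ (2 * k)) fun z => by ring).add
    ((hU.mul hb').congr_right (g₂ := fun z => z ^ (2 * k)) fun z => by ring)).sub
    ((hSk.mul hSk).congr_right (g₂ := fun z => z ^ (2 * k)) fun z => by ring)
  obtain ⟨B, hB, h2⟩ := h1.exists_pos
  refine ⟨B, hB, fun z hz => ?_⟩
  have h3 := eventually_principal.mp h2.bound z hz
  rw [norm_pow] at h3
  refine le_of_eq_of_le ?_ h3
  rw [localFactor]
  congr 1
  simp only [hS]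
  ring

end

/-- The part of the Euler product of a fake Möbius function that converges for
`1 / (2 k) < re s`. -/
noncomputable def eulerRemainder (e : ℕ → ℤ) (k : ℕ) (s : ℂ) : ℂ :=
  ∏' p : Nat.Primes, localFactor e k ((p : ℂ) ^ (-s))

lemma exists_tsum_rpow_neg_le :
    ∃ C : ℝ, 0 < C ∧ ∀ w : ℝ, 1 < w → w ≤ 2 → ∑' n : ℕ, (n : ℝ) ^ (-w) ≤ C / (w - 1) := by
  obtain ⟨C, hC, h⟩ := exists_norm_zetaReg_le (σ := 1) one_pos
  refine ⟨9 * C, by positivity, fun w hw hw2 => ?_⟩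
  have h1 : ((∑' n : ℕ, (n : ℝ) ^ (-w) : ℝ) : ℂ) = riemannZeta w := by
    rw [zeta_eq_tsum_one_div_nat_cpow (by simpa using hw), Complex.ofReal_tsum]
    congr 1
    ext n
    rw [Complex.ofReal_cpow (Nat.cast_nonneg n), Complex.ofReal_neg, Complex.cpow_neg, one_div]
    simp
  have h2 : ∑' n : ℕ, (n : ℝ) ^ (-w) ≤ ‖riemannZeta w‖ := by
    rw [← h1, Complex.norm_real]
    exact Real.le_norm_self _
  refine h2.trans ?_
  have hw1 : (w : ℂ) ≠ 1 := by exact_mod_cast hw.ne'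
  have h3 := h w (by simpa using hw.le)
  rw [Complex.norm_real, Real.norm_of_nonneg (by linarith)] at h3
  rw [riemannZeta_eq_zetaReg hw1 (by simp; linarith), norm_mul, norm_div]
  have e1 : ‖(w : ℂ) + 1‖ = w + 1 := by
    rw [← Complex.ofReal_one, ← Complex.ofReal_add, Complex.norm_real,
      Real.norm_of_nonneg (by linarith)]
  have e2 : ‖(w : ℂ) - 1‖ = w - 1 := by
    rw [← Complex.ofReal_one, ← Complex.ofReal_sub, Complex.norm_real,
      Real.norm_of_nonneg (by linarith)]
  rw [e1, e2, div_mul_eq_mul_div]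
  have hw0 : 0 < w - 1 := by linarith
  refine div_le_div_of_nonneg_right ?_ hw0.le
  calc (w + 1) * ‖zetaReg w‖ ≤ 3 * (C * 3) := by
        gcongr
        · linarith
        · exact h3.trans (by gcongr; linarith)
    _ = _ := by ring

lemma differentiableOn_localFactor {e : ℕ → ℤ} (he : ∀ j, e j = -1 ∨ e j = 0 ∨ e j = 1) {k : ℕ}
    (hk : 1 ≤ k) {r : ℝ} (hr0 : 0 < r) (hr1 : r < 1) :
    DifferentiableOn ℂ (localFactor e k) (Metric.ball 0 r) := by
  refine DifferentiableOn.mul ?_ ?_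
  · refine Complex.differentiableOn_tsum_of_summable_norm
      (summable_geometric_of_lt_one hr0.le hr1) (fun j => by fun_prop) Metric.isOpen_ball ?_
    intro j z hz
    rw [mem_ball_zero_iff] at hz
    rw [norm_mul, norm_pow]
    calc ‖(e j : ℂ)‖ * ‖z‖ ^ j ≤ 1 * r ^ j := by
          gcongr
          exact norm_intCast_le_one (he j)
      _ = _ := one_mul _
  · intro z hz
    rw [mem_ball_zero_iff] at hz
    refine (DifferentiableAt.fun_finsetProd fun j hj => ?_).differentiableWithinAt
    refine DifferentiableAt.zpow (by fun_prop) (Or.inl fun h => ?_)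
    have h1 := one_sub_norm_le_norm_one_sub_pow hr1 hz.le (hk.trans (Finset.mem_Icc.mp hj).1)
    rw [h, norm_zero] at h1
    linarith

lemma norm_prime_cpow_neg (p : Nat.Primes) (s : ℂ) : ‖(p : ℂ) ^ (-s)‖ = (p : ℝ) ^ (-s.re) := by
  rw [Complex.norm_natCast_cpow_of_pos p.2.pos, Complex.neg_re]

lemma norm_prime_cpow_neg_le (p : Nat.Primes) {s : ℂ} {σ : ℝ} (h0 : 0 ≤ σ) (hs : σ ≤ s.re) :
    ‖(p : ℂ) ^ (-s)‖ ≤ (2 : ℝ) ^ (-σ) := by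
  have hp : (2 : ℝ) ≤ p := by exact_mod_cast p.2.two_le
  rw [norm_prime_cpow_neg]
  calc (p : ℝ) ^ (-s.re) ≤ (p : ℝ) ^ (-σ) :=
        Real.rpow_le_rpow_of_exponent_le (by linarith) (by linarith)
    _ ≤ _ := Real.rpow_le_rpow_of_nonpos (by norm_num) hp (by linarith)

section

variable {e : ℕ → ℤ} {k : ℕ}

lemma exists_norm_localFactor_prime_le (he : ∀ j, e j = -1 ∨ e j = 0 ∨ e j = 1) (he0 : e 0 = 1)
    (hk : 1 ≤ k) (hzero : ∀ j, 1 ≤ j → j ≤ k - 1 → e j = 0) :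
    ∃ B : ℝ, 0 < B ∧ ∀ σ : ℝ, 1 / (2 * k : ℝ) ≤ σ → ∀ s : ℂ, σ ≤ s.re → ∀ p : Nat.Primes,
      ‖localFactor e k ((p : ℂ) ^ (-s)) - 1‖ ≤ B * (p : ℝ) ^ (-(2 * k * σ)) := by
  have hk0 : (0 : ℝ) < 1 / (2 * k : ℝ) := by positivity
  obtain ⟨B, hB, h⟩ := exists_norm_localFactor_sub_one_le he he0
    (r := (2 : ℝ) ^ (-(1 / (2 * k : ℝ))))
    (Real.rpow_lt_one_of_one_lt_of_neg one_lt_two (by linarith)) hk hzero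
  refine ⟨B, hB, fun σ hσ s hs p => ?_⟩
  refine (h _ (norm_prime_cpow_neg_le p hk0.le (hσ.trans hs))).trans ?_
  have hp : (1 : ℝ) ≤ p := by exact_mod_cast p.2.one_le
  rw [norm_prime_cpow_neg, ← Real.rpow_natCast, ← Real.rpow_mul (by positivity)]
  refine mul_le_mul_of_nonneg_left (Real.rpow_le_rpow_of_exponent_le hp ?_) hB.le
  push_cast
  nlinarith

lemma summable_prime_rpow_neg {w : ℝ} (hw : 1 < w) :
    Summable fun p : Nat.Primes => (p : ℝ) ^ (-w) :=
  (Real.summable_nat_rpow.mpr (by linarith)).comp_injective Nat.Primes.coe_nat_injective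

lemma hasProd_eulerRemainder (he : ∀ j, e j = -1 ∨ e j = 0 ∨ e j = 1) (he0 : e 0 = 1)
    (hk : 1 ≤ k) (hzero : ∀ j, 1 ≤ j → j ≤ k - 1 → e j = 0) {s : ℂ}
    (hs : 1 / (2 * k : ℝ) < s.re) :
    HasProd (fun p : Nat.Primes => localFactor e k ((p : ℂ) ^ (-s))) (eulerRemainder e k s) := by
  obtain ⟨B, hB, h⟩ := exists_norm_localFactor_prime_le he he0 hk hzero
  have hw : 1 < 2 * k * s.re := by
    rw [div_lt_iff₀ (by positivity)] at hs
    linarith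
  have hsum : Summable fun p : Nat.Primes => ‖localFactor e k ((p : ℂ) ^ (-s)) - 1‖ :=
    Summable.of_nonneg_of_le (fun p => norm_nonneg _) (h s.re hs.le s le_rfl)
      ((summable_prime_rpow_neg hw).mul_left B)
  have := multipliable_one_add_of_summable hsum
  simp only [add_sub_cancel] at this
  exact this.hasProd

lemma differentiableOn_eulerRemainder (he : ∀ j, e j = -1 ∨ e j = 0 ∨ e j = 1) (he0 : e 0 = 1)
    (hk : 1 ≤ k) (hzero : ∀ j, 1 ≤ j → j ≤ k - 1 → e j = 0) :
    DifferentiableOn ℂ (eulerRemainder e k) {s | 1 / (2 * k : ℝ) < s.re} := by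
  obtain ⟨B, hB, h⟩ := exists_norm_localFactor_prime_le he he0 hk hzero
  have hk0 : (0 : ℝ) < 1 / (2 * k : ℝ) := by positivity
  intro s hs
  have hs : 1 / (2 * k : ℝ) < s.re := hs
  obtain ⟨σ, hσ, hσs⟩ := exists_between hs
  have hopen : IsOpen {z : ℂ | σ < z.re} := isOpen_lt continuous_const Complex.continuous_re
  have hw : 1 < 2 * k * σ := by
    rw [div_lt_iff₀ (by positivity)] at hσ
    linarith
  have hd : ∀ p : Nat.Primes, DifferentiableOn ℂ
      (fun z : ℂ => localFactor e k ((p : ℂ) ^ (-z))) {z | σ < z.re} := by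
    intro p
    have hr : (2 : ℝ) ^ (-(1 / (2 * k : ℝ))) < 1 :=
      Real.rpow_lt_one_of_one_lt_of_neg one_lt_two (by linarith)
    refine (differentiableOn_localFactor he hk (by positivity) hr).comp
      (t := Metric.ball 0 ((2 : ℝ) ^ (-(1 / (2 * k : ℝ))))) ?_ ?_
    · intro z _
      exact (DifferentiableAt.const_cpow (by fun_prop)
        (Or.inl (by exact_mod_cast p.2.ne_zero))).differentiableWithinAt
    · intro z hz
      have hz : σ < z.re := hz
      rw [mem_ball_zero_iff]
      refine (norm_prime_cpow_neg_le p (hk0.trans hσ).le hz.le).trans_lt ?_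
      exact Real.rpow_lt_rpow_of_exponent_lt one_lt_two (by linarith)
  have hprod := Summable.hasProdLocallyUniformlyOn_one_add
    (f := fun (p : Nat.Primes) (z : ℂ) => localFactor e k ((p : ℂ) ^ (-z)) - 1) hopen
    ((summable_prime_rpow_neg hw).mul_left B)
    (Eventually.of_forall fun p z (hz : σ < z.re) => h σ hσ.le z hz.le p)
    (fun p => ((hd p).sub_const 1).continuousOn)
  simp only [add_sub_cancel] at hprod
  have hfin := TendstoLocallyUniformlyOn.differentiableOn
    (hasProdLocallyUniformlyOn_iff_tendstoLocallyUniformlyOn.mp hprod)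
    (Eventually.of_forall fun t => DifferentiableOn.fun_finsetProd fun p _ => hd p) hopen
  exact (hfin.differentiableAt (hopen.mem_nhds hσs)).differentiableWithinAt

lemma exists_norm_eulerRemainder_le (he : ∀ j, e j = -1 ∨ e j = 0 ∨ e j = 1) (he0 : e 0 = 1)
    (hk : 1 ≤ k) (hzero : ∀ j, 1 ≤ j → j ≤ k - 1 → e j = 0) :
    ∃ C : ℝ, 0 < C ∧ ∀ l : ℝ, 8 * (k : ℝ) ≤ l → ∀ s : ℂ, 1 / (2 * k : ℝ) + 4 / l ≤ s.re →
      ‖eulerRemainder e k s‖ ≤ Real.exp (C * l) := by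
  obtain ⟨B, hB, h⟩ := exists_norm_localFactor_prime_le he he0 hk hzero
  obtain ⟨C, hC, hCb⟩ := exists_tsum_rpow_neg_le
  refine ⟨B * C, by positivity, fun l hl s hs => ?_⟩
  have hk' : (1 : ℝ) ≤ k := by exact_mod_cast hk
  have hl0 : 0 < l := by linarith
  set σ : ℝ := 1 / (2 * k : ℝ) + 4 / l with hσ
  have h4 : 0 < 4 / l := by positivity
  have hw : 2 * k * σ = 1 + 8 * k / l := by
    rw [hσ]; field_simp; ring
  have hw1 : 1 < 2 * k * σ := by
    rw [hw]; have : 0 < 8 * k / l := by positivity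
    linarith
  have hw2 : 2 * k * σ ≤ 2 := by
    rw [hw]
    have : 8 * k / l ≤ 1 := by rw [div_le_one hl0]; exact hl
    linarith
  have hprod := hasProd_eulerRemainder he he0 hk hzero (s := s) (by linarith)
  refine le_of_tendsto hprod.norm (Eventually.of_forall fun t => ?_)
  calc ∏ p ∈ t, ‖localFactor e k ((p : ℂ) ^ (-s))‖
      ≤ ∏ p ∈ t, Real.exp (B * (p : ℝ) ^ (-(2 * k * σ))) := by
        refine Finset.prod_le_prod (fun p _ => norm_nonneg _) fun p _ => ?_
        have h1 := h σ (by linarith) s hs p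
        have h2 := norm_le_norm_sub_add (localFactor e k ((p : ℂ) ^ (-s))) 1
        rw [norm_one] at h2
        linarith [Real.add_one_le_exp (B * (p : ℝ) ^ (-(2 * k * σ)))]
    _ = Real.exp (∑ p ∈ t, B * (p : ℝ) ^ (-(2 * k * σ))) := (Real.exp_sum _ _).symm
    _ ≤ Real.exp (B * C * l) := by
        refine Real.exp_le_exp.mpr ?_
        rw [← Finset.mul_sum, mul_assoc B]
        refine mul_le_mul_of_nonneg_left ?_ hB.le
        calc ∑ p ∈ t, (p : ℝ) ^ (-(2 * k * σ)) ≤ ∑' p : Nat.Primes, (p : ℝ) ^ (-(2 * k * σ)) :=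
              (summable_prime_rpow_neg hw1).sum_le_tsum _ fun p _ => by positivity
          _ ≤ ∑' n : ℕ, (n : ℝ) ^ (-(2 * k * σ)) :=
              tsum_comp_le_tsum_of_inj (Real.summable_nat_rpow.mpr (by linarith))
                (fun n => by positivity) Nat.Primes.coe_nat_injective
          _ ≤ C / (2 * k * σ - 1) := hCb _ hw1 hw2
          _ ≤ C * l := by
              rw [hw, add_sub_cancel_left, div_div_eq_mul_div]
              rw [div_le_iff₀ (by positivity)]
              nlinarith [mul_pos hC hl0]

lemma zpow_mul_ite_eq {K : Type*} [Field K] {a : ℤ} (ha : a = -1 ∨ a = 0 ∨ a = 1) {x : K}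
    (hx : x ≠ 0) : x ^ a * (if a = 1 then x⁻¹ else 1) = if a = -1 then x⁻¹ else 1 := by
  rcases ha with h | h | h <;> simp [h, hx]

/-- The Dirichlet series of a fake Möbius function in terms of zeta. -/
lemma LSeries_mul_prod_eq {f : ℕ → ℤ} (hf1 : f 1 = 1)
    (hmul : ∀ m n : ℕ, Nat.Coprime m n → f (m * n) = f m * f n)
    (hle : ∀ n, n ≠ 0 → ‖(f n : ℂ)‖ ≤ 1)
    (hfp : ∀ p : ℕ, Nat.Prime p → ∀ j : ℕ, f (p ^ j) = e j)
    (he : ∀ j, e j = -1 ∨ e j = 0 ∨ e j = 1) (he0 : e 0 = 1)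
    (hk : 1 ≤ k) (hzero : ∀ j, 1 ≤ j → j ≤ k - 1 → e j = 0) {s : ℂ} (hs : 1 < s.re) :
    LSeries (fun n => (f n : ℂ)) s *
      ∏ j ∈ Finset.Icc k (2 * k - 1), (if e j = -1 then riemannZeta (j * s) else 1) =
    eulerRemainder e k s *
      ∏ j ∈ Finset.Icc k (2 * k - 1), (if e j = 1 then riemannZeta (j * s) else 1) := by
  have hk' : (1 : ℝ) ≤ k := by exact_mod_cast hk
  have hk1 : 1 / (2 * k : ℝ) < s.re := by
    rw [div_lt_iff₀ (by positivity)]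
    nlinarith
  have hterm : ∀ n, n ≠ 0 → LSeries.term (fun n => (f n : ℂ)) s n = f n * (n : ℂ) ^ (-s) := by
    intro n hn
    rw [LSeries.term_of_ne_zero hn, Complex.cpow_neg, div_eq_mul_inv]
  have hF : HasProd (fun p : Nat.Primes => ∑' j, (e j : ℂ) * ((p : ℂ) ^ (-s)) ^ j)
      (LSeries (fun n => (f n : ℂ)) s) := by
    have h := EulerProduct.eulerProduct_hasProd (f := LSeries.term (fun n => (f n : ℂ)) s)
      (by rw [hterm 1 one_ne_zero]; simp [hf1])
      (fun {m n} hmn => by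
        rcases eq_or_ne m 0 with hm | hm
        · simp [hm]
        rcases eq_or_ne n 0 with hn | hn
        · simp [hn]
        rw [hterm _ (mul_ne_zero hm hn), hterm _ hm, hterm _ hn, hmul m n hmn]
        push_cast
        rw [Complex.natCast_mul_natCast_cpow]
        ring)
      (LSeriesSummable_of_bounded_of_one_lt_re hle hs).norm
      (LSeries.term_zero _ _)
    have hfun : (fun p : Nat.Primes => ∑' j, (e j : ℂ) * ((p : ℂ) ^ (-s)) ^ j) =
        fun p : Nat.Primes => ∑' j, LSeries.term (fun n => (f n : ℂ)) s ((p : ℕ) ^ j) := by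
      ext p
      congr 1
      ext j
      rw [hterm _ (pow_ne_zero _ p.2.ne_zero), hfp p p.2 j]
      congr 1
      push_cast
      rw [← Complex.natCast_cpow_natCast_mul, ← Complex.cpow_nat_mul]
    rw [hfun]
    exact h
  have hz : ∀ j ∈ Finset.Icc k (2 * k - 1), HasProd
      (fun p : Nat.Primes => (1 - ((p : ℂ) ^ (-s)) ^ j)⁻¹) (riemannZeta (j * s)) := by
    intro j hj
    have hj1 : (1 : ℝ) ≤ j := by exact_mod_cast hk.trans (Finset.mem_Icc.mp hj).1
    have h := riemannZeta_eulerProduct_hasProd (s := j * s) (by simp; nlinarith)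
    convert h using 3 with p
    rw [← Complex.cpow_nat_mul]
    congr 2
    ring
  have hite : ∀ a : ℤ, HasProd (fun p : Nat.Primes => ∏ j ∈ Finset.Icc k (2 * k - 1),
      (if e j = a then (1 - ((p : ℂ) ^ (-s)) ^ j)⁻¹ else 1))
      (∏ j ∈ Finset.Icc k (2 * k - 1), (if e j = a then riemannZeta (j * s) else 1)) := by
    intro a
    refine hasProd_prod fun j hj => ?_
    split_ifs
    · exact hz j hj
    · exact hasProd_one
  have h1 := hF.mul (hite (-1))
  have h2 := (hasProd_eulerRemainder he he0 hk hzero hk1).mul (hite 1)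
  have hr : (2 : ℝ) ^ (-1 : ℝ) < 1 := by norm_num
  have hfun : ∀ p : Nat.Primes, (∑' j, (e j : ℂ) * ((p : ℂ) ^ (-s)) ^ j) *
      (∏ j ∈ Finset.Icc k (2 * k - 1),
        (if e j = -1 then (1 - ((p : ℂ) ^ (-s)) ^ j)⁻¹ else 1)) =
      localFactor e k ((p : ℂ) ^ (-s)) * (∏ j ∈ Finset.Icc k (2 * k - 1),
        (if e j = 1 then (1 - ((p : ℂ) ^ (-s)) ^ j)⁻¹ else 1)) := by
    intro p
    have hne : ∀ j ∈ Finset.Icc k (2 * k - 1), 1 - ((p : ℂ) ^ (-s)) ^ j ≠ 0 := by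
      intro j hj h
      have h3 := one_sub_norm_le_norm_one_sub_pow hr
        (norm_prime_cpow_neg_le p zero_le_one hs.le) (hk.trans (Finset.mem_Icc.mp hj).1)
      rw [h, norm_zero] at h3
      linarith
    rw [localFactor, mul_assoc, ← Finset.prod_mul_distrib]
    congr 1
    exact Finset.prod_congr rfl fun j hj => (zpow_mul_ite_eq (he j) (hne j hj)).symm
  rw [funext hfun] at h1
  exact h1.unique h2

end

lemma norm_zpow_le_exp_abs_log {a : ℤ} (ha : a = -1 ∨ a = 0 ∨ a = 1) (z : ℂ) :
    ‖z ^ a‖ ≤ Real.exp |Real.log ‖z‖| := by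
  rcases eq_or_ne z 0 with hz | hz
  · rcases ha with h | h | h <;> simp [h, hz]
  have h0 : 0 < ‖z‖ := norm_pos_iff.mpr hz
  rcases ha with h | h | h
  · rw [h, zpow_neg_one, norm_inv]
    calc ‖z‖⁻¹ = Real.exp (-Real.log ‖z‖) := by rw [Real.exp_neg, Real.exp_log h0]
      _ ≤ _ := Real.exp_le_exp.mpr (neg_le_abs _)
  · rw [h, zpow_zero, norm_one]
    exact Real.one_le_exp (abs_nonneg _)
  · rw [h, zpow_one]
    calc ‖z‖ = Real.exp (Real.log ‖z‖) := (Real.exp_log h0).symm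
      _ ≤ _ := Real.exp_le_exp.mpr (le_abs_self _)

section

variable (hRH : ∀ ρ : ℂ, riemannZeta ρ = 0 → 0 < ρ.re → ρ.re < 1 → ρ.re = 1 / 2) {k : ℕ}

include hRH

lemma exists_abs_log_norm_zeta_mul_le (hk : 1 ≤ k) :
    ∃ C : ℝ, 0 < C ∧ ∀ l : ℝ, 2 * (k : ℝ) ≤ l → ∀ j ∈ Finset.Icc k (2 * k - 1), ∀ s : ℂ,
      1 / (2 * k : ℝ) + 4 / l ≤ s.re → 1 / (4 * k : ℝ) ≤ ‖j * s - 1‖ →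
      |Real.log ‖riemannZeta (j * s)‖| ≤
        C * (Real.log (|s.im| + 3) / l + Real.exp (2 * l)) := by
  obtain ⟨C, hC, h⟩ := exists_abs_log_norm_zetaReg_le hRH
  refine ⟨8 * k + 2 * C, by positivity, fun l hl j hj s hs hjs => ?_⟩
  have hk' : (1 : ℝ) ≤ k := by exact_mod_cast hk
  have hl0 : 0 < l := by linarith
  have hjk : (k : ℝ) ≤ j := by exact_mod_cast (Finset.mem_Icc.mp hj).1
  have hjk2 : (j : ℝ) ≤ 2 * k := by
    have := (Finset.mem_Icc.mp hj).2
    exact_mod_cast (show j ≤ 2 * k by omega)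
  set w : ℂ := j * s with hw
  have h4 : 0 < 4 / l := by positivity
  have hwre : 1 / 2 + 4 / l ≤ w.re := by
    have e1 : w.re = j * s.re := by simp [hw]
    rw [e1]
    have e2 : (k : ℝ) * (1 / (2 * k : ℝ)) = 1 / 2 := by field_simp
    have hs0 : 0 ≤ 1 / (2 * k : ℝ) + 4 / l := by positivity
    calc 1 / 2 + 4 / l ≤ k * (1 / (2 * k : ℝ) + 4 / l) := by
          rw [mul_add, e2]
          nlinarith
      _ ≤ j * s.re := mul_le_mul hjk hs hs0 (by linarith)
  have hwim : |w.im| ≤ 2 * k * |s.im| := by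
    have e1 : w.im = j * s.im := by simp [hw]
    rw [e1, abs_mul, Nat.abs_cast]
    gcongr
  have hk4 : (0 : ℝ) < 1 / (4 * k : ℝ) := by positivity
  have hw1 : w - 1 ≠ 0 := fun h => by rw [h, norm_zero] at hjs; linarith
  have hZ : zetaReg w ≠ 0 := zetaReg_ne_zero hRH (by linarith)
  obtain ⟨-, hn1, hn2⟩ := norm_le_norm_add_one (s := w) (by linarith)
  have hm : 0 < ‖w - 1‖ := norm_pos_iff.mpr hw1
  have hlog1 : Real.log ‖riemannZeta w‖ =
      Real.log (‖w + 1‖ / ‖w - 1‖) + Real.log ‖zetaReg w‖ := by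
    rw [riemannZeta_eq_zetaReg (sub_ne_zero.mp hw1) (by linarith), norm_mul, norm_div,
      Real.log_mul (by positivity) (norm_ne_zero_iff.mpr hZ)]
  have hr1 : 1 ≤ ‖w + 1‖ / ‖w - 1‖ := by rwa [one_le_div hm]
  have hr2 : ‖w + 1‖ / ‖w - 1‖ ≤ 1 + 8 * k := by
    rw [div_le_iff₀ hm]
    have e1 : ‖w + 1‖ ≤ ‖w - 1‖ + 2 := by
      calc ‖w + 1‖ = ‖(w - 1) + 2‖ := by ring_nf
        _ ≤ _ := (norm_add_le _ _).trans (by simp)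
    have e2 : 1 ≤ 4 * k * ‖w - 1‖ := by
      rw [div_le_iff₀ (by positivity)] at hjs
      linarith
    linarith
  have hlogr : |Real.log (‖w + 1‖ / ‖w - 1‖)| ≤ 8 * k := by
    rw [abs_of_nonneg (Real.log_nonneg hr1)]
    linarith [Real.log_le_sub_one_of_pos (zero_lt_one.trans_le hr1)]
  have hZb := h l (by linarith) w hwre
  have hlogt : Real.log (|w.im| + 3) ≤ 2 * k + Real.log (|s.im| + 3) := by
    have e1 : |w.im| + 3 ≤ 2 * k * (|s.im| + 3) := by
      nlinarith [abs_nonneg s.im]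
    calc Real.log (|w.im| + 3) ≤ Real.log (2 * k * (|s.im| + 3)) :=
          Real.log_le_log (by positivity) e1
      _ = Real.log (2 * k) + Real.log (|s.im| + 3) :=
          Real.log_mul (by positivity) (by positivity)
      _ ≤ _ := by linarith [Real.log_le_sub_one_of_pos (show (0 : ℝ) < 2 * k by positivity)]
  have hexp : 1 ≤ Real.exp (2 * l) := Real.one_le_exp (by linarith)
  have hdiv : Real.log (|w.im| + 3) / l ≤ 1 + Real.log (|s.im| + 3) / l := by
    rw [div_le_iff₀ hl0, add_mul, div_mul_cancel₀ _ hl0.ne']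
    linarith
  have hnn : 0 ≤ Real.log (|s.im| + 3) / l := by
    have := one_le_log_abs_add_three s.im
    positivity
  rw [hlog1]
  refine (abs_add_le _ _).trans ((add_le_add hlogr hZb).trans ?_)
  have := mul_le_mul_of_nonneg_left hdiv hC.le
  nlinarith [mul_nonneg hC.le hnn, mul_nonneg hC.le (sub_nonneg.mpr hexp),
    mul_nonneg (show (0 : ℝ) ≤ 8 * k by positivity) hnn,
    mul_nonneg (show (0 : ℝ) ≤ 8 * k by positivity) (sub_nonneg.mpr hexp)]

lemma exists_norm_eulerRemainder_mul_prod_le {e : ℕ → ℤ}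
    (he : ∀ j, e j = -1 ∨ e j = 0 ∨ e j = 1) (he0 : e 0 = 1)
    (hk : 1 ≤ k) (hzero : ∀ j, 1 ≤ j → j ≤ k - 1 → e j = 0) (c : ℕ → ℂ) :
    ∃ C : ℝ, 0 < C ∧ ∀ l : ℝ, 8 * (k : ℝ) ≤ l → ∀ s : ℂ, 1 / (2 * k : ℝ) + 4 / l ≤ s.re →
      (∀ j ∈ Finset.Icc k (2 * k - 1), 1 / (4 * k : ℝ) ≤ ‖j * s - 1‖) →
      ‖eulerRemainder e k s * ∏ j ∈ Finset.Icc k (2 * k - 1), riemannZeta (j * s) ^ (e j) -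
        ∑ j ∈ Finset.Icc k (2 * k - 1), c j * riemannZeta (j * s)‖ ≤
        Real.exp (C * (Real.log (|s.im| + 3) / l + Real.exp (2 * l))) := by
  obtain ⟨A, hA, hAb⟩ := exists_abs_log_norm_zeta_mul_le hRH hk
  obtain ⟨B, hB, hBb⟩ := exists_norm_eulerRemainder_le he he0 hk hzero
  set J := Finset.Icc k (2 * k - 1) with hJ
  set D : ℝ := ∑ j ∈ J, ‖c j‖ with hD
  have hD0 : 0 ≤ D := Finset.sum_nonneg fun _ _ => norm_nonneg _
  refine ⟨B + J.card * A + A + D, by positivity, fun l hl s hs hjs => ?_⟩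
  have hk' : (1 : ℝ) ≤ k := by exact_mod_cast hk
  set X : ℝ := Real.log (|s.im| + 3) / l + Real.exp (2 * l) with hX
  have hl0 : 0 < l := by linarith
  have hexp : l ≤ Real.exp (2 * l) := by linarith [Real.add_one_le_exp (2 * l)]
  have hnn : 0 ≤ Real.log (|s.im| + 3) / l := by
    have := one_le_log_abs_add_three s.im
    positivity
  have hlX : l ≤ X := by linarith
  have hX1 : 1 ≤ X := by linarith
  have hz : ∀ j ∈ J, |Real.log ‖riemannZeta (j * s)‖| ≤ A * X := fun j hj =>
    hAb l (by linarith) j hj s hs (hjs j hj)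
  have h1 : ‖eulerRemainder e k s * ∏ j ∈ J, riemannZeta (j * s) ^ (e j)‖ ≤
      Real.exp ((B + J.card * A) * X) := by
    rw [norm_mul, norm_prod]
    calc _ ≤ Real.exp (B * l) * ∏ j ∈ J, Real.exp (A * X) := by
          refine mul_le_mul (hBb l hl s hs) (Finset.prod_le_prod (fun _ _ => norm_nonneg _)
            fun j hj => (norm_zpow_le_exp_abs_log (he j) _).trans
              (Real.exp_le_exp.mpr (hz j hj))) (by positivity) (by positivity)
      _ = Real.exp (B * l + J.card * (A * X)) := by
          rw [Finset.prod_const, ← Real.exp_nat_mul, Real.exp_add]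
      _ ≤ _ := by
          refine Real.exp_le_exp.mpr ?_
          nlinarith [mul_le_mul_of_nonneg_left hlX hB.le]
  have h2 : ‖∑ j ∈ J, c j * riemannZeta (j * s)‖ ≤ D * Real.exp (A * X) := by
    rw [hD, Finset.sum_mul]
    refine norm_sum_le_of_le _ fun j hj => ?_
    rw [norm_mul]
    refine mul_le_mul_of_nonneg_left ?_ (norm_nonneg _)
    have := norm_zpow_le_exp_abs_log (a := 1) (by simp) (riemannZeta (j * s))
    rw [zpow_one] at this
    exact this.trans (Real.exp_le_exp.mpr (hz j hj))
  have hAX : 0 ≤ A * X := by positivity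
  have hBX : 0 ≤ (B + J.card * A) * X := by positivity
  calc _ ≤ Real.exp ((B + J.card * A) * X) + D * Real.exp (A * X) :=
        (norm_sub_le _ _).trans (add_le_add h1 h2)
    _ ≤ Real.exp ((B + J.card * A + A) * X) + D * Real.exp ((B + J.card * A + A) * X) := by
        exact add_le_add (Real.exp_le_exp.mpr (by linarith)) (mul_le_mul_of_nonneg_left
          (Real.exp_le_exp.mpr (by linarith)) hD0)
    _ = Real.exp ((B + J.card * A + A) * X) * (1 + D) := by ring
    _ ≤ Real.exp ((B + J.card * A + A) * X) * Real.exp (D * X) := by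
        refine mul_le_mul_of_nonneg_left ?_ (Real.exp_nonneg _)
        have := Real.add_one_le_exp (D * X)
        nlinarith
    _ = _ := by rw [← Real.exp_add]; congr 1; ring

end

lemma le_norm_natCast_mul_sub_one_of_one_le {k : ℕ} (hk : 1 ≤ k) {j : ℕ}
    (hj : j ∈ Finset.Icc k (2 * k - 1)) {s : ℂ} (hs : 1 ≤ |s.im|) :
    1 / (4 * k : ℝ) ≤ ‖j * s - 1‖ := by
  have hk' : (1 : ℝ) ≤ k := by exact_mod_cast hk
  have hj1 : (1 : ℝ) ≤ j := by exact_mod_cast hk.trans (Finset.mem_Icc.mp hj).1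
  have h := Complex.abs_im_le_norm (j * s - 1)
  have e1 : (j * s - 1).im = j * s.im := by simp
  rw [e1, abs_mul, Nat.abs_cast] at h
  have : 1 / (4 * k : ℝ) ≤ 1 := by rw [div_le_one (by positivity)]; linarith
  nlinarith

lemma le_norm_natCast_mul_sub_one_of_re_eq {k : ℕ} (hk : 1 ≤ k) {j : ℕ}
    (hj : j ∈ Finset.Icc k (2 * k - 1)) {l : ℝ} (hl : 32 * (k : ℝ) ^ 2 ≤ l) {s : ℂ}
    (hs : s.re = 1 / (2 * k : ℝ) + 4 / l) : 1 / (4 * k : ℝ) ≤ ‖j * s - 1‖ := by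
  have hk' : (1 : ℝ) ≤ k := by exact_mod_cast hk
  have hl0 : 0 < l := lt_of_lt_of_le (by positivity) hl
  have hj1 : (j : ℝ) + 1 ≤ 2 * k := by
    have := (Finset.mem_Icc.mp hj).2
    exact_mod_cast (show j + 1 ≤ 2 * k by omega)
  have h := (neg_le_abs _).trans (Complex.abs_re_le_norm (j * s - 1))
  have e1 : (j * s - 1).re = j * s.re - 1 := by simp
  rw [e1, hs] at h
  refine le_trans ?_ h
  have h4 : 4 / l ≤ 1 / (8 * k ^ 2 : ℝ) := by
    rw [div_le_div_iff₀ hl0 (by positivity)]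
    linarith
  have h5 : 0 < 4 / l := by positivity
  have h6 : (j : ℝ) * (1 / (2 * k : ℝ) + 4 / l) ≤
      (2 * k - 1) * (1 / (2 * k)) + 2 * k * (1 / (8 * k ^ 2 : ℝ)) := by
    rw [mul_add]
    gcongr <;> linarith
  have h7 : (2 * k - 1) * (1 / (2 * k)) + 2 * k * (1 / (8 * k ^ 2 : ℝ)) =
      1 - 1 / (4 * k : ℝ) := by
    field_simp
    ring
  linarith

lemma exists_partialFractions {Ω : Set ℂ} (hΩ : IsOpen Ω) {M : ℂ → ℂ}
    (hM : DifferentiableOn ℂ M Ω) (J : Finset ℕ)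
    (hJ : ∀ j ∈ J, j ≠ 0 ∧ (1 / (j : ℂ)) ∈ Ω) :
    ∃ (c : ℕ → ℂ) (E : ℂ → ℂ), DifferentiableOn ℂ E Ω ∧
      ∀ s ∈ Ω, (∀ j ∈ J, (j : ℂ) * s - 1 ≠ 0) →
        M s / ∏ j ∈ J, ((j : ℂ) * s - 1) = E s + ∑ j ∈ J, c j / ((j : ℂ) * s - 1) := by
  classical
  induction J using Finset.induction_on with
  | empty => exact ⟨0, M, hM, fun s _ _ => by simp⟩
  | insert i J hi ih =>
    obtain ⟨c, E, hE, h⟩ := ih fun j hj => hJ j (Finset.mem_insert_of_mem hj)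
    obtain ⟨hi0, hiΩ⟩ := hJ i (Finset.mem_insert_self i J)
    have hi0' : (i : ℂ) ≠ 0 := by exact_mod_cast hi0
    refine ⟨fun j => if j = i then E (1 / i) - ∑ j ∈ J, c j * (i / ((i : ℂ) - j))
      else c j * (j / ((i : ℂ) - j)), fun s => dslope E (1 / i) s / i, ?_, fun s hs hne => ?_⟩
    · exact ((Complex.differentiableOn_dslope (hΩ.mem_nhds hiΩ)).mpr hE).div_const _
    have hnei := hne i (Finset.mem_insert_self i J)
    have hneJ : ∀ j ∈ J, (j : ℂ) * s - 1 ≠ 0 := fun j hj => hne j (Finset.mem_insert_of_mem hj)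
    have hsi : s ≠ 1 / i := by
      rintro rfl
      exact hnei (by field_simp; ring)
    have hsum : ∑ j ∈ J, (if j = i then E (1 / i) - ∑ j ∈ J, c j * (i / ((i : ℂ) - j))
        else c j * (j / ((i : ℂ) - j))) / ((j : ℂ) * s - 1) =
        ∑ j ∈ J, c j * (j / ((i : ℂ) - j)) / ((j : ℂ) * s - 1) :=
      Finset.sum_congr rfl fun j hj => by
        rw [if_neg (fun hji : j = i => hi (hji ▸ hj))]
    have hfrac : (∑ j ∈ J, c j / ((j : ℂ) * s - 1)) / ((i : ℂ) * s - 1) =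
        ∑ j ∈ J, c j * (j / ((i : ℂ) - j)) / ((j : ℂ) * s - 1) -
          (∑ j ∈ J, c j * (i / ((i : ℂ) - j))) / ((i : ℂ) * s - 1) := by
      rw [Finset.sum_div, Finset.sum_div, ← Finset.sum_sub_distrib]
      refine Finset.sum_congr rfl fun j hj => ?_
      have h1 := hneJ j hj
      have h2 : (i : ℂ) - j ≠ 0 := by
        rw [sub_ne_zero]
        exact_mod_cast fun hij : i = j => hi (hij ▸ hj)
      rw [mul_div_assoc', mul_div_assoc', div_div, div_div, div_div,
        div_sub_div _ _ (mul_ne_zero h2 h1) (mul_ne_zero h2 hnei),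
        div_eq_div_iff (mul_ne_zero h1 hnei)
          (mul_ne_zero (mul_ne_zero h2 h1) (mul_ne_zero h2 hnei))]
      ring
    have hslope : dslope E (1 / i) s / i =
        E s / ((i : ℂ) * s - 1) - E (1 / i) / ((i : ℂ) * s - 1) := by
      have h3 : s - 1 / i ≠ 0 := sub_ne_zero.mpr hsi
      have h4 : (i : ℂ) * s - 1 = i * (s - 1 / i) := by field_simp
      rw [dslope_of_ne _ hsi, slope_def_field, h4]
      field_simp
    rw [Finset.prod_insert hi, Finset.sum_insert hi, hsum]
    simp only [if_true]
    rw [mul_comm _ (∏ j ∈ J, _), ← div_div, h s hs hneJ, add_div, hfrac, hslope]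
    ring

/-- The function `ζ(w) - 1 / (w - 1)`, extended holomorphically to `w = 1`. -/
noncomputable def zetaSubPole : ℂ → ℂ := dslope (fun w => (w + 1) * zetaReg w) 1

lemma zetaSubPole_eq {w : ℂ} (hw : w ≠ 1) (hw' : -1 < w.re) :
    zetaSubPole w = riemannZeta w - 1 / (w - 1) := by
  have h1 : w - 1 ≠ 0 := sub_ne_zero.mpr hw
  rw [zetaSubPole, dslope_of_ne _ hw, slope_def_field, zetaReg_one,
    riemannZeta_eq_zetaReg hw hw']
  field_simp
  ring

lemma differentiableAt_zetaSubPole {w : ℂ} (hw : -1 < w.re) :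
    DifferentiableAt ℂ zetaSubPole w := by
  have hopen : IsOpen {z : ℂ | -1 < z.re} := isOpen_lt continuous_const Complex.continuous_re
  have h : DifferentiableOn ℂ zetaSubPole {z : ℂ | -1 < z.re} := by
    refine (Complex.differentiableOn_dslope (hopen.mem_nhds ?_)).mpr fun z hz => ?_
    · simp
    · exact (DifferentiableAt.mul (by fun_prop)
        (differentiableAt_zetaReg hz)).differentiableWithinAt
  exact h.differentiableAt (hopen.mem_nhds hw)

lemma exists_holomorphic_extension
    (hRH : ∀ ρ : ℂ, riemannZeta ρ = 0 → 0 < ρ.re → ρ.re < 1 → ρ.re = 1 / 2)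
    {e : ℕ → ℤ} {k : ℕ}
    (he : ∀ j, e j = -1 ∨ e j = 0 ∨ e j = 1) (he0 : e 0 = 1)
    (hk : 1 ≤ k) (hzero : ∀ j, 1 ≤ j → j ≤ k - 1 → e j = 0) :
    ∃ (c : ℕ → ℂ) (G : ℂ → ℂ), DifferentiableOn ℂ G {s | 1 / (2 * k : ℝ) < s.re} ∧
      ∀ s : ℂ, 1 / (2 * k : ℝ) < s.re → (∀ j ∈ Finset.Icc k (2 * k - 1), (j : ℂ) * s - 1 ≠ 0) →
        G s = eulerRemainder e k s *
          ∏ j ∈ Finset.Icc k (2 * k - 1), riemannZeta (j * s) ^ (e j) -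
          ∑ j ∈ Finset.Icc k (2 * k - 1), c j * riemannZeta (j * s) := by
  set J := Finset.Icc k (2 * k - 1) with hJ
  set Ω : Set ℂ := {s | 1 / (2 * k : ℝ) < s.re} with hΩ
  have hopen : IsOpen Ω := isOpen_lt continuous_const Complex.continuous_re
  have hk' : (1 : ℝ) ≤ k := by exact_mod_cast hk
  have hre : ∀ s ∈ Ω, ∀ j ∈ J, 1 / 2 < ((j : ℂ) * s).re := by
    intro s hs j hj
    have hs : 1 / (2 * k : ℝ) < s.re := hs
    have hjk : (k : ℝ) ≤ j := by exact_mod_cast (Finset.mem_Icc.mp hj).1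
    have e1 : ((j : ℂ) * s).re = j * s.re := by simp
    have e2 : (k : ℝ) * (1 / (2 * k : ℝ)) = 1 / 2 := by field_simp
    have h0 : (0 : ℝ) < 1 / (2 * k : ℝ) := by positivity
    rw [e1, ← e2]
    calc (k : ℝ) * (1 / (2 * k : ℝ)) < k * s.re := by gcongr
      _ ≤ j * s.re := by gcongr; exact (h0.trans hs).le
  let fac : ℕ → ℂ → ℂ := fun j s =>
    if e j = 1 then (j * s + 1) * zetaReg (j * s)
    else if e j = -1 then (j * s - 1) ^ 2 / ((j * s + 1) * zetaReg (j * s)) else j * s - 1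
  have hfacd : ∀ j ∈ J, DifferentiableOn ℂ (fac j) Ω := by
    intro j hj s hs
    have h1 := hre s hs j hj
    have hd : DifferentiableAt ℂ (fun s : ℂ => zetaReg (j * s)) s :=
      (differentiableAt_zetaReg (by linarith)).comp s (by fun_prop)
    refine DifferentiableAt.differentiableWithinAt ?_
    simp only [fac]
    split_ifs
    · exact DifferentiableAt.mul (by fun_prop) hd
    · exact DifferentiableAt.div (by fun_prop) (DifferentiableAt.mul (by fun_prop) hd)
        (mul_ne_zero (add_one_ne_zero_of_re (by linarith)) (zetaReg_ne_zero hRH h1))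
    · fun_prop
  have hfac : ∀ j ∈ J, ∀ s ∈ Ω, (j : ℂ) * s - 1 ≠ 0 →
      fac j s / (j * s - 1) = riemannZeta (j * s) ^ (e j) := by
    intro j hj s hs hne
    have h1 := hre s hs j hj
    have h2 : (j : ℂ) * s + 1 ≠ 0 := add_one_ne_zero_of_re (by linarith)
    have h3 := zetaReg_ne_zero hRH h1
    rw [riemannZeta_eq_zetaReg (sub_ne_zero.mp hne) (by linarith)]
    rcases he j with h | h | h
    · simp only [fac, h, if_neg (show ¬ ((-1 : ℤ) = 1) by norm_num), if_true, zpow_neg_one]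
      field_simp
    · simp only [fac, h, if_neg (show ¬ ((0 : ℤ) = 1) by norm_num),
        if_neg (show ¬ ((0 : ℤ) = -1) by norm_num), zpow_zero]
      exact div_self hne
    · simp only [fac, h, if_true, zpow_one]
      field_simp
  have hMd : DifferentiableOn ℂ (fun s => eulerRemainder e k s * ∏ j ∈ J, fac j s) Ω :=
    (differentiableOn_eulerRemainder he he0 hk hzero).mul
      (DifferentiableOn.fun_finsetProd fun j hj => hfacd j hj)
  have hJΩ : ∀ j ∈ J, j ≠ 0 ∧ (1 / (j : ℂ)) ∈ Ω := by
    intro j hj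
    have hj' := Finset.mem_Icc.mp hj
    have hj0 : 0 < j := by omega
    refine ⟨hj0.ne', ?_⟩
    have e1 : (1 / (j : ℂ)) = ((1 / (j : ℝ) : ℝ) : ℂ) := by push_cast; rfl
    rw [hΩ, Set.mem_ofPred_eq, e1, Complex.ofReal_re]
    refine one_div_lt_one_div_of_lt (by exact_mod_cast hj0) ?_
    exact_mod_cast (show j < 2 * k by omega)
  obtain ⟨c, E, hE, h⟩ := exists_partialFractions hopen hMd J hJΩ
  refine ⟨c, fun s => E s - ∑ j ∈ J, c j * zetaSubPole (j * s), ?_, fun s hs hne => ?_⟩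
  · refine hE.sub (DifferentiableOn.fun_sum fun j hj s hs => ?_)
    refine DifferentiableAt.differentiableWithinAt (DifferentiableAt.const_mul ?_ _)
    exact (differentiableAt_zetaSubPole (by linarith [hre s hs j hj])).comp s (by fun_prop)
  · have h1 := h s hs hne
    rw [mul_div_assoc, ← Finset.prod_div_distrib,
      Finset.prod_congr rfl fun j hj => hfac j hj s hs (hne j hj)] at h1
    rw [h1, add_sub_assoc, ← Finset.sum_sub_distrib]
    have h2 : ∑ j ∈ J, c j * zetaSubPole (j * s) =
        -∑ j ∈ J, (c j / (j * s - 1) - c j * riemannZeta (j * s)) := by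
      rw [← Finset.sum_neg_distrib]
      refine Finset.sum_congr rfl fun j hj => ?_
      rw [zetaSubPole_eq (sub_ne_zero.mp (hne j hj)) (by linarith [hre s hs j hj])]
      ring
    simp only [h2]
    ring

lemma integrable_abs_add_three_rpow {r : ℝ} (hr : 1 < r) :
    MeasureTheory.Integrable (fun t : ℝ => (|t| + 3) ^ (-r)) := by
  refine (integrable_one_add_abs_rpow hr).mono' ?_ (Eventually.of_forall fun t => ?_)
  · refine Continuous.aestronglyMeasurable ?_
    exact Continuous.rpow_const (by fun_prop) fun t => Or.inl (by positivity)
  · rw [Real.norm_of_nonneg (by positivity)]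
    exact Real.rpow_le_rpow_of_nonpos (by positivity) (by linarith) (by linarith)

lemma integral_abs_add_three_rpow_le {δ : ℝ} (hδ : 0 < δ) :
    ∫ t : ℝ, (|t| + 3) ^ (-(1 + δ)) ≤ 2 / δ := by
  rw [integral_comp_abs (f := fun t => (t + 3) ^ (-(1 + δ)))]
  have h := MeasureTheory.integral_Ioi_of_hasDerivAt_of_tendsto
    (f := fun t : ℝ => -(t + 3) ^ (-δ) / δ) (f' := fun t => (t + 3) ^ (-(1 + δ))) (a := 0) (m := 0)
    ?_ ?_ (integrableOn_add_rpow_Ioi_of_lt (by linarith) (by norm_num)) ?_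
  · rw [h]
    have h3 : (0 + 3 : ℝ) ^ (-δ) ≤ 1 :=
      Real.rpow_le_one_of_one_le_of_nonpos (by norm_num) (by linarith)
    have h4 : (0 + 3 : ℝ) ^ (-δ) / δ ≤ 1 / δ := by gcongr
    have h5 : 2 / δ = 2 * (1 / δ) := by ring
    rw [h5, zero_sub, neg_div, neg_neg]
    linarith
  · refine ContinuousAt.continuousWithinAt ?_
    refine ContinuousAt.div_const (ContinuousAt.neg (ContinuousAt.rpow_const (by fun_prop)
      (Or.inl (by norm_num)))) _
  · intro x hx
    have hx : 0 < x := hx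
    have h1 := ((hasDerivAt_id x).add_const 3).rpow_const (p := -δ)
      (Or.inl (by simp; positivity))
    refine (h1.neg.div_const δ).congr_deriv ?_
    simp only [id, one_mul]
    rw [show -δ - 1 = -(1 + δ) by ring]
    field_simp
  · have h1 : Tendsto (fun t : ℝ => (t + 3) ^ (-δ)) atTop (nhds 0) :=
      (tendsto_rpow_neg_atTop hδ).comp (tendsto_atTop_add_const_right _ _ tendsto_id)
    simpa using (h1.neg.div_const δ)

lemma mul_abs_im_add_three_le_norm {σ : ℝ} (hσ : 0 < σ) (hσ1 : σ ≤ 1) {s : ℂ} (hs : σ ≤ s.re) :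
    σ / 6 * (|s.im| + 3) ≤ ‖s‖ := by
  have h1 := hs.trans (Complex.re_le_norm s)
  have h2 := Complex.abs_im_le_norm s
  nlinarith [abs_nonneg s.im]

lemma norm_integral_mul_perronKernel_le {G : ℂ → ℂ} {σ : ℝ} (hσ : 0 < σ) (hσ1 : σ ≤ 1)
    (hd : DifferentiableOn ℂ G {s | σ ≤ s.re}) {D δ : ℝ} (hδ : 0 < δ) (hδ1 : δ ≤ 1 / 4)
    (hG : ∀ s : ℂ, σ ≤ s.re → (s.re = σ ∨ 1 ≤ |s.im|) → ‖G s‖ ≤ D * (|s.im| + 3) ^ δ)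
    {N : ℕ} (hN : 0 < N) :
    ‖∫ t : ℝ, G ((2 : ℝ) + t * Complex.I) * perronKernel N ((2 : ℝ) + t * Complex.I)‖ ≤
      144 * D / (σ ^ 2 * δ) * ((N : ℝ) + 1) ^ (σ + 2 * δ) := by
  have hD : 0 ≤ D := by
    have h := (norm_nonneg _).trans (hG σ (by simp) (Or.inl (by simp)))
    exact nonneg_of_mul_nonneg_left h (by positivity)
  have hN1 : (1 : ℝ) ≤ (N : ℝ) + 1 := by simp
  have hHd : DifferentiableOn ℂ (fun s => G s * perronKernel N s) {z | σ ≤ z.re ∧ z.re ≤ 2} :=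
    (hd.mono fun z hz => hz.1).mul fun z hz =>
      (differentiableAt_perronKernel hN (hσ.trans_le hz.1)).differentiableWithinAt
  obtain ⟨C, hC⟩ := exists_bound_of_bound_outside (H := G) (S := {z | σ ≤ z.re ∧ z.re ≤ 2})
    (C := D * 3) (R := 4) (r := 1 / 4)
    ((isClosed_le continuous_const Complex.continuous_re).inter
      (isClosed_le Complex.continuous_re continuous_const))
    (hd.continuousOn.mono fun z hz => hz.1) (by
      intro z hz hz4
      have h1 : 1 ≤ |z.im| := by
        have := Complex.norm_le_abs_re_add_abs_im z
        rw [abs_of_nonneg (hσ.le.trans hz.1)] at this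
        linarith [hz.2]
      refine (hG z hz.1 (Or.inr h1)).trans ?_
      rw [mul_assoc]
      refine mul_le_mul_of_nonneg_left ?_ hD
      have h2 := Complex.abs_im_le_norm z
      calc (|z.im| + 3) ^ δ ≤ (3 * (1 + ‖z‖)) ^ δ := by gcongr; linarith
        _ ≤ (3 * (1 + ‖z‖)) ^ (1 / 4 : ℝ) :=
            Real.rpow_le_rpow_of_exponent_le (by linarith [norm_nonneg z]) hδ1
        _ = 3 ^ (1 / 4 : ℝ) * (1 + ‖z‖) ^ (1 / 4 : ℝ) :=
            Real.mul_rpow (by norm_num) (by positivity)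
        _ ≤ 3 ^ (1 : ℝ) * (1 + ‖z‖) ^ (1 / 4 : ℝ) := by
            gcongr <;> norm_num
        _ = _ := by rw [Real.rpow_one])
  have hshift := integral_vertical_eq_of_strip (H := fun s => G s * perronKernel N s)
    (a := σ) (b := 2) (C := |C| * 3 * (2 * ((N : ℝ) + 1) ^ (3 : ℝ) / (σ / 6) ^ 2))
    (by linarith) hHd (by
      intro z h1 h2
      have hz0 : 0 < ‖z‖ := lt_of_lt_of_le (hσ.trans_le h1) (Complex.re_le_norm z)
      have hk := norm_perronKernel_le hN (hσ.trans_le h1) zero_le_one le_rfl (s := z)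
      have hlow := mul_abs_im_add_three_le_norm hσ hσ1 h1
      have hpos : 0 < 1 + |z.im| := by positivity
      have hlow' : σ / 6 * (1 + |z.im|) ≤ ‖z‖ := by nlinarith
      have hup : 1 + ‖z‖ ≤ 3 * (1 + |z.im|) := by
        have := Complex.norm_le_abs_re_add_abs_im z
        rw [abs_of_nonneg (hσ.le.trans h1)] at this
        linarith [abs_nonneg z.im]
      have hk2 : ‖perronKernel N z‖ ≤
          2 * ((N : ℝ) + 1) ^ (3 : ℝ) / (σ / 6) ^ 2 * (1 + |z.im|) ^ (-2 : ℝ) := by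
        refine hk.trans ?_
        rw [Real.rpow_neg hpos.le, ← div_eq_mul_inv, div_div,
          show (1 + 1 : ℝ) = 2 by norm_num]
        refine div_le_div₀ (by positivity) ?_ (by positivity) ?_
        · gcongr
          linarith
        · rw [Real.rpow_two, Real.rpow_two, ← mul_pow]
          gcongr
      have hG2 : ‖G z‖ ≤ |C| * 3 * (1 + |z.im|) ^ (1 / 4 : ℝ) := by
        calc ‖G z‖ ≤ C * (1 + ‖z‖) ^ (1 / 4 : ℝ) := hC z ⟨h1, h2⟩
          _ ≤ |C| * (3 * (1 + |z.im|)) ^ (1 / 4 : ℝ) := by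
              gcongr
              exact le_abs_self C
          _ = |C| * (3 ^ (1 / 4 : ℝ) * (1 + |z.im|) ^ (1 / 4 : ℝ)) := by
              rw [Real.mul_rpow (by norm_num) hpos.le]
          _ ≤ |C| * (3 ^ (1 : ℝ) * (1 + |z.im|) ^ (1 / 4 : ℝ)) := by
              gcongr <;> norm_num
          _ = _ := by rw [Real.rpow_one]; ring
      rw [norm_mul]
      calc ‖G z‖ * ‖perronKernel N z‖ ≤ _ :=
            mul_le_mul hG2 hk2 (norm_nonneg _) (by positivity)
        _ = |C| * 3 * (2 * ((N : ℝ) + 1) ^ (3 : ℝ) / (σ / 6) ^ 2) *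
            ((1 + |z.im|) ^ (1 / 4 : ℝ) * (1 + |z.im|) ^ (-2 : ℝ)) := by ring
        _ ≤ _ := by
            refine mul_le_mul_of_nonneg_left ?_ (by positivity)
            rw [← Real.rpow_add hpos]
            exact Real.rpow_le_rpow_of_exponent_le (by linarith [abs_nonneg z.im]) (by norm_num))
  rw [← hshift]
  refine (MeasureTheory.norm_integral_le_of_norm_le
    (g := fun t => 72 * D / σ ^ 2 * ((N : ℝ) + 1) ^ (σ + 2 * δ) * (|t| + 3) ^ (-(1 + δ)))
    ((integrable_abs_add_three_rpow (by linarith)).const_mul _)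
    (Eventually.of_forall fun t => ?_)).trans ?_
  · set s : ℂ := σ + t * Complex.I with hs
    have hre : s.re = σ := by simp [hs]
    have him : s.im = t := by simp [hs]
    have hk := norm_perronKernel_le hN (s := s) (θ := 2 * δ) (by linarith) (by linarith)
      (by linarith)
    have hlow := mul_abs_im_add_three_le_norm hσ hσ1 hre.ge
    have hG1 := hG s hre.ge (Or.inl hre)
    rw [him] at hlow hG1
    rw [hre] at hk
    have hpos : 0 < |t| + 3 := by positivity
    have ha : σ ^ 2 / 36 ≤ (σ / 6) ^ (1 + 2 * δ) := by
      calc σ ^ 2 / 36 = (σ / 6) ^ (2 : ℝ) := by rw [Real.rpow_two]; ring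
        _ ≤ _ := Real.rpow_le_rpow_of_exponent_ge (by positivity) (by linarith) (by linarith)
    have hk2 : ‖perronKernel N s‖ ≤
        2 * ((N : ℝ) + 1) ^ (σ + 2 * δ) / (σ ^ 2 / 36 * (|t| + 3) ^ (1 + 2 * δ)) := by
      refine hk.trans (div_le_div_of_nonneg_left (by positivity) (by positivity) ?_)
      calc σ ^ 2 / 36 * (|t| + 3) ^ (1 + 2 * δ)
          ≤ (σ / 6) ^ (1 + 2 * δ) * (|t| + 3) ^ (1 + 2 * δ) := by gcongr
        _ = (σ / 6 * (|t| + 3)) ^ (1 + 2 * δ) := (Real.mul_rpow (by positivity) hpos.le).symm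
        _ ≤ _ := by gcongr
    rw [norm_mul]
    calc ‖G s‖ * ‖perronKernel N s‖ ≤ _ := mul_le_mul hG1 hk2 (norm_nonneg _) (by positivity)
      _ = 72 * D / σ ^ 2 * ((N : ℝ) + 1) ^ (σ + 2 * δ) *
          ((|t| + 3) ^ δ / (|t| + 3) ^ (1 + 2 * δ)) := by
          field_simp
          ring
      _ = _ := by
          rw [← Real.rpow_sub hpos]
          congr 2
          ring
  · rw [MeasureTheory.integral_const_mul]
    calc _ ≤ 72 * D / σ ^ 2 * ((N : ℝ) + 1) ^ (σ + 2 * δ) * (2 / δ) := by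
          gcongr
          exact integral_abs_add_three_rpow_le hδ
      _ = _ := by
          field_simp
          ring

open Classical in
/-- The indicator function of the set of `j`-th powers. -/
noncomputable def powIndicator (j n : ℕ) : ℂ := if ∃ m : ℕ, m ^ j = n then 1 else 0

lemma norm_powIndicator_le (j n : ℕ) : ‖powIndicator j n‖ ≤ 1 := by
  rw [powIndicator]
  split_ifs <;> simp

lemma LSeries_powIndicator {j : ℕ} (hj : j ≠ 0) {s : ℂ} (hs : 1 < s.re) :
    LSeries (powIndicator j) s = riemannZeta (j * s) := by
  have hj1 : (1 : ℝ) ≤ j := by exact_mod_cast Nat.one_le_iff_ne_zero.mpr hj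
  have hjs : 1 < ((j : ℂ) * s).re := by
    have e1 : ((j : ℂ) * s).re = j * s.re := by simp
    rw [e1]
    nlinarith
  have hjs0 : (j : ℂ) * s ≠ 0 := by
    intro h
    rw [h, Complex.zero_re] at hjs
    linarith
  rw [zeta_eq_tsum_one_div_nat_cpow hjs, LSeries,
    ← (Nat.pow_left_injective hj).tsum_eq (f := LSeries.term (powIndicator j) s)]
  · congr 1
    ext m
    rcases eq_or_ne m 0 with hm | hm
    · simp [hm, hj, Complex.zero_cpow hjs0]
    · rw [LSeries.term_of_ne_zero (pow_ne_zero _ hm), powIndicator, if_pos ⟨m, rfl⟩,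
        Complex.natCast_cpow_natCast_mul]
      push_cast
      rfl
  · intro n hn
    by_contra h
    refine hn ?_
    have h0 : powIndicator j n = 0 := if_neg fun ⟨m, hm⟩ => h ⟨m, hm⟩
    rcases eq_or_ne n 0 with h1 | h1
    · simp [h1]
    · rw [LSeries.term_of_ne_zero h1, h0, zero_div]

lemma sum_powIndicator {j : ℕ} (hj : j ≠ 0) {x : ℝ} (hx : 0 ≤ x) :
    ∑ n ∈ Finset.Icc 1 ⌊x⌋₊, powIndicator j n = (⌊x ^ (1 / (j : ℝ))⌋₊ : ℂ) := by
  classical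
  simp only [powIndicator]
  rw [Finset.sum_boole]
  congr 1
  have hset : {n ∈ Finset.Icc 1 ⌊x⌋₊ | ∃ m : ℕ, m ^ j = n} =
      (Finset.Icc 1 ⌊x ^ (1 / (j : ℝ))⌋₊).image (fun m => m ^ j) := by
    have key : ∀ m : ℕ, m ^ j ≤ ⌊x⌋₊ ↔ m ≤ ⌊x ^ (1 / (j : ℝ))⌋₊ := by
      intro m
      rw [Nat.le_floor_iff hx, Nat.le_floor_iff (by positivity), one_div,
        Real.le_rpow_inv_iff_of_pos (by positivity) hx (by positivity), Real.rpow_natCast]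
      push_cast
      rfl
    ext n
    simp only [Finset.mem_filter, Finset.mem_Icc, Finset.mem_image]
    constructor
    · rintro ⟨⟨h1, h2⟩, m, rfl⟩
      refine ⟨m, ⟨Nat.pos_of_ne_zero fun h => ?_, (key m).mp h2⟩, rfl⟩
      simp [h, hj] at h1
    · rintro ⟨m, ⟨h1, h2⟩, rfl⟩
      exact ⟨⟨Nat.pow_pos h1, (key m).mpr h2⟩, m, rfl⟩
  rw [hset, Finset.card_image_of_injective _ (Nat.pow_left_injective hj), Nat.card_Icc,
    Nat.add_sub_cancel]

lemma zpow_mul_ite_neg_one_eq {K : Type*} [Field K] {a : ℤ} (ha : a = -1 ∨ a = 0 ∨ a = 1) {x : K}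
    (hx : x ≠ 0) : x ^ a * (if a = -1 then x else 1) = if a = 1 then x else 1 := by
  rcases ha with h | h | h <;> simp [h, hx]

section

variable (hRH : ∀ ρ : ℂ, riemannZeta ρ = 0 → 0 < ρ.re → ρ.re < 1 → ρ.re = 1 / 2)
  {f : ℕ → ℤ} {e : ℕ → ℤ} {k : ℕ} (hf1 : f 1 = 1)
  (hmul : ∀ m n : ℕ, Nat.Coprime m n → f (m * n) = f m * f n)
  (hle : ∀ n, n ≠ 0 → ‖(f n : ℂ)‖ ≤ 1)
  (hfp : ∀ p : ℕ, Nat.Prime p → ∀ j : ℕ, f (p ^ j) = e j)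
  (he : ∀ j, e j = -1 ∨ e j = 0 ∨ e j = 1) (he0 : e 0 = 1)
  (hk : 1 ≤ k) (hzero : ∀ j, 1 ≤ j → j ≤ k - 1 → e j = 0)

include hf1 hmul hle hfp he he0 hk hzero

lemma LSeries_sub_sum_powIndicator (c : ℕ → ℂ) {s : ℂ} (hs : 1 < s.re) :
    LSeries ((fun n => (f n : ℂ)) - ∑ j ∈ Finset.Icc k (2 * k - 1), c j • powIndicator j) s =
      eulerRemainder e k s * ∏ j ∈ Finset.Icc k (2 * k - 1), riemannZeta (j * s) ^ (e j) -
        ∑ j ∈ Finset.Icc k (2 * k - 1), c j * riemannZeta (j * s) := by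
  have hj0 : ∀ j ∈ Finset.Icc k (2 * k - 1), j ≠ 0 := fun j hj => by
    have := (Finset.mem_Icc.mp hj).1
    omega
  have hζ : ∀ j ∈ Finset.Icc k (2 * k - 1), riemannZeta (j * s) ≠ 0 := by
    intro j hj
    have hj1 : (1 : ℝ) ≤ j := by exact_mod_cast Nat.one_le_iff_ne_zero.mpr (hj0 j hj)
    refine riemannZeta_ne_zero_of_one_le_re ?_
    have e1 : ((j : ℂ) * s).re = j * s.re := by simp
    rw [e1]
    nlinarith
  have hF : LSeries (fun n => (f n : ℂ)) s =
      eulerRemainder e k s * ∏ j ∈ Finset.Icc k (2 * k - 1), riemannZeta (j * s) ^ (e j) := by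
    have h := LSeries_mul_prod_eq hf1 hmul hle hfp he he0 hk hzero hs
    have hne : ∏ j ∈ Finset.Icc k (2 * k - 1), (if e j = -1 then riemannZeta (j * s) else 1) ≠ 0 :=
      Finset.prod_ne_zero_iff.mpr fun j hj => by
        split_ifs
        · exact hζ j hj
        · exact one_ne_zero
    refine mul_right_cancel₀ hne ?_
    rw [h, mul_assoc, ← Finset.prod_mul_distrib]
    congr 1
    exact Finset.prod_congr rfl fun j hj => (zpow_mul_ite_neg_one_eq (he j) (hζ j hj)).symm
  have hps : ∀ j ∈ Finset.Icc k (2 * k - 1), LSeriesSummable (c j • powIndicator j) s :=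
    fun j _ => (LSeriesSummable_of_bounded_of_one_lt_re
      (fun n _ => norm_powIndicator_le j n) hs).smul _
  rw [LSeries_sub (LSeriesSummable_of_bounded_of_one_lt_re hle hs) (LSeriesSummable.sum hps),
    LSeries_sum hps, hF]
  congr 1
  exact Finset.sum_congr rfl fun j hj => by rw [LSeries_smul, LSeries_powIndicator (hj0 j hj) hs]

include hRH

lemma exists_norm_sum_sub_le :
    ∃ (c : ℕ → ℂ) (C : ℝ), 0 < C ∧ ∀ l : ℝ, C ≤ l → ∀ N : ℕ, 0 < N →
      ‖∑ n ∈ Finset.Icc 1 N, (f n : ℂ) - ∑ j ∈ Finset.Icc k (2 * k - 1),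
        c j * ∑ n ∈ Finset.Icc 1 N, powIndicator j n‖ ≤
        Real.exp (C * Real.exp (2 * l)) * ((N : ℝ) + 1) ^ (1 / (2 * k : ℝ) + C / l) := by
  obtain ⟨c, G, hGd, hG⟩ := exists_holomorphic_extension hRH he he0 hk hzero
  obtain ⟨A, hA, hAb⟩ := exists_norm_eulerRemainder_mul_prod_le hRH he he0 hk hzero c
  have hk' : (1 : ℝ) ≤ k := by exact_mod_cast hk
  have hB : 0 < 576 * (k : ℝ) ^ 2 / A := by positivity
  refine ⟨c, 6 * A + 40 * k ^ 2 + 576 * k ^ 2 / A, by positivity, fun l hl N hN => ?_⟩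
  have hl1 : 32 * (k : ℝ) ^ 2 ≤ l := by nlinarith
  have hl2 : 8 * (k : ℝ) ≤ l := by nlinarith
  have hl0 : 0 < l := by linarith
  set σ : ℝ := 1 / (2 * k : ℝ) + 4 / l with hσ
  have hk0 : 0 < 1 / (2 * k : ℝ) := by positivity
  have hl4 : 0 < 4 / l := by positivity
  have hσ0 : 0 < σ := by positivity
  have hσ1 : σ ≤ 1 := by
    have h1 : 1 / (2 * k : ℝ) ≤ 1 / 2 := by
      rw [div_le_div_iff₀ (by positivity) (by norm_num)]; linarith
    have h2 : 4 / l ≤ 1 / 2 := by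
      rw [div_le_div_iff₀ hl0 (by norm_num)]; linarith
    linarith
  have hδ1 : A / l ≤ 1 / 4 := by
    rw [div_le_div_iff₀ hl0 (by norm_num)]; nlinarith
  have hGb : ∀ s : ℂ, σ ≤ s.re → (s.re = σ ∨ 1 ≤ |s.im|) →
      ‖G s‖ ≤ Real.exp (A * Real.exp (2 * l)) * (|s.im| + 3) ^ (A / l) := by
    intro s hs hor
    have hjs : ∀ j ∈ Finset.Icc k (2 * k - 1), 1 / (4 * k : ℝ) ≤ ‖j * s - 1‖ := fun j hj =>
      hor.elim (fun h => le_norm_natCast_mul_sub_one_of_re_eq hk hj hl1 h)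
        (fun h => le_norm_natCast_mul_sub_one_of_one_le hk hj h)
    have hne : ∀ j ∈ Finset.Icc k (2 * k - 1), (j : ℂ) * s - 1 ≠ 0 := fun j hj h => by
      have h1 := hjs j hj
      rw [h, norm_zero] at h1
      have : 0 < 1 / (4 * k : ℝ) := by positivity
      linarith
    rw [hG s (by linarith) hne]
    refine (hAb l hl2 s hs hjs).trans (le_of_eq ?_)
    rw [Real.rpow_def_of_pos (by positivity), ← Real.exp_add]
    congr 1
    ring
  have hmain := norm_integral_mul_perronKernel_le hσ0 hσ1
    (hGd.mono fun s (hs : σ ≤ s.re) => show 1 / (2 * k : ℝ) < s.re by linarith)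
    (by positivity) hδ1 hGb hN
  set g : ℕ → ℂ := (fun n => (f n : ℂ)) - ∑ j ∈ Finset.Icc k (2 * k - 1), c j • powIndicator j
    with hg
  have hgn : ∀ n, g n = f n - ∑ j ∈ Finset.Icc k (2 * k - 1), c j * powIndicator j n := by
    intro n
    simp [hg, Finset.sum_apply]
  have hgb : ∀ n, ‖g n‖ ≤ (1 + ‖(f 0 : ℂ)‖) + ∑ j ∈ Finset.Icc k (2 * k - 1), ‖c j‖ := by
    intro n
    rw [hgn]
    refine (norm_sub_le _ _).trans (add_le_add ?_ (norm_sum_le_of_le _ fun j _ => ?_))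
    · rcases eq_or_ne n 0 with h | h
      · rw [h]; linarith
      · linarith [hle n h, norm_nonneg (f 0 : ℂ)]
    · rw [norm_mul]
      exact mul_le_of_le_one_right (norm_nonneg _) (norm_powIndicator_le j n)
  have hperron := sum_eq_integral_LSeries_mul_perronKernel hgb hN
  have hGL : ∀ t : ℝ, LSeries g ((2 : ℝ) + t * Complex.I) = G ((2 : ℝ) + t * Complex.I) := by
    intro t
    have hre : ((2 : ℝ) + t * Complex.I : ℂ).re = 2 := by simp
    rw [hg, LSeries_sub_sum_powIndicator hf1 hmul hle hfp he he0 hk hzero c (by rw [hre]; norm_num),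
      hG _ (by rw [hre]; linarith) fun j hj h => ?_]
    have hj1 : (1 : ℝ) ≤ j := by exact_mod_cast hk.trans (Finset.mem_Icc.mp hj).1
    have h1 := congrArg Complex.re h
    have h2 : ((j : ℂ) * ((2 : ℝ) + t * Complex.I) - 1).re = j * 2 - 1 := by simp
    rw [h2, Complex.zero_re] at h1
    linarith
  simp only [hGL] at hperron
  rw [hperron, norm_mul, norm_mul, Complex.norm_ofNat, Complex.norm_real,
    Real.norm_of_nonneg Real.pi_pos.le] at hmain
  have hsum : ∑ n ∈ Finset.Icc 1 N, g n = ∑ n ∈ Finset.Icc 1 N, (f n : ℂ) -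
      ∑ j ∈ Finset.Icc k (2 * k - 1), c j * ∑ n ∈ Finset.Icc 1 N, powIndicator j n := by
    simp only [hgn, Finset.sum_sub_distrib, Finset.mul_sum]
    rw [Finset.sum_comm]
  rw [← hsum]
  have hpi : 1 ≤ 2 * Real.pi := by linarith [Real.pi_gt_three]
  have hN1 : (1 : ℝ) ≤ (N : ℝ) + 1 := by simp
  have hexp : l ≤ Real.exp (2 * l) := by linarith [Real.add_one_le_exp (2 * l)]
  have hconst : 144 * Real.exp (A * Real.exp (2 * l)) / (σ ^ 2 * (A / l)) ≤
      Real.exp ((6 * A + 40 * k ^ 2 + 576 * k ^ 2 / A) * Real.exp (2 * l)) := by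
    have hσk : (1 / (2 * k : ℝ)) ^ 2 ≤ σ ^ 2 := by gcongr; linarith
    calc 144 * Real.exp (A * Real.exp (2 * l)) / (σ ^ 2 * (A / l))
        ≤ 144 * Real.exp (A * Real.exp (2 * l)) / ((1 / (2 * k : ℝ)) ^ 2 * (A / l)) := by
          gcongr
      _ = 576 * k ^ 2 / A * l * Real.exp (A * Real.exp (2 * l)) := by
          field_simp
          ring
      _ ≤ Real.exp (576 * k ^ 2 / A * Real.exp (2 * l)) * Real.exp (A * Real.exp (2 * l)) := by
          gcongr
          have := Real.add_one_le_exp (576 * k ^ 2 / A * Real.exp (2 * l))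
          have := mul_le_mul_of_nonneg_left hexp hB.le
          linarith
      _ = Real.exp ((A + 576 * k ^ 2 / A) * Real.exp (2 * l)) := by
          rw [← Real.exp_add]; congr 1; ring
      _ ≤ _ := by
          refine Real.exp_le_exp.mpr (mul_le_mul_of_nonneg_right ?_ (Real.exp_nonneg _))
          nlinarith
  calc ‖∑ n ∈ Finset.Icc 1 N, g n‖ ≤ 2 * Real.pi * ‖∑ n ∈ Finset.Icc 1 N, g n‖ :=
        le_mul_of_one_le_left (norm_nonneg _) hpi
    _ ≤ _ := hmain
    _ ≤ _ := by
        refine mul_le_mul hconst (Real.rpow_le_rpow_of_exponent_le hN1 ?_) (by positivity)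
          (Real.exp_nonneg _)
        have h1 : σ + 2 * (A / l) = 1 / (2 * k : ℝ) + (4 + 2 * A) / l := by
          rw [hσ]; ring
        rw [h1]
        have h2 : 4 + 2 * A ≤ 6 * A + 40 * k ^ 2 + 576 * k ^ 2 / A := by nlinarith
        gcongr

end

lemma abs_le_one_of_mul_coprime {f : ℕ → ℤ} (hf1 : f 1 = 1)
    (hmul : ∀ m n : ℕ, Nat.Coprime m n → f (m * n) = f m * f n)
    (hfp : ∀ p : ℕ, Nat.Prime p → ∀ j : ℕ, |f (p ^ j)| ≤ 1) {n : ℕ} (hn : n ≠ 0) : |f n| ≤ 1 := by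
  induction n using Nat.recOnPosPrimePosCoprime with
  | prime_pow p n hp _ => exact hfp p hp n
  | zero => exact absurd rfl hn
  | one => simp [hf1]
  | coprime a b ha hb hab iha ihb =>
    rw [hmul a b hab, abs_mul]
    exact mul_le_one₀ (iha (by omega)) (abs_nonneg _) (ihb (by omega))

lemma exp_mul_rpow_le {C k x : ℝ} (hC : 0 < C) (hk : 1 ≤ k) (hx : Real.exp 1 ≤ Real.log x)
    (hx2 : 4 * C ≤ Real.log (Real.log x)) {y : ℝ} (hy0 : 0 ≤ y) (hy : y ≤ 2 * x) :
    Real.exp (C * Real.exp (2 * (Real.log (Real.log x) / 4))) *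
        y ^ (1 / (2 * k) + C / (Real.log (Real.log x) / 4)) ≤
      4 * (x ^ (1 / (2 * k)) * Real.exp (6 * C * (Real.log x / Real.log (Real.log x)))) := by
  set L := Real.log x with hL
  have hL0 : 0 < L := (Real.exp_pos 1).trans_le hx
  have hx0 : 0 < x := by
    rcases eq_or_ne x 0 with h | h
    · rw [hL, h, Real.log_zero] at hL0; exact absurd hL0 (lt_irrefl _)
    · have : 0 ≤ x := by linarith
      exact lt_of_le_of_ne this (Ne.symm h)
  set M := Real.log L with hM
  have hM1 : 1 ≤ M := by
    rw [hM, Real.le_log_iff_exp_le hL0]; exact hx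
  have hM0 : 0 < M := by linarith
  have hsqrt : Real.exp (2 * (M / 4)) ≤ 2 * (L / M) := by
    have e1 : Real.exp (2 * (M / 4)) = L ^ (1 / 2 : ℝ) := by
      rw [Real.rpow_def_of_pos hL0, ← hM]; congr 1; ring
    have h1 : M ≤ L ^ (1 / 2 : ℝ) / (1 / 2) := Real.log_le_rpow_div hL0.le (by norm_num)
    have h2 : L ^ (1 / 2 : ℝ) * L ^ (1 / 2 : ℝ) = L := by
      rw [← Real.rpow_add hL0]; norm_num
    have h3 : 0 < L ^ (1 / 2 : ℝ) := by positivity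
    rw [e1, ← mul_div_assoc, le_div_iff₀ hM0]
    nlinarith
  have hk0 : 0 < 1 / (2 * k) := by positivity
  have hk2 : 1 / (2 * k) ≤ 1 := by rw [div_le_one (by positivity)]; linarith
  set a : ℝ := 1 / (2 * k) + C / (M / 4) with ha
  have ha2 : C / (M / 4) ≤ 1 := by rw [div_le_one (by positivity)]; linarith
  have ha0 : 0 ≤ a := by positivity
  have hxa : y ^ a ≤ 4 * (x ^ (1 / (2 * k)) * Real.exp (4 * C * (L / M))) := by
    calc y ^ a ≤ (2 * x) ^ a := Real.rpow_le_rpow hy0 hy ha0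
      _ = 2 ^ a * x ^ a := Real.mul_rpow (by norm_num) hx0.le
      _ ≤ 2 ^ (2 : ℝ) * x ^ a := by
          gcongr
          · norm_num
          · linarith
      _ = _ := by
          rw [ha, Real.rpow_add hx0, Real.rpow_def_of_pos hx0 (C / (M / 4)), ← hL, Real.rpow_two,
            show L * (C / (M / 4)) = 4 * C * (L / M) by field_simp]
          norm_num
  calc _ ≤ Real.exp (2 * C * (L / M)) *
        (4 * (x ^ (1 / (2 * k)) * Real.exp (4 * C * (L / M)))) := by
        refine mul_le_mul (Real.exp_le_exp.mpr ?_) hxa (by positivity) (Real.exp_nonneg _)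
        nlinarith
    _ = 4 * (x ^ (1 / (2 * k)) * (Real.exp (2 * C * (L / M)) * Real.exp (4 * C * (L / M)))) := by
        ring
    _ = _ := by
        rw [← Real.exp_add]; congr 3; ring

/-- conditional upper bound, Möbius-type or powerfull-type.
Assume the Riemann hypothesis.  If `f` is a fake μ defined via `(ε_j)` with
`ε_j = 0` for `1 ≤ j ≤ k-1` and `ε_k ≠ 0`, where moreover `k ≥ 2` if `ε_k = 1`,
then there are a constant `C > 0` and real polynomials `P_k, …, P_{2k-1}` such
that for all sufficiently large `x`,
`|F_f(x) - Σ_{j=k}^{2k-1} P_j(log x) x^{1/j}| ≤ x^{1/(2k)} exp(C log x / log log x)`. -/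
theorem stmt_14
    (hRH : ∀ ρ : ℂ, riemannZeta ρ = 0 → 0 < ρ.re → ρ.re < 1 → ρ.re = 1 / 2)
    (f : ℕ → ℤ) (ε : ℕ → ℤ)
    (hf1 : f 1 = 1)
    (hmul : ∀ m n : ℕ, Nat.Coprime m n → f (m * n) = f m * f n)
    (hεval : ∀ j : ℕ, 1 ≤ j → ε j = -1 ∨ ε j = 0 ∨ ε j = 1)
    (hfp : ∀ p : ℕ, Nat.Prime p → ∀ j : ℕ, 1 ≤ j → f (p ^ j) = ε j)
    (k : ℕ) (hk : 1 ≤ k)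
    (hzero : ∀ j : ℕ, 1 ≤ j → j ≤ k - 1 → ε j = 0)
    (hεk : ε k ≠ 0)
    (hk2 : ε k = 1 → 2 ≤ k) :
    ∃ C : ℝ, 0 < C ∧ ∃ P : ℕ → Polynomial ℝ, ∀ᶠ x : ℝ in atTop,
      |(∑ n ∈ Finset.Icc 1 ⌊x⌋₊, (f n : ℝ)) -
          ∑ j ∈ Finset.Icc k (2 * k - 1), (P j).eval (Real.log x) * x ^ (1 / (j : ℝ))| ≤
        x ^ (1 / (2 * k : ℝ)) * Real.exp (C * Real.log x / Real.log (Real.log x)) := by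
  obtain ⟨e, he_def⟩ : ∃ e : ℕ → ℤ, ∀ j, e j = f (2 ^ j) := ⟨_, fun _ => rfl⟩
  have he0 : e 0 = 1 := by rw [he_def, pow_zero, hf1]
  have heε : ∀ j, 1 ≤ j → e j = ε j := fun j hj => by rw [he_def, hfp 2 Nat.prime_two j hj]
  have hfpe : ∀ p : ℕ, Nat.Prime p → ∀ j : ℕ, f (p ^ j) = e j := by
    intro p hp j
    rcases Nat.eq_zero_or_pos j with h | h
    · rw [h, pow_zero, hf1, he0]
    · rw [hfp p hp j h, heε j h]
  have he : ∀ j, e j = -1 ∨ e j = 0 ∨ e j = 1 := by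
    intro j
    rcases Nat.eq_zero_or_pos j with h | h
    · rw [h, he0]; simp
    · rw [heε j h]; exact hεval j h
  have hle : ∀ n, n ≠ 0 → ‖(f n : ℂ)‖ ≤ 1 := by
    intro n hn
    have h := abs_le_one_of_mul_coprime hf1 hmul (fun p hp j => by
      rw [hfpe p hp j]
      rcases he j with h | h | h <;> simp [h]) hn
    rw [Complex.norm_intCast]
    exact_mod_cast h
  obtain ⟨c, C, hC, hmain⟩ := exists_norm_sum_sub_le hRH hf1 hmul hle hfpe he he0 hk
    fun j h1 h2 => (heε j h1).trans (hzero j h1 h2)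
  set J := Finset.Icc k (2 * k - 1) with hJ
  set D : ℝ := ∑ j ∈ J, ‖c j‖ with hD
  have hD0 : 0 ≤ D := Finset.sum_nonneg fun _ _ => norm_nonneg _
  refine ⟨6 * C + 4 + D, by positivity, fun j => Polynomial.C (c j).re, ?_⟩
  have hloglog : Tendsto (fun x => Real.log (Real.log x)) atTop atTop :=
    Real.tendsto_log_atTop.comp Real.tendsto_log_atTop
  filter_upwards [eventually_ge_atTop 1, hloglog.eventually_ge_atTop (4 * C),
    Real.tendsto_log_atTop.eventually_ge_atTop (Real.exp 1)] with x hx1 hx2 hx3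
  have hk' : (1 : ℝ) ≤ k := by exact_mod_cast hk
  have hx0 : 0 < x := by linarith
  have hN : 0 < ⌊x⌋₊ := Nat.floor_pos.mpr hx1
  have hb := (hmain (Real.log (Real.log x) / 4) (by linarith) ⌊x⌋₊ hN).trans
    (exp_mul_rpow_le hC hk' hx3 hx2 (by positivity)
      (by linarith [Nat.floor_le hx0.le]))
  set Y := Real.log x / Real.log (Real.log x) with hY
  have hL0 : 0 < Real.log x := (Real.exp_pos 1).trans_le hx3
  have hM1 : 1 ≤ Real.log (Real.log x) := by
    rw [Real.le_log_iff_exp_le hL0]; exact hx3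
  have hY1 : 1 ≤ Y := by
    rw [hY, one_le_div (by linarith)]
    linarith [Real.log_le_sub_one_of_pos hL0]
  have hround : |∑ j ∈ J, (c j).re * ((⌊x ^ (1 / (j : ℝ))⌋₊ : ℝ) - x ^ (1 / (j : ℝ)))| ≤ D := by
    refine (Finset.abs_sum_le_sum_abs _ _).trans (Finset.sum_le_sum fun j _ => ?_)
    rw [abs_mul]
    refine (mul_le_of_le_one_right (abs_nonneg _) ?_).trans (Complex.abs_re_le_norm _)
    have h1 := Nat.floor_le (show 0 ≤ x ^ (1 / (j : ℝ)) by positivity)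
    have h2 := Nat.lt_floor_add_one (x ^ (1 / (j : ℝ)))
    rw [abs_le]
    constructor <;> linarith
  have hre : (∑ n ∈ Finset.Icc 1 ⌊x⌋₊, (f n : ℂ) - ∑ j ∈ J,
      c j * ∑ n ∈ Finset.Icc 1 ⌊x⌋₊, powIndicator j n).re =
      ∑ n ∈ Finset.Icc 1 ⌊x⌋₊, (f n : ℝ) - ∑ j ∈ J, (c j).re * (⌊x ^ (1 / (j : ℝ))⌋₊ : ℝ) := by
    rw [Complex.sub_re, Complex.re_sum, Complex.re_sum]
    congr 1
    refine Finset.sum_congr rfl fun j hj => ?_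
    have hj0 : j ≠ 0 := by
      have := (Finset.mem_Icc.mp hj).1
      omega
    rw [sum_powIndicator hj0 hx0.le]
    simp
  have hb2 := (Complex.abs_re_le_norm _).trans hb
  rw [hre] at hb2
  have hsplit : ∑ n ∈ Finset.Icc 1 ⌊x⌋₊, (f n : ℝ) -
      ∑ j ∈ J, (Polynomial.C (c j).re).eval (Real.log x) * x ^ (1 / (j : ℝ)) =
      (∑ n ∈ Finset.Icc 1 ⌊x⌋₊, (f n : ℝ) - ∑ j ∈ J, (c j).re * (⌊x ^ (1 / (j : ℝ))⌋₊ : ℝ)) +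
      ∑ j ∈ J, (c j).re * ((⌊x ^ (1 / (j : ℝ))⌋₊ : ℝ) - x ^ (1 / (j : ℝ))) := by
    simp only [Polynomial.eval_C, mul_sub, Finset.sum_sub_distrib]
    ring
  rw [hsplit, mul_div_assoc, ← hY]
  set T := x ^ (1 / (2 * k : ℝ)) with hT
  have hT1 : 1 ≤ T := Real.one_le_rpow hx1 (by positivity)
  have hE1 : 1 ≤ Real.exp (6 * C * Y) := Real.one_le_exp (by positivity)
  calc _ ≤ 4 * (T * Real.exp (6 * C * Y)) + D := (abs_add_le _ _).trans (add_le_add hb2 hround)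
    _ ≤ 4 * (T * Real.exp (6 * C * Y)) + D * (T * Real.exp (6 * C * Y)) := by
        have : 1 ≤ T * Real.exp (6 * C * Y) := one_le_mul_of_one_le_of_one_le hT1 hE1
        nlinarith
    _ = T * (Real.exp (6 * C * Y) * (4 + D)) := by ring
    _ ≤ T * (Real.exp (6 * C * Y) * Real.exp ((4 + D) * Y)) := by
        gcongr
        have := Real.add_one_le_exp ((4 + D) * Y)
        nlinarith
    _ = _ := by rw [← Real.exp_add]; congr 2; ring
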